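/- arXiv:2405.11291 — 4 statements merged into one kernel-verified Lean document; each statement's English description precedes it below -/
import Mathlib

section
/- Assume ∫_{(0,1]} z^{α/d} λ(dz) < ∞, and assume that either (a) ∫_{(1,∞)} z^{max(α/d, d/(d+α))} λ(dz) < ∞, or (b) d/(d+α) < α/d and there is a slowly varying function l at infinity with λ̄(r) = l(r)/r^{α/d} for all r ≥ 1. Then for every nonempty bounded Borel set A ⊂ ℝ^d with 0 < |Ā| < ∞, one has lim_{r→∞} η̄_A(r)/τ̄(r) = |Ā| · g(0)^{α/d}. -/
open MeasureTheory Set Filter Topology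
open scoped ENNReal NNReal

/-- `tauBar d α t lam r = τ̄(r)`, where
`τ(B) = (Leb ⊗ λ)({(s,z) ∈ (0,t] × (0,∞) : z·s^{-d/α} ∈ B})` and `τ̄(r) = τ((r,∞))`. -/
noncomputable def tauBar (d : ℕ) (α t : ℝ) (lam : MeasureTheory.Measure ℝ) (r : ℝ) : ℝ≥0∞ :=
  ((MeasureTheory.volume.restrict (Set.Ioc (0:ℝ) t)).prod (lam.restrict (Set.Ioi (0:ℝ))))
    {p : ℝ × ℝ | r < p.2 * p.1 ^ (-((d : ℝ) / α))}

/-- `etaABar d α t g lam A r = η̄_A(r)`, where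
`η_A(B) = (Leb_(0,t] ⊗ Leb_{ℝ^d} ⊗ λ)({(s,y,z) : s^{-d/α} g(d(y,A)/s^{1/α})·z ∈ B})`
and `η̄_A(r) = η_A((r,∞))`. -/
noncomputable def etaABar (d : ℕ) (α t : ℝ) (g : ℝ → ℝ) (lam : MeasureTheory.Measure ℝ)
    (A : Set (EuclideanSpace ℝ (Fin d))) (r : ℝ) : ℝ≥0∞ :=
  ((MeasureTheory.volume.restrict (Set.Ioc (0:ℝ) t)).prod
      ((MeasureTheory.volume : MeasureTheory.Measure (EuclideanSpace ℝ (Fin d))).prod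
        (lam.restrict (Set.Ioi (0:ℝ)))))
    {q : ℝ × EuclideanSpace ℝ (Fin d) × ℝ |
      r < q.1 ^ (-((d : ℝ) / α)) * g (Metric.infDist q.2.1 A / q.1 ^ ((1 : ℝ) / α)) * q.2.2}

/-- `l : (0,∞) → (0,∞)` is slowly varying at infinity if `l(cr)/l(r) → 1` as `r → ∞`
for every `c > 0`. -/
def SlowlyVarying (l : ℝ → ℝ) : Prop :=
  ∀ c : ℝ, 0 < c → Filter.Tendsto (fun r => l (c * r) / l r) Filter.atTop (nhds 1)

/-- The integral `∫ min(t, (z/r)^a) λ(dz)` over `(0,∞)`. -/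
noncomputable def truncMoment (a t : ℝ) (lam : Measure ℝ) (r : ℝ) : ℝ≥0∞ :=
  ∫⁻ z in Ioi (0:ℝ), ENNReal.ofReal (min t ((z / r) ^ a)) ∂lam

/-- The integral `∫ (z/r)^b λ(dz)` over `(κr,∞)`. -/
noncomputable def tailMoment (b : ℝ) (lam : Measure ℝ) (κ r : ℝ) : ℝ≥0∞ :=
  ∫⁻ z in Ioi (κ * r), ENNReal.ofReal ((z / r) ^ b) ∂lam

lemma truncMoment_mul_le {a t κ r : ℝ} (lam : Measure ℝ) (ht : 0 < t) (hκ : 0 < κ)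
    (hr : 0 < r) :
    truncMoment a t lam (κ * r) ≤ ENNReal.ofReal (max 1 (κ⁻¹ ^ a)) * truncMoment a t lam r := by
  unfold truncMoment
  rw [← lintegral_const_mul' _ _ ENNReal.ofReal_ne_top]
  refine setLIntegral_mono' measurableSet_Ioi fun z hz => ?_
  rw [mem_Ioi] at hz
  rw [← ENNReal.ofReal_mul (by positivity)]
  apply ENNReal.ofReal_le_ofReal
  have h1 : (z / (κ * r)) ^ a = κ⁻¹ ^ a * (z / r) ^ a := by
    rw [← Real.mul_rpow (by positivity) (by positivity)]
    congr 1
    field_simp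
  have hp : 0 < (z / r) ^ a := by positivity
  rw [h1, mul_min_of_nonneg _ _ (by positivity)]
  refine le_min ?_ ?_
  · exact (min_le_left _ _).trans (le_mul_of_one_le_left ht.le (le_max_left _ _))
  · exact (min_le_right _ _).trans (mul_le_mul_of_nonneg_right (le_max_right _ _) hp.le)

lemma truncMoment_ne_zero {a t r : ℝ} {lam : Measure ℝ} (ht : 0 < t) (hr : 0 < r)
    (hlam : lam (Ioi 0) ≠ 0) : truncMoment a t lam r ≠ 0 := by
  unfold truncMoment
  intro h
  rw [lintegral_eq_zero_iff (by fun_prop)] at h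
  apply hlam
  rw [Filter.EventuallyEq, ae_restrict_iff' measurableSet_Ioi] at h
  refine measure_mono_null (fun z hz => ?_) h
  rw [mem_Ioi] at hz
  have : 0 < (z / r) ^ a := by positivity
  simp only [mem_compl_iff, mem_ofPred_eq]
  intro hc
  have := hc hz
  simp only [Pi.zero_apply, ENNReal.ofReal_eq_zero, min_le_iff] at this
  rcases this with h | h <;> linarith

lemma truncMoment_ne_top {a t r : ℝ} {lam : Measure ℝ} (hr : 0 < r)
    (hsmall : ∫⁻ z in Ioc (0:ℝ) 1, ENNReal.ofReal (z ^ a) ∂lam ≠ ⊤)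
    (hfin : lam (Ioi 1) ≠ ⊤) : truncMoment a t lam r ≠ ⊤ := by
  unfold truncMoment
  rw [← Ioc_union_Ioi_eq_Ioi (zero_le_one' ℝ)]
  refine ne_top_of_le_ne_top ?_ (lintegral_union_le _ _ _)
  refine ENNReal.add_ne_top.2 ⟨?_, ?_⟩
  · have : ∫⁻ z in Ioc (0:ℝ) 1, ENNReal.ofReal (min t ((z / r) ^ a)) ∂lam ≤
        ENNReal.ofReal (r⁻¹ ^ a) * ∫⁻ z in Ioc (0:ℝ) 1, ENNReal.ofReal (z ^ a) ∂lam := by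
      rw [← lintegral_const_mul' _ _ ENNReal.ofReal_ne_top]
      refine setLIntegral_mono' measurableSet_Ioc fun z hz => ?_
      rw [← ENNReal.ofReal_mul (by positivity)]
      apply ENNReal.ofReal_le_ofReal
      refine (min_le_right _ _).trans (le_of_eq ?_)
      rw [← Real.mul_rpow (by positivity) hz.1.le]
      congr 1
      field_simp
    exact ne_top_of_le_ne_top (ENNReal.mul_ne_top ENNReal.ofReal_ne_top hsmall) this
  · have : ∫⁻ z in Ioi (1:ℝ), ENNReal.ofReal (min t ((z / r) ^ a)) ∂lam ≤
        ENNReal.ofReal t * lam (Ioi 1) := by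
      rw [← setLIntegral_const]
      exact setLIntegral_mono' measurableSet_Ioi fun z hz =>
        ENNReal.ofReal_le_ofReal (min_le_left _ _)
    exact ne_top_of_le_ne_top (ENNReal.mul_ne_top ENNReal.ofReal_ne_top hfin) this

lemma tailMoment_eq {b κ r : ℝ} (lam : Measure ℝ) (hκ : 0 < κ) (hr : 0 < r) :
    tailMoment b lam κ r = ENNReal.ofReal (κ ^ b) * tailMoment b lam 1 (κ * r) := by
  unfold tailMoment
  rw [← lintegral_const_mul' _ _ ENNReal.ofReal_ne_top, one_mul]
  refine setLIntegral_congr_fun measurableSet_Ioi fun z hz => ?_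
  rw [mem_Ioi] at hz
  have hz0 : 0 < z := lt_trans (by positivity) hz
  rw [← ENNReal.ofReal_mul (by positivity), ← Real.mul_rpow (by positivity) (by positivity)]
  congr 2
  field_simp

/-- The tail moment of `λ` is negligible compared with the truncated moment. -/
def TailNegligible (a b t : ℝ) (lam : Measure ℝ) (κ : ℝ) : Prop :=
  Tendsto (fun r => tailMoment b lam κ r / truncMoment a t lam r) atTop (𝓝 0)

lemma TailNegligible.of_one {a b t κ : ℝ} {lam : Measure ℝ} (ht : 0 < t)
    (hκ : 0 < κ) (h : TailNegligible a b t lam 1) : TailNegligible a b t lam κ := by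
  unfold TailNegligible at *
  have h1 := h.comp (tendsto_id.const_mul_atTop hκ)
  set K := ENNReal.ofReal (max 1 (κ⁻¹ ^ a)) with hK
  have hK0 : K ≠ 0 := by
    rw [hK, Ne, ENNReal.ofReal_eq_zero, not_le]
    positivity
  have hKt : K ≠ ⊤ := ENNReal.ofReal_ne_top
  have h2 := ENNReal.Tendsto.const_mul (a := ENNReal.ofReal (κ ^ b) * K) h1
    (Or.inr (ENNReal.mul_ne_top ENNReal.ofReal_ne_top hKt))
  rw [mul_zero] at h2
  refine tendsto_of_tendsto_of_tendsto_of_le_of_le' tendsto_const_nhds h2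
    (Eventually.of_forall fun _ => zero_le) ?_
  filter_upwards [eventually_gt_atTop 0] with r hr
  simp only [Function.comp_apply, id_eq]
  rw [tailMoment_eq lam hκ hr, mul_assoc, mul_div_assoc]
  gcongr
  calc tailMoment b lam 1 (κ * r) / truncMoment a t lam r
      = K * (tailMoment b lam 1 (κ * r) / (K * truncMoment a t lam r)) := by
        rw [← mul_div_assoc, ENNReal.mul_div_mul_left _ _ hK0 hKt]
    _ ≤ _ := by
        gcongr
        exact truncMoment_mul_le lam ht hκ hr

lemma exists_rpow_threshold {a t c : ℝ} (ha : 0 < a) (ht : 0 < t) (hc : 0 < c) :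
    ∃ κ : ℝ, 0 < κ ∧ κ ^ a ≤ t ∧ c ^ a * κ ^ a ≤ t := by
  have hca : 0 < c ^ a := by positivity
  have hm : 0 < min t (t / c ^ a) := lt_min ht (by positivity)
  refine ⟨min t (t / c ^ a) ^ a⁻¹, by positivity, ?_, ?_⟩
  · rw [Real.rpow_inv_rpow hm.le ha.ne']
    exact min_le_left _ _
  · rw [Real.rpow_inv_rpow hm.le ha.ne', ← le_div_iff₀' hca]
    exact min_le_right _ _

lemma tendsto_truncMoment_div {a b t c : ℝ} {lam : Measure ℝ} (ha : 0 < a) (hb : 0 < b)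
    (ht : 0 < t) (hc : 0 < c) (hlam : lam (Ioi 0) ≠ 0)
    (hsmall : ∫⁻ z in Ioc (0:ℝ) 1, ENNReal.ofReal (z ^ a) ∂lam ≠ ⊤)
    (hfin : lam (Ioi 1) ≠ ⊤) (h : ∀ κ, 0 < κ → TailNegligible a b t lam κ) :
    Tendsto (fun r => truncMoment a t lam (r / c) / truncMoment a t lam r) atTop
      (𝓝 (ENNReal.ofReal (c ^ a))) := by
  obtain ⟨κ, hκ, hκ1, hκ2⟩ := exists_rpow_threshold ha ht hc
  have hca : 0 < c ^ a := by positivity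
  set K := ENNReal.ofReal (max 1 (c ^ a) * t * (κ ^ b)⁻¹) with hK
  have hpow : ∀ z r : ℝ, 0 < z → 0 < r → (z / (r / c)) ^ a = c ^ a * (z / r) ^ a := by
    intro z r hz hr
    rw [← Real.mul_rpow (by positivity) (by positivity)]
    congr 1
    field_simp
  have hsplit : ∀ r, 0 < r → ∀ p q : ℝ → ℝ, (∀ z, 0 < z → z ≤ κ * r → p z ≤ q z) →
      (∀ z, κ * r < z → p z ≤ max 1 (c ^ a) * t) → Measurable q →
      ∫⁻ z in Ioi (0:ℝ), ENNReal.ofReal (p z) ∂lam ≤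
        ∫⁻ z in Ioi (0:ℝ), ENNReal.ofReal (q z) ∂lam + K * tailMoment b lam κ r := by
    intro r hr p q hle hgt hq
    have hF : K * tailMoment b lam κ r = ∫⁻ z in Ioi (0:ℝ),
        (Ioi (κ * r)).indicator (fun z => K * ENNReal.ofReal ((z / r) ^ b)) z ∂lam := by
      rw [setLIntegral_indicator measurableSet_Ioi, Ioi_inter_Ioi,
        sup_of_le_left (by positivity), lintegral_const_mul' _ _ ENNReal.ofReal_ne_top]
      rfl
    rw [hF, ← lintegral_add_left (by fun_prop)]
    refine setLIntegral_mono' measurableSet_Ioi fun z hz => ?_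
    rw [mem_Ioi] at hz
    by_cases hzr : z ≤ κ * r
    · exact (ENNReal.ofReal_le_ofReal (hle z hz hzr)).trans le_self_add
    · rw [not_le] at hzr
      refine le_add_left ?_
      rw [indicator_of_mem (by exact hzr), ← ENNReal.ofReal_mul (by positivity)]
      apply ENNReal.ofReal_le_ofReal
      refine (hgt z hzr).trans ?_
      have h1 : κ ^ b ≤ (z / r) ^ b :=
        Real.rpow_le_rpow hκ.le ((le_div_iff₀ hr).2 hzr.le) hb.le
      have h2 : 0 < κ ^ b := by positivity
      rw [mul_assoc _ (κ ^ b)⁻¹]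
      refine le_mul_of_one_le_right (by positivity) ?_
      rw [inv_mul_eq_div, one_le_div h2]
      exact h1
  have hsm : ∀ z r : ℝ, 0 < z → 0 < r → z ≤ κ * r →
      min t (c ^ a * (z / r) ^ a) = c ^ a * min t ((z / r) ^ a) := by
    intro z r hz hr hzr
    have h1 : (z / r) ^ a ≤ κ ^ a :=
      Real.rpow_le_rpow (by positivity) ((div_le_iff₀ hr).2 hzr) ha.le
    rw [min_eq_right (h1.trans hκ1), min_eq_right]
    exact (mul_le_mul_of_nonneg_left h1 hca.le).trans hκ2
  have hup : ∀ r, 0 < r → truncMoment a t lam (r / c) ≤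
      ENNReal.ofReal (c ^ a) * truncMoment a t lam r + K * tailMoment b lam κ r := by
    intro r hr
    have e : ENNReal.ofReal (c ^ a) * truncMoment a t lam r =
        ∫⁻ z in Ioi (0:ℝ), ENNReal.ofReal (c ^ a * min t ((z / r) ^ a)) ∂lam := by
      unfold truncMoment
      rw [← lintegral_const_mul' _ _ ENNReal.ofReal_ne_top]
      simp_rw [ENNReal.ofReal_mul hca.le]
    rw [e]
    refine hsplit r hr _ _ (fun z hz hzr => ?_) (fun z hz => ?_) (by fun_prop)
    · rw [hpow z r hz hr, hsm z r hz hr hzr]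
    · exact (min_le_left _ _).trans (le_mul_of_one_le_left ht.le (le_max_left _ _))
  have hlow : ∀ r, 0 < r → ENNReal.ofReal (c ^ a) * truncMoment a t lam r ≤
      truncMoment a t lam (r / c) + K * tailMoment b lam κ r := by
    intro r hr
    have e : ENNReal.ofReal (c ^ a) * truncMoment a t lam r =
        ∫⁻ z in Ioi (0:ℝ), ENNReal.ofReal (c ^ a * min t ((z / r) ^ a)) ∂lam := by
      unfold truncMoment
      rw [← lintegral_const_mul' _ _ ENNReal.ofReal_ne_top]
      simp_rw [ENNReal.ofReal_mul hca.le]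
    rw [e]
    refine hsplit r hr _ _ (fun z hz hzr => ?_) (fun z hz => ?_) (by fun_prop)
    · rw [hpow z r hz hr, hsm z r hz hr hzr]
    · exact mul_le_mul (le_max_right _ _) (min_le_left _ _)
        (le_min ht.le (Real.rpow_nonneg (div_nonneg ((mul_pos hκ hr).trans hz).le hr.le) _))
        (by positivity)
  have hKt : Tendsto (fun r => K * (tailMoment b lam κ r / truncMoment a t lam r)) atTop (𝓝 0) := by
    have := ENNReal.Tendsto.const_mul (a := K) (h κ hκ) (Or.inr ENNReal.ofReal_ne_top)
    rwa [mul_zero] at this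
  have hU : Tendsto (fun r => ENNReal.ofReal (c ^ a) +
      K * (tailMoment b lam κ r / truncMoment a t lam r)) atTop (𝓝 (ENNReal.ofReal (c ^ a))) := by
    simpa using tendsto_const_nhds.add hKt
  have hL : Tendsto (fun r => ENNReal.ofReal (c ^ a) -
      K * (tailMoment b lam κ r / truncMoment a t lam r)) atTop (𝓝 (ENNReal.ofReal (c ^ a))) := by
    simpa using ENNReal.Tendsto.sub (tendsto_const_nhds (x := ENNReal.ofReal (c ^ a))) hKt
      (Or.inl ENNReal.ofReal_ne_top)
  refine tendsto_of_tendsto_of_tendsto_of_le_of_le' hL hU ?_ ?_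
  · filter_upwards [eventually_gt_atTop 0] with r hr
    have h0 := truncMoment_ne_zero (a := a) ht hr hlam
    have hT := truncMoment_ne_top (t := t) hr hsmall hfin
    rw [tsub_le_iff_right, ← mul_div_assoc, ← ENNReal.add_div,
      ENNReal.le_div_iff_mul_le (Or.inl h0) (Or.inl hT)]
    exact hlow r hr
  · filter_upwards [eventually_gt_atTop 0] with r hr
    have h0 := truncMoment_ne_zero (a := a) ht hr hlam
    have hT := truncMoment_ne_top (t := t) hr hsmall hfin
    rw [ENNReal.div_le_iff h0 hT, add_mul, mul_assoc, ENNReal.div_mul_cancel h0 hT]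
    exact hup r hr

lemma tendsto_setLIntegral_Ioi_atTop {lam : Measure ℝ} {f : ℝ → ℝ≥0∞} (hfin : lam (Ioi 1) ≠ ⊤)
    (hf : ∫⁻ z in Ioi (1:ℝ), f z ∂lam ≠ ⊤) :
    Tendsto (fun r => ∫⁻ z in Ioi r, f z ∂lam) atTop (𝓝 0) := by
  have hzero : Tendsto ((lam.restrict (Ioi 1)) ∘ fun r : ℝ => Ioi r) atTop (𝓝 0) := by
    have hempty : ⋂ r : ℝ, Ioi r = ∅ := by
      ext z
      simp only [mem_iInter, mem_Ioi, mem_empty_iff_false, iff_false, not_forall, not_lt]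
      exact ⟨z, le_rfl⟩
    have := tendsto_measure_iInter_atTop (μ := lam.restrict (Ioi 1)) (s := fun r : ℝ => Ioi r)
      (fun r => measurableSet_Ioi.nullMeasurableSet) (fun _ _ h => Ioi_subset_Ioi h)
      ⟨1, by simpa using hfin⟩
    rwa [hempty, measure_empty] at this
  refine (tendsto_setLIntegral_zero hf hzero).congr' ?_
  filter_upwards [eventually_ge_atTop 1] with r hr
  rw [Measure.restrict_restrict measurableSet_Ioi, inter_eq_left.2 (Ioi_subset_Ioi hr)]

lemma tailNegligible_of_moment {a b t : ℝ} {lam : Measure ℝ} (ht : 0 < t)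
    (hlam : lam (Ioi 0) ≠ 0) (hfin : lam (Ioi 1) ≠ ⊤)
    (hmom : ∫⁻ z in Ioi (1:ℝ), ENNReal.ofReal (z ^ max a b) ∂lam ≠ ⊤) (ha : 0 < a) :
    TailNegligible a b t lam 1 := by
  have h0 := truncMoment_ne_zero (a := a) ht one_pos hlam
  have h1 := ENNReal.Tendsto.const_mul (a := (truncMoment a t lam 1)⁻¹)
    (tendsto_setLIntegral_Ioi_atTop hfin hmom) (Or.inr (ENNReal.inv_ne_top.2 h0))
  rw [mul_zero] at h1
  refine tendsto_of_tendsto_of_tendsto_of_le_of_le' tendsto_const_nhds h1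
    (Eventually.of_forall fun _ => zero_le) ?_
  filter_upwards [eventually_ge_atTop 1] with r hr
  have hr0 : 0 < r := by linarith
  have hN : truncMoment a t lam 1 ≤ ENNReal.ofReal (r ^ a) * truncMoment a t lam r := by
    have := truncMoment_mul_le (a := a) lam ht (inv_pos.2 hr0) hr0
    rwa [inv_mul_cancel₀ hr0.ne', inv_inv, max_eq_right (Real.one_le_rpow hr ha.le)] at this
  have hF : ENNReal.ofReal (r ^ a) * tailMoment b lam 1 r ≤
      ∫⁻ z in Ioi r, ENNReal.ofReal (z ^ max a b) ∂lam := by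
    unfold tailMoment
    rw [← lintegral_const_mul' _ _ ENNReal.ofReal_ne_top, one_mul]
    refine setLIntegral_mono' measurableSet_Ioi fun z hz => ?_
    rw [mem_Ioi] at hz
    have hz0 : 0 < z := by linarith
    rw [← ENNReal.ofReal_mul (by positivity)]
    apply ENNReal.ofReal_le_ofReal
    rw [Real.div_rpow hz0.le hr0.le, ← mul_div_assoc, div_le_iff₀ (by positivity)]
    rcases le_total a b with hab | hab
    · rw [max_eq_right hab, mul_comm]
      gcongr
    · rw [max_eq_left hab]
      have e1 : r ^ a = r ^ (a - b) * r ^ b := by rw [← Real.rpow_add hr0]; simp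
      have e2 : z ^ a = z ^ (a - b) * z ^ b := by rw [← Real.rpow_add hz0]; simp
      have : r ^ (a - b) ≤ z ^ (a - b) := Real.rpow_le_rpow hr0.le hz.le (by linarith)
      rw [e1, e2, mul_assoc, mul_assoc, mul_comm (r ^ b)]
      gcongr
  have hra : ENNReal.ofReal (r ^ a) ≠ 0 := by
    rw [Ne, ENNReal.ofReal_eq_zero, not_le]
    positivity
  calc tailMoment b lam 1 r / truncMoment a t lam r
      = (ENNReal.ofReal (r ^ a) * tailMoment b lam 1 r) /
          (ENNReal.ofReal (r ^ a) * truncMoment a t lam r) :=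
        (ENNReal.mul_div_mul_left _ _ hra ENNReal.ofReal_ne_top).symm
    _ ≤ (∫⁻ z in Ioi r, ENNReal.ofReal (z ^ max a b) ∂lam) / truncMoment a t lam 1 :=
        ENNReal.div_le_div hF hN
    _ = _ := by rw [ENNReal.div_eq_inv_mul]

lemma sum_half_pow_indicator_le (n : ℕ) (w : ℝ) (hw : 0 ≤ w) :
    ∑ k ∈ Finset.range n, (1 / 2 : ℝ) ^ (k + 1) * (if (1 / 2 : ℝ) ^ k < w then 1 else 0) ≤
      min 1 w := by
  induction n generalizing w with
  | zero => simpa using hw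
  | succ n ih =>
    have h := ih (2 * w) (by positivity)
    rw [Finset.sum_range_succ']
    have e : ∑ k ∈ Finset.range n, (1 / 2 : ℝ) ^ (k + 1 + 1) *
        (if (1 / 2 : ℝ) ^ (k + 1) < w then 1 else 0) =
        1 / 2 * ∑ k ∈ Finset.range n, (1 / 2 : ℝ) ^ (k + 1) *
          (if (1 / 2 : ℝ) ^ k < 2 * w then 1 else 0) := by
      rw [Finset.mul_sum]
      refine Finset.sum_congr rfl fun k _ => ?_
      have : ((1 / 2 : ℝ) ^ (k + 1) < w) ↔ ((1 / 2 : ℝ) ^ k < 2 * w) := by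
        rw [pow_succ]
        constructor <;> intro h <;> linarith
      simp only [this]
      ring
    rw [e]
    have h1 := h.trans (min_le_left _ _)
    have h2 := h.trans (min_le_right _ _)
    rw [pow_zero, zero_add, pow_one]
    refine le_min ?_ ?_ <;> split_ifs <;> linarith

lemma sum_measure_Ioi_le_truncMoment {a t r : ℝ} (lam : Measure ℝ) (ha : 0 < a) (ht : 0 < t)
    (hr : 0 < r) (n : ℕ) :
    ∑ k ∈ Finset.range n, ENNReal.ofReal (t * (1 / 2) ^ (k + 1)) *
      lam (Ioi ((t * (1 / 2) ^ k) ^ a⁻¹ * r)) ≤ truncMoment a t lam r := by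
  have e : ∀ k, ENNReal.ofReal (t * (1 / 2) ^ (k + 1)) *
      lam (Ioi ((t * (1 / 2) ^ k) ^ a⁻¹ * r)) = ∫⁻ z in Ioi (0:ℝ),
        (Ioi ((t * (1 / 2) ^ k) ^ a⁻¹ * r)).indicator
          (fun _ => ENNReal.ofReal (t * (1 / 2) ^ (k + 1))) z ∂lam := by
    intro k
    rw [lintegral_indicator_const measurableSet_Ioi, Measure.restrict_apply measurableSet_Ioi,
      Ioi_inter_Ioi, sup_of_le_left (by positivity)]
  simp_rw [e]
  rw [← lintegral_finsetSum _ fun k _ => by measurability]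
  refine setLIntegral_mono' measurableSet_Ioi fun z hz => ?_
  rw [mem_Ioi] at hz
  have hw : 0 ≤ (z / r) ^ a / t := by positivity
  have hiff : ∀ k : ℕ, z ∈ Ioi ((t * (1 / 2) ^ k) ^ a⁻¹ * r) ↔
      (1 / 2 : ℝ) ^ k < (z / r) ^ a / t := by
    intro k
    rw [mem_Ioi, ← lt_div_iff₀ hr, lt_div_iff₀ ht, mul_comm _ t,
      Real.rpow_inv_lt_iff_of_pos (by positivity) (by positivity) ha]
  calc ∑ k ∈ Finset.range n, (Ioi ((t * (1 / 2) ^ k) ^ a⁻¹ * r)).indicator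
          (fun _ => ENNReal.ofReal (t * (1 / 2) ^ (k + 1))) z
      = ∑ k ∈ Finset.range n, ENNReal.ofReal (t * ((1 / 2) ^ (k + 1) *
          (if (1 / 2 : ℝ) ^ k < (z / r) ^ a / t then 1 else 0))) := by
        refine Finset.sum_congr rfl fun k _ => ?_
        by_cases hk : (1 / 2 : ℝ) ^ k < (z / r) ^ a / t
        · rw [indicator_of_mem ((hiff k).2 hk), if_pos hk, mul_one]
        · rw [indicator_of_notMem (fun h => hk ((hiff k).1 h)), if_neg hk, mul_zero, mul_zero,
            ENNReal.ofReal_zero]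
    _ = ENNReal.ofReal (t * ∑ k ∈ Finset.range n, (1 / 2 : ℝ) ^ (k + 1) *
          (if (1 / 2 : ℝ) ^ k < (z / r) ^ a / t then 1 else 0)) := by
        rw [Finset.mul_sum, ENNReal.ofReal_sum_of_nonneg]
        intro k _
        split_ifs <;> positivity
    _ ≤ _ := by
        apply ENNReal.ofReal_le_ofReal
        refine (mul_le_mul_of_nonneg_left (sum_half_pow_indicator_le n _ hw) ht.le).trans ?_
        rw [mul_min_of_nonneg _ _ ht.le, mul_one, mul_div_cancel₀ _ ht.ne']

lemma tailMoment_le_tsum {b r : ℝ} (lam : Measure ℝ) (hb : 0 < b) (hr : 0 < r) :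
    tailMoment b lam 1 r ≤
      ∑' k : ℕ, ENNReal.ofReal ((2 ^ (k + 1) : ℝ) ^ b) * lam (Ioi (2 ^ k * r)) := by
  have hcover : Ioi (1 * r) ⊆ ⋃ k : ℕ, Ioc (2 ^ k * r) (2 ^ (k + 1) * r) := by
    intro z hz
    rw [one_mul, mem_Ioi] at hz
    obtain ⟨k, hk1, hk2⟩ : ∃ k : ℕ, 2 ^ k < z / r ∧ z / r ≤ 2 ^ (k + 1) := by
      have hex : ∃ n : ℕ, z / r ≤ 2 ^ n :=
        (pow_unbounded_of_one_lt (z / r) one_lt_two).imp fun _ => le_of_lt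
      have hpos : Nat.find hex ≠ 0 := fun h0 => by
        have := Nat.find_spec hex
        rw [h0, pow_zero] at this
        exact absurd ((one_lt_div hr).2 hz) this.not_gt
      obtain ⟨k, hk⟩ := Nat.exists_eq_succ_of_ne_zero hpos
      refine ⟨k, not_le.1 (Nat.find_min hex (by omega)), ?_⟩
      have := Nat.find_spec hex
      rwa [hk] at this
    refine mem_iUnion.2 ⟨k, ?_, ?_⟩
    · exact (lt_div_iff₀ hr).1 hk1
    · exact (div_le_iff₀ hr).1 hk2
  unfold tailMoment
  refine (lintegral_mono_set hcover).trans ((lintegral_iUnion_le _ _).trans ?_)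
  refine ENNReal.tsum_le_tsum fun k => ?_
  calc ∫⁻ z in Ioc (2 ^ k * r) (2 ^ (k + 1) * r), ENNReal.ofReal ((z / r) ^ b) ∂lam
      ≤ ∫⁻ z in Ioc (2 ^ k * r) (2 ^ (k + 1) * r), ENNReal.ofReal ((2 ^ (k + 1) : ℝ) ^ b) ∂lam := by
        refine setLIntegral_mono' measurableSet_Ioc fun z hz => ENNReal.ofReal_le_ofReal ?_
        have : 0 < z := lt_of_le_of_lt (by positivity) hz.1
        exact Real.rpow_le_rpow (by positivity) ((div_le_iff₀ hr).2 hz.2) hb.le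
    _ ≤ _ := by
        rw [setLIntegral_const]
        gcongr
        exact Ioc_subset_Ioi_self

/-- The tail `λ̄` is eventually positive and finite, and regularly varying of index `-a`. -/
structure RegularlyVaryingTail (a : ℝ) (lam : Measure ℝ) : Prop where
  ne_top : lam (Ioi 1) ≠ ⊤
  pos : ∀ r, 1 ≤ r → 0 < (lam (Ioi r)).toReal
  tendsto : ∀ c, 0 < c →
    Tendsto (fun r => (lam (Ioi (c * r))).toReal / (lam (Ioi r)).toReal) atTop (𝓝 (c ^ (-a)))

namespace RegularlyVaryingTail

variable {a : ℝ} {lam : Measure ℝ}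

lemma measure_ne_top (h : RegularlyVaryingTail a lam) {r : ℝ} (hr : 1 ≤ r) :
    lam (Ioi r) ≠ ⊤ :=
  measure_ne_top_of_subset (Ioi_subset_Ioi hr) h.ne_top

lemma eventually_le (h : RegularlyVaryingTail a lam) {c q : ℝ} (hc : 0 < c)
    (hq : c ^ (-a) < q) : ∀ᶠ r in atTop, lam (Ioi (c * r)) ≤ ENNReal.ofReal q * lam (Ioi r) := by
  filter_upwards [(h.tendsto c hc).eventually_lt_const hq, eventually_ge_atTop 1,
    (tendsto_id.const_mul_atTop hc).eventually_ge_atTop 1] with r h1 h2 h3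
  rw [div_lt_iff₀ (h.pos r h2)] at h1
  rw [id_eq] at h3
  rw [← ENNReal.ofReal_toReal (h.measure_ne_top h2), ← ENNReal.ofReal_toReal (h.measure_ne_top h3),
    ← ENNReal.ofReal_mul ((by positivity : 0 < c ^ (-a)).le.trans hq.le)]
  exact ENNReal.ofReal_le_ofReal h1.le

lemma eventually_ge (h : RegularlyVaryingTail a lam) {c q : ℝ} (hc : 0 < c) (hq0 : 0 ≤ q)
    (hq : q < c ^ (-a)) : ∀ᶠ r in atTop, ENNReal.ofReal q * lam (Ioi r) ≤ lam (Ioi (c * r)) := by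
  filter_upwards [(h.tendsto c hc).eventually_const_lt hq, eventually_ge_atTop 1,
    (tendsto_id.const_mul_atTop hc).eventually_ge_atTop 1] with r h1 h2 h3
  rw [lt_div_iff₀ (h.pos r h2)] at h1
  rw [id_eq] at h3
  rw [← ENNReal.ofReal_toReal (h.measure_ne_top h2), ← ENNReal.ofReal_toReal (h.measure_ne_top h3),
    ← ENNReal.ofReal_mul hq0]
  exact ENNReal.ofReal_le_ofReal h1.le

lemma tendsto_measure_Ioi_div_truncMoment (h : RegularlyVaryingTail a lam) (ha : 0 < a) {t : ℝ}
    (ht : 0 < t) :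
    Tendsto (fun r => lam (Ioi r) / truncMoment a t lam r) atTop (𝓝 0) := by
  have key : ∀ n : ℕ, ∀ᶠ r in atTop,
      (n : ℝ≥0∞) * ENNReal.ofReal (1 / 4) * lam (Ioi r) ≤ truncMoment a t lam r := by
    intro n
    have hev : ∀ᶠ r in atTop, ∀ k ∈ Finset.range n,
        ENNReal.ofReal (1 / 2 * (t * (1 / 2) ^ k)⁻¹) * lam (Ioi r) ≤
          lam (Ioi ((t * (1 / 2) ^ k) ^ a⁻¹ * r)) := by
      rw [Filter.eventually_all_finset]
      intro k _
      have hpos : 0 < t * (1 / 2) ^ k := by positivity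
      have e : ((t * (1 / 2) ^ k) ^ a⁻¹) ^ (-a) = (t * (1 / 2) ^ k)⁻¹ := by
        rw [Real.rpow_neg (by positivity), Real.rpow_inv_rpow hpos.le ha.ne']
      refine h.eventually_ge (by positivity) (by positivity) ?_
      rw [e]
      have := inv_pos.2 hpos
      linarith
    filter_upwards [hev, eventually_gt_atTop 0] with r h1 hr
    refine le_trans ?_ (sum_measure_Ioi_le_truncMoment lam ha ht hr n)
    calc (n : ℝ≥0∞) * ENNReal.ofReal (1 / 4) * lam (Ioi r)
        = ∑ k ∈ Finset.range n, ENNReal.ofReal (1 / 4) * lam (Ioi r) := by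
          rw [Finset.sum_const, Finset.card_range, nsmul_eq_mul, mul_assoc]
      _ ≤ _ := by
          refine Finset.sum_le_sum fun k hk => ?_
          refine le_trans (le_of_eq ?_) (mul_le_mul_right (h1 k hk) _)
          rw [← mul_assoc, ← ENNReal.ofReal_mul (by positivity)]
          congr 2
          field_simp
          ring
  rw [ENNReal.tendsto_nhds_zero]
  intro ε hε
  obtain ⟨n, hn⟩ := ENNReal.exists_nat_gt (r := (ε * ENNReal.ofReal (1 / 4))⁻¹)
    (ENNReal.inv_ne_top.2 (mul_ne_zero hε.ne' (by simp)))
  filter_upwards [key n] with r hr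
  refine ENNReal.div_le_of_le_mul ?_
  have h1 : 1 ≤ ε * (n * ENNReal.ofReal (1 / 4)) := by
    have := ENNReal.inv_lt_iff_inv_lt.1 hn
    have h2 : (n : ℝ≥0∞)⁻¹ * n ≤ ε * ENNReal.ofReal (1 / 4) * n := by gcongr
    rw [ENNReal.inv_mul_cancel (by rintro h0; rw [h0] at hn; exact not_lt_zero hn)
      (ENNReal.natCast_ne_top n)] at h2
    calc (1 : ℝ≥0∞) ≤ _ := h2
      _ = _ := by ring
  calc lam (Ioi r) = 1 * lam (Ioi r) := (one_mul _).symm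
    _ ≤ ε * (n * ENNReal.ofReal (1 / 4)) * lam (Ioi r) := by gcongr
    _ = ε * (n * ENNReal.ofReal (1 / 4) * lam (Ioi r)) := by ring
    _ ≤ _ := by gcongr

lemma exists_tailMoment_le (h : RegularlyVaryingTail a lam) {b : ℝ} (hb : 0 < b) (hba : b < a) :
    ∃ K : ℝ≥0∞, K ≠ ⊤ ∧ ∀ᶠ r in atTop, tailMoment b lam 1 r ≤ K * lam (Ioi r) := by
  obtain ⟨q, hq1, hq2⟩ := exists_between
    (Real.rpow_lt_rpow_of_exponent_lt (one_lt_two : (1:ℝ) < 2) (neg_lt_neg hba))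
  have hq0 : 0 < q := lt_trans (by positivity) hq1
  set ρ := ENNReal.ofReal ((2:ℝ) ^ b * q) with hρ
  have hρ1 : ρ < 1 := by
    rw [hρ, ENNReal.ofReal_lt_one]
    calc (2:ℝ) ^ b * q < 2 ^ b * 2 ^ (-b) := by gcongr
      _ = 1 := by rw [← Real.rpow_add two_pos]; simp
  refine ⟨ENNReal.ofReal ((2:ℝ) ^ b) * (1 - ρ)⁻¹, ENNReal.mul_ne_top ENNReal.ofReal_ne_top
    (ENNReal.inv_ne_top.2 (tsub_pos_of_lt hρ1).ne'), ?_⟩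
  obtain ⟨r₀, hr₀⟩ := eventually_atTop.1 (h.eventually_le two_pos hq1)
  filter_upwards [eventually_ge_atTop r₀, eventually_gt_atTop 0] with r hr hr0
  have hiter : ∀ k : ℕ, lam (Ioi (2 ^ k * r)) ≤ ENNReal.ofReal q ^ k * lam (Ioi r) := by
    intro k
    induction k with
    | zero => simp
    | succ k ih =>
      have h1 : r ≤ 2 ^ k * r := le_mul_of_one_le_left hr0.le (one_le_pow₀ one_le_two)
      have := hr₀ _ (hr.trans h1)
      calc lam (Ioi (2 ^ (k + 1) * r)) = lam (Ioi (2 * (2 ^ k * r))) := by rw [pow_succ']; ring_nf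
        _ ≤ _ := this
        _ ≤ ENNReal.ofReal q * (ENNReal.ofReal q ^ k * lam (Ioi r)) := by gcongr
        _ = _ := by rw [pow_succ']; ring
  refine (tailMoment_le_tsum lam hb hr0).trans ?_
  calc ∑' k : ℕ, ENNReal.ofReal ((2 ^ (k + 1) : ℝ) ^ b) * lam (Ioi (2 ^ k * r))
      ≤ ∑' k : ℕ, ENNReal.ofReal ((2:ℝ) ^ b) * lam (Ioi r) * ρ ^ k := by
        refine ENNReal.tsum_le_tsum fun k => ?_
        have e : ENNReal.ofReal ((2 ^ (k + 1) : ℝ) ^ b) =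
            ENNReal.ofReal ((2:ℝ) ^ b) * ENNReal.ofReal ((2:ℝ) ^ b) ^ k := by
          rw [← ENNReal.ofReal_pow (by positivity), ← ENNReal.ofReal_mul (by positivity),
            ← pow_succ', ← Real.rpow_natCast, ← Real.rpow_natCast, ← Real.rpow_mul (by positivity),
            ← Real.rpow_mul (by positivity), mul_comm]
        rw [e, hρ, ENNReal.ofReal_mul (by positivity), mul_pow]
        calc _ ≤ ENNReal.ofReal ((2:ℝ) ^ b) * ENNReal.ofReal ((2:ℝ) ^ b) ^ k *
              (ENNReal.ofReal q ^ k * lam (Ioi r)) := by gcongr; exact hiter k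
          _ = _ := by ring
    _ = _ := by
        rw [ENNReal.tsum_mul_left, ENNReal.tsum_geometric]
        ring

lemma tailNegligible (h : RegularlyVaryingTail a lam) {b t : ℝ} (hb : 0 < b) (hba : b < a)
    (ht : 0 < t) : TailNegligible a b t lam 1 := by
  obtain ⟨K, hK, hle⟩ := h.exists_tailMoment_le hb hba
  have h1 := ENNReal.Tendsto.const_mul (a := K)
    (h.tendsto_measure_Ioi_div_truncMoment (hb.trans hba) ht) (Or.inr hK)
  rw [mul_zero] at h1
  refine tendsto_of_tendsto_of_tendsto_of_le_of_le' tendsto_const_nhds h1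
    (Eventually.of_forall fun _ => zero_le) ?_
  filter_upwards [hle] with r hr
  rw [← mul_div_assoc]
  gcongr

end RegularlyVaryingTail

lemma SlowlyVarying.regularlyVaryingTail {a : ℝ} {lam : Measure ℝ} {l : ℝ → ℝ}
    (hl : SlowlyVarying l) (hlpos : ∀ x, 0 < x → 0 < l x) (hfin : lam (Ioi 1) ≠ ⊤)
    (heq : ∀ r : ℝ, 1 ≤ r → (lam (Ioi r)).toReal = l r / r ^ a) :
    RegularlyVaryingTail a lam where
  ne_top := hfin
  pos r hr := by
    have hr0 : 0 < r := by linarith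
    rw [heq r hr]
    have := hlpos r hr0
    positivity
  tendsto c hc := by
    have h1 := (hl c hc).mul_const (c ^ (-a))
    rw [one_mul] at h1
    refine h1.congr' ?_
    filter_upwards [eventually_ge_atTop 1,
      (tendsto_id.const_mul_atTop hc).eventually_ge_atTop 1] with r h2 h3
    have hr0 : 0 < r := by linarith
    rw [id_eq] at h3
    rw [heq r h2, heq _ h3, Real.mul_rpow hc.le hr0.le, Real.rpow_neg hc.le]
    have := hlpos r hr0
    field_simp

lemma volume_setOf_lt_mul_rpow {e t r z : ℝ} (he : 0 < e) (hr : 0 < r) (hz : 0 < z) :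
    (volume.restrict (Ioc (0:ℝ) t)) {s : ℝ | r < z * s ^ (-e)} =
      ENNReal.ofReal (min t ((z / r) ^ e⁻¹)) := by
  have hiff : ∀ s : ℝ, 0 < s → (r < z * s ^ (-e) ↔ s < (z / r) ^ e⁻¹) := by
    intro s hs
    rw [Real.lt_rpow_inv_iff_of_pos hs.le (by positivity) he, Real.rpow_neg hs.le,
      ← div_eq_mul_inv, lt_div_iff₀ (by positivity), lt_div_iff₀' hr]
  rw [Measure.restrict_apply' measurableSet_Ioc]
  apply le_antisymm
  · calc volume ({s : ℝ | r < z * s ^ (-e)} ∩ Ioc 0 t)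
        ≤ volume (Ioc 0 (min t ((z / r) ^ e⁻¹))) := by
          refine measure_mono fun s hs => ?_
          exact ⟨hs.2.1, le_min hs.2.2 ((hiff s hs.2.1).1 hs.1).le⟩
      _ = _ := by rw [Real.volume_Ioc, sub_zero]
  · calc ENNReal.ofReal (min t ((z / r) ^ e⁻¹))
        = volume (Ioo 0 (min t ((z / r) ^ e⁻¹))) := by rw [Real.volume_Ioo, sub_zero]
      _ ≤ _ := by
          refine measure_mono fun s hs => ?_
          exact ⟨(hiff s hs.1).2 (hs.2.trans_le (min_le_right _ _)), hs.1,
            (hs.2.trans_le (min_le_left _ _)).le⟩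

lemma tauBar_eq_truncMoment {d : ℕ} {α t r : ℝ} (lam : Measure ℝ) [SFinite lam] (hd : 0 < d)
    (hα : 0 < α) (hr : 0 < r) : tauBar d α t lam r = truncMoment (α / d) t lam r := by
  unfold tauBar truncMoment
  have hd' : (0:ℝ) < d := by exact_mod_cast hd
  rw [Measure.prod_apply_symm (measurableSet_lt (by fun_prop) (by fun_prop))]
  refine setLIntegral_congr_fun measurableSet_Ioi fun z hz => ?_
  have := volume_setOf_lt_mul_rpow (t := t) (div_pos hd' hα) hr hz
  rw [inv_div] at this
  exact this

section Geometry

variable {d : ℕ} {α t r : ℝ} (lam : Measure ℝ) [SFinite lam]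

lemma measure_mem_and_lt_eq {B : Set (EuclideanSpace ℝ (Fin d))} (hB : MeasurableSet B)
    (hBfin : volume B ≠ ⊤) {c : ℝ} (hc : 0 < c) :
    ((volume.restrict (Ioc (0:ℝ) t)).prod
      ((volume : Measure (EuclideanSpace ℝ (Fin d))).prod (lam.restrict (Ioi (0:ℝ)))))
      {q : ℝ × EuclideanSpace ℝ (Fin d) × ℝ |
        q.2.1 ∈ B ∧ r < q.1 ^ (-((d : ℝ) / α)) * c * q.2.2} =
      volume B * tauBar d α t lam (r / c) := by
  have hm : MeasurableSet {q : ℝ × EuclideanSpace ℝ (Fin d) × ℝ |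
        q.2.1 ∈ B ∧ r < q.1 ^ (-((d : ℝ) / α)) * c * q.2.2} := by
    have h1 : MeasurableSet {q : ℝ × EuclideanSpace ℝ (Fin d) × ℝ | q.2.1 ∈ B} :=
      hB.preimage (by fun_prop)
    have h2 : MeasurableSet {q : ℝ × EuclideanSpace ℝ (Fin d) × ℝ |
        r < q.1 ^ (-((d : ℝ) / α)) * c * q.2.2} :=
      measurableSet_lt (by fun_prop) (by fun_prop)
    exact h1.inter h2
  unfold tauBar
  rw [Measure.prod_apply hm, Measure.prod_apply (measurableSet_lt (by fun_prop) (by fun_prop)),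
    ← lintegral_const_mul' _ _ hBfin]
  refine lintegral_congr fun s => ?_
  rw [← Measure.prod_prod]
  congr 1
  ext ⟨y, z⟩
  simp only [mem_preimage, mem_ofPred_eq, mem_prod]
  rw [div_lt_iff₀ hc]
  ring_nf

lemma volume_infDist_lt_le {A : Set (EuclideanSpace ℝ (Fin d))} (hA : A.Nonempty) {R u ε : ℝ}
    {x₀ : EuclideanSpace ℝ (Fin d)} (hR : 0 < R) (hAR : A ⊆ Metric.ball x₀ R) (hε : 0 < ε)
    (hu : ε < u) :
    volume {y | Metric.infDist y A < u} ≤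
      ENNReal.ofReal ((R / ε + 1) ^ d * u ^ d) *
        volume (Metric.ball (0 : EuclideanSpace ℝ (Fin d)) 1) := by
  have hu0 : 0 < u := hε.trans hu
  have hsub : {y | Metric.infDist y A < u} ⊆ Metric.ball x₀ (R + u) := by
    intro y hy
    obtain ⟨x, hx, hxy⟩ := (Metric.infDist_lt_iff hA).1 hy
    have h1 := hAR hx
    rw [Metric.mem_ball] at h1 ⊢
    linarith [dist_triangle y x x₀]
  refine (measure_mono hsub).trans ?_
  rw [Measure.addHaar_ball_of_pos _ _ (by positivity), finrank_euclideanSpace_fin]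
  gcongr
  rw [← mul_pow]
  gcongr
  rw [add_mul, one_mul]
  gcongr
  rw [div_mul_eq_mul_div, le_div_iff₀ hε]
  gcongr

lemma measure_infDist_rpow_lt_le {A : Set (EuclideanSpace ℝ (Fin d))} (hA : A.Nonempty)
    (hAb : Bornology.IsBounded A) {p ε M : ℝ} (hp : 0 < p) (hε : 0 < ε) (hM : 0 < M) :
    ∃ K : ℝ≥0∞, K ≠ ⊤ ∧ ∀ r : ℝ, 0 < r →
      ((volume : Measure (EuclideanSpace ℝ (Fin d))).prod (lam.restrict (Ioi (0:ℝ))))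
        {w | ε < Metric.infDist w.1 A ∧ Metric.infDist w.1 A ^ p < M * (w.2 / r)} ≤
      K * tailMoment (d / p) lam (ε ^ p / M) r := by
  obtain ⟨x₀, hx₀⟩ := hA
  obtain ⟨R, hR, hAR⟩ := hAb.subset_ball_lt 0 x₀
  set V := volume (Metric.ball (0 : EuclideanSpace ℝ (Fin d)) 1) with hV
  have hVt : V ≠ ⊤ := measure_ball_lt_top.ne
  set D := ENNReal.ofReal ((R / ε + 1) ^ d * M ^ ((d:ℝ) / p)) * V with hD
  have hDt : D ≠ ⊤ := ENNReal.mul_ne_top ENNReal.ofReal_ne_top hVt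
  refine ⟨D, hDt, fun r hr => ?_⟩
  have hcont : Measurable fun w : EuclideanSpace ℝ (Fin d) × ℝ => Metric.infDist w.1 A :=
    ((Metric.continuous_infDist_pt A).comp continuous_fst).measurable
  have hm : MeasurableSet {w : EuclideanSpace ℝ (Fin d) × ℝ |
      ε < Metric.infDist w.1 A ∧ Metric.infDist w.1 A ^ p < M * (w.2 / r)} :=
    (measurableSet_lt (by fun_prop) hcont).inter
      (measurableSet_lt (hcont.pow_const p) (by fun_prop))
  have hF : D * tailMoment (d / p) lam (ε ^ p / M) r = ∫⁻ z in Ioi (0:ℝ),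
      (Ioi (ε ^ p / M * r)).indicator
        (fun z => D * ENNReal.ofReal ((z / r) ^ ((d:ℝ) / p))) z ∂lam := by
    rw [setLIntegral_indicator measurableSet_Ioi, Ioi_inter_Ioi,
      sup_of_le_left (by positivity), lintegral_const_mul' _ _ hDt]
    rfl
  rw [Measure.prod_apply_symm hm, hF]
  refine setLIntegral_mono' measurableSet_Ioi fun z hz => ?_
  rw [mem_Ioi] at hz
  by_cases hzr : ε ^ p / M * r < z
  · rw [indicator_of_mem (by exact hzr)]
    have hx : ε ^ p < M * (z / r) := by
      rw [div_mul_eq_mul_div, div_lt_iff₀ hM] at hzr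
      rw [← mul_div_assoc, lt_div_iff₀ hr, mul_comm M]
      exact hzr
    have hx0 : 0 ≤ M * (z / r) := by positivity
    have hεu : ε < (M * (z / r)) ^ p⁻¹ := (Real.lt_rpow_inv_iff_of_pos hε.le hx0 hp).2 hx
    refine (measure_mono ?_).trans
      ((volume_infDist_lt_le ⟨x₀, hx₀⟩ hR hAR hε hεu).trans (le_of_eq ?_))
    · rintro y ⟨-, hy⟩
      exact (Real.lt_rpow_inv_iff_of_pos Metric.infDist_nonneg hx0 hp).2 hy
    · have e : ((M * (z / r)) ^ p⁻¹) ^ d = M ^ ((d:ℝ) / p) * (z / r) ^ ((d:ℝ) / p) := by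
        rw [← Real.rpow_natCast, ← Real.rpow_mul hx0, inv_mul_eq_div,
          Real.mul_rpow hM.le (by positivity)]
      rw [e, ← mul_assoc, ENNReal.ofReal_mul (by positivity), hD]
      ring
  · rw [indicator_of_notMem (by exact hzr)]
    refine le_of_eq (measure_mono_null (t := ∅) ?_ measure_empty)
    rintro y ⟨hy1, hy2⟩
    apply hzr
    have : ε ^ p < M * (z / r) := (Real.rpow_lt_rpow hε.le hy1 hp).trans hy2
    rw [← mul_div_assoc, lt_div_iff₀ hr] at this
    rw [div_mul_eq_mul_div, div_lt_iff₀ hM, mul_comm z]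
    exact this

lemma exists_rpow_mul_le {g : ℝ → ℝ} {p c₀ : ℝ} (hp : 0 < p) (hg_anti : AntitoneOn g (Ici 0))
    (hg_tail : Tendsto (fun x : ℝ => x ^ p * g x) atTop (𝓝 c₀)) (hg0 : 0 ≤ g 0) :
    ∃ C : ℝ, 0 < C ∧ ∀ x, 0 ≤ x → x ^ p * g x ≤ C := by
  obtain ⟨x₀, hx₀⟩ := eventually_atTop.1 (hg_tail.eventually_le_const (lt_add_one c₀))
  refine ⟨max 1 (max (c₀ + 1) (|x₀| ^ p * g 0)), lt_max_of_lt_left one_pos, fun x hx => ?_⟩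
  rcases le_total x₀ x with h | h
  · exact (hx₀ x h).trans ((le_max_left _ _).trans (le_max_right _ _))
  · refine le_trans ?_ ((le_max_right _ _).trans (le_max_right _ _))
    have h1 : g x ≤ g 0 := hg_anti (mem_Ici.2 le_rfl) hx hx
    have h2 : x ^ p ≤ |x₀| ^ p := Real.rpow_le_rpow hx (h.trans (le_abs_self _)) hp.le
    exact (mul_le_mul_of_nonneg_left h1 (by positivity)).trans
      (mul_le_mul_of_nonneg_right h2 hg0)

lemma rpow_lt_of_lt_mul {g : ℝ → ℝ} {C s z δ : ℝ} (hα : 0 < α) (hr : 0 < r)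
    (hC : 0 < C) (hgC : ∀ x, 0 ≤ x → x ^ ((d:ℝ) + α) * g x ≤ C) (hs : 0 < s) (hst : s ≤ t)
    (hz : 0 < z) (hδ : 0 < δ)
    (h : r < s ^ (-((d : ℝ) / α)) * g (δ / s ^ ((1 : ℝ) / α)) * z) :
    δ ^ ((d:ℝ) + α) < t * C * (z / r) := by
  have h1 := hgC (δ / s ^ ((1 : ℝ) / α)) (by positivity)
  have e1 : (δ / s ^ ((1 : ℝ) / α)) ^ ((d:ℝ) + α) =
      δ ^ ((d:ℝ) + α) * (s ^ (-((d : ℝ) / α)) * s⁻¹) := by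
    rw [Real.div_rpow hδ.le (by positivity), ← Real.rpow_mul hs.le, div_eq_mul_inv,
      ← Real.rpow_neg hs.le, ← Real.rpow_neg_one s, ← Real.rpow_add hs]
    congr 2
    field_simp
    ring
  rw [e1] at h1
  set G := g (δ / s ^ ((1 : ℝ) / α))
  set S := s ^ (-((d : ℝ) / α))
  set P := δ ^ ((d:ℝ) + α)
  have hP : 0 < P := by positivity
  have h2 : P * (S * G) ≤ C * s := by
    have := mul_le_mul_of_nonneg_right h1 hs.le
    calc P * (S * G) = P * (S * s⁻¹) * G * s := by field_simp
      _ ≤ C * s := this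
  rw [← mul_div_assoc, lt_div_iff₀ hr]
  calc P * r < P * (S * G * z) := by gcongr
    _ = P * (S * G) * z := by ring
    _ ≤ C * s * z := by gcongr
    _ ≤ C * t * z := by gcongr
    _ = t * C * z := by ring

variable {g : ℝ → ℝ} {A : Set (EuclideanSpace ℝ (Fin d))}

lemma le_etaABar (hg0 : 0 < g 0) (hA : volume (closure A) ≠ ⊤) :
    volume (closure A) * tauBar d α t lam (r / g 0) ≤ etaABar d α t g lam A r := by
  unfold etaABar
  rw [← measure_mem_and_lt_eq lam isClosed_closure.measurableSet hA hg0]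
  refine measure_mono ?_
  rintro ⟨s, y, z⟩ ⟨hy, hr⟩
  simp only [mem_ofPred_eq] at hy hr ⊢
  rwa [Metric.infDist_zero_of_mem_closure hy, zero_div]

lemma etaABar_le (hα : 0 < α) (hd : 0 < d) (ht : 0 < t) (hA : A.Nonempty)
    (hAb : Bornology.IsBounded A) (hg_anti : AntitoneOn g (Ici 0)) (hg0 : 0 < g 0) {c₀ : ℝ}
    (hg_tail : Tendsto (fun x : ℝ => x ^ ((d:ℝ) + α) * g x) atTop (𝓝 c₀)) {ε : ℝ} (hε : 0 < ε) :
    ∃ K : ℝ≥0∞, K ≠ ⊤ ∧ ∃ κ : ℝ, 0 < κ ∧ ∀ r : ℝ, 0 < r →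
      etaABar d α t g lam A r ≤
        volume (Metric.cthickening ε A) * tauBar d α t lam (r / g 0) +
          K * tailMoment (d / (d + α)) lam κ r := by
  obtain ⟨C, hC, hgC⟩ := exists_rpow_mul_le (by positivity) hg_anti hg_tail hg0.le
  obtain ⟨K, hK, hle⟩ := measure_infDist_rpow_lt_le lam hA hAb
    (by positivity : 0 < (d:ℝ) + α) hε (mul_pos ht hC)
  refine ⟨ENNReal.ofReal t * K, ENNReal.mul_ne_top ENNReal.ofReal_ne_top hK,
    ε ^ ((d:ℝ) + α) / (t * C), by positivity, fun r hr => ?_⟩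
  set W : Set (EuclideanSpace ℝ (Fin d) × ℝ) :=
    {w | ε < Metric.infDist w.1 A ∧ Metric.infDist w.1 A ^ ((d:ℝ) + α) < t * C * (w.2 / r)}
  have hfin : volume (Metric.cthickening ε A) ≠ ⊤ := hAb.cthickening.measure_lt_top.ne
  rw [← measure_mem_and_lt_eq lam Metric.isClosed_cthickening.measurableSet hfin hg0]
  have hW : ((volume.restrict (Ioc (0:ℝ) t)).prod
      ((volume : Measure (EuclideanSpace ℝ (Fin d))).prod (lam.restrict (Ioi (0:ℝ)))))
      (univ ×ˢ W) ≤ ENNReal.ofReal t * K *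
        tailMoment (d / (d + α)) lam (ε ^ ((d:ℝ) + α) / (t * C)) r := by
    rw [Measure.prod_prod, Measure.restrict_apply_univ, Real.volume_Ioc, sub_zero, mul_assoc]
    gcongr
    exact hle r hr
  refine le_trans ?_ (add_le_add_right hW _)
  refine le_trans ?_ (measure_union_le _ _)
  unfold etaABar
  refine measure_mono_ae ?_
  have hs : ∀ᵐ q ∂((volume.restrict (Ioc (0:ℝ) t)).prod
      ((volume : Measure (EuclideanSpace ℝ (Fin d))).prod (lam.restrict (Ioi (0:ℝ))))),
      q.1 ∈ Ioc 0 t :=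
    Measure.quasiMeasurePreserving_fst.ae (ae_restrict_mem measurableSet_Ioc)
  have hz : ∀ᵐ q ∂((volume.restrict (Ioc (0:ℝ) t)).prod
      ((volume : Measure (EuclideanSpace ℝ (Fin d))).prod (lam.restrict (Ioi (0:ℝ))))),
      q.2.2 ∈ Ioi (0:ℝ) :=
    Measure.quasiMeasurePreserving_snd.ae
      (Measure.quasiMeasurePreserving_snd.ae (ae_restrict_mem measurableSet_Ioi))
  filter_upwards [hs, hz]
  rintro ⟨s, y, z⟩ ⟨hs0, hst⟩ hz hq
  simp only at hs0 hst hz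
  rw [mem_Ioi] at hz
  replace hq : r < s ^ (-((d : ℝ) / α)) * g (Metric.infDist y A / s ^ ((1 : ℝ) / α)) * z := hq
  by_cases hy : y ∈ Metric.cthickening ε A
  · refine Or.inl ⟨hy, hq.trans_le ?_⟩
    have hnn : 0 ≤ Metric.infDist y A / s ^ ((1 : ℝ) / α) :=
      div_nonneg Metric.infDist_nonneg (by positivity)
    have : g (Metric.infDist y A / s ^ ((1 : ℝ) / α)) ≤ g 0 :=
      hg_anti (mem_Ici.2 le_rfl) hnn hnn
    simp only
    gcongr
  · have hεy : ε < Metric.infDist y A := by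
      by_contra hcon
      rw [not_lt] at hcon
      apply hy
      rw [Metric.mem_cthickening_iff]
      exact (ENNReal.le_ofReal_iff_toReal_le (Metric.infEDist_ne_top hA) hε.le).2 hcon
    exact Or.inr ⟨mem_univ _, hεy,
      rpow_lt_of_lt_mul hα hr hC hgC hs0 hst hz (hε.trans hεy) hq⟩

end Geometry

lemma tendsto_etaABar_div_tauBar {d : ℕ} {α t : ℝ} {lam : Measure ℝ} [SFinite lam] {g : ℝ → ℝ}
    {A : Set (EuclideanSpace ℝ (Fin d))} (hα : 0 < α) (hd : 0 < d) (ht : 0 < t)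
    (hlam : lam (Ioi 0) ≠ 0) (hfin : lam (Ioi 1) ≠ ⊤)
    (hsmall : ∫⁻ z in Ioc (0:ℝ) 1, ENNReal.ofReal (z ^ (α / (d:ℝ))) ∂lam ≠ ⊤)
    (htail : TailNegligible (α / d) (d / (d + α)) t lam 1) (hA : A.Nonempty)
    (hAb : Bornology.IsBounded A) (hg_anti : AntitoneOn g (Ici 0)) (hg0 : 0 < g 0) {c₀ : ℝ}
    (hg_tail : Tendsto (fun x : ℝ => x ^ ((d:ℝ) + α) * g x) atTop (𝓝 c₀)) :
    Tendsto (fun r => etaABar d α t g lam A r / tauBar d α t lam r) atTop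
      (𝓝 (volume (closure A) * ENNReal.ofReal (g 0 ^ (α / (d:ℝ))))) := by
  have hd' : (0:ℝ) < d := by exact_mod_cast hd
  have htail' : ∀ κ, 0 < κ → TailNegligible (α / d) (d / (d + α)) t lam κ :=
    fun κ hκ => htail.of_one ht hκ
  have hratio : Tendsto (fun r => tauBar d α t lam (r / g 0) / tauBar d α t lam r) atTop
      (𝓝 (ENNReal.ofReal (g 0 ^ (α / (d:ℝ))))) := by
    refine (tendsto_truncMoment_div (by positivity) (by positivity) ht hg0 hlam hsmall hfin
      htail').congr' ?_
    filter_upwards [eventually_gt_atTop 0] with r hr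
    rw [tauBar_eq_truncMoment lam hd hα hr, tauBar_eq_truncMoment lam hd hα (by positivity)]
  have hclosure : volume (closure A) ≠ ⊤ := hAb.closure.measure_lt_top.ne
  refine tendsto_order.2 ⟨fun x hx => ?_, fun x hx => ?_⟩
  · have h1 := ENNReal.Tendsto.const_mul (a := volume (closure A)) hratio (Or.inr hclosure)
    filter_upwards [h1.eventually_const_lt hx] with r h2
    refine h2.trans_le ?_
    rw [← mul_div_assoc]
    gcongr
    exact le_etaABar lam hg0 hclosure
  · have h1 : Tendsto (fun ε => volume (Metric.cthickening ε A) *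
        ENNReal.ofReal (g 0 ^ (α / (d:ℝ)))) (𝓝[>] 0)
        (𝓝 (volume (closure A) * ENNReal.ofReal (g 0 ^ (α / (d:ℝ))))) :=
      ENNReal.Tendsto.mul_const ((tendsto_measure_cthickening
        ⟨1, one_pos, hAb.cthickening.measure_lt_top.ne⟩).mono_left nhdsWithin_le_nhds)
        (Or.inr ENNReal.ofReal_ne_top)
    obtain ⟨ε, hεx, hε⟩ := ((h1.eventually_lt_const hx).and self_mem_nhdsWithin).exists
    obtain ⟨K, hK, κ, hκ, hle⟩ := etaABar_le lam hα hd ht hA hAb hg_anti hg0 hg_tail hε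
    have h2 := (ENNReal.Tendsto.const_mul (a := volume (Metric.cthickening ε A)) hratio
      (Or.inr hAb.cthickening.measure_lt_top.ne)).add
      (ENNReal.Tendsto.const_mul (a := K) (htail' κ hκ) (Or.inr hK))
    rw [mul_zero, add_zero] at h2
    filter_upwards [h2.eventually_lt_const hεx, eventually_gt_atTop 0] with r h3 hr
    refine lt_of_le_of_lt ?_ h3
    rw [← tauBar_eq_truncMoment lam hd hα hr, ← mul_div_assoc, ← mul_div_assoc, ← ENNReal.add_div]
    gcongr
    exact hle r hr

theorem stmt11 (d : ℕ) (hd : 1 ≤ d) (α : ℝ) (hα : α ∈ Set.Ioo (0:ℝ) 2) (t : ℝ) (ht : 0 < t)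
    (lam : MeasureTheory.Measure ℝ) [SigmaFinite lam]
    (hlam0 : lam (Set.Iic 0) = 0) (hlam_ne : lam ≠ 0)
    (hmom : ∫⁻ z in Set.Ioi (0:ℝ), ENNReal.ofReal (min 1 (z ^ 2)) ∂lam ≠ ⊤)
    (g : ℝ → ℝ) (hg_cont : ContinuousOn g (Set.Ici 0))
    (hg_anti : StrictAntiOn g (Set.Ici 0)) (hg_pos : ∀ x : ℝ, 0 ≤ x → 0 < g x)
    (c₀ : ℝ) (hc₀ : 0 < c₀)
    (hg_tail : Filter.Tendsto (fun r : ℝ => r ^ ((d:ℝ) + α) * g r) Filter.atTop (nhds c₀))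
    (hsmall : ∫⁻ z in Set.Ioc (0:ℝ) 1, ENNReal.ofReal (z ^ (α / (d:ℝ))) ∂lam ≠ ⊤)
    (hcase :
      (∫⁻ z in Set.Ioi (1:ℝ),
          ENNReal.ofReal (z ^ max (α / (d:ℝ)) ((d:ℝ) / ((d:ℝ) + α))) ∂lam ≠ ⊤) ∨
      ((d:ℝ) / ((d:ℝ) + α) < α / (d:ℝ) ∧
        ∃ l : ℝ → ℝ, SlowlyVarying l ∧ (∀ x : ℝ, 0 < x → 0 < l x) ∧
          ∀ r : ℝ, 1 ≤ r → (lam (Set.Ioi r)).toReal = l r / r ^ (α / (d:ℝ)))) :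
    ∀ A : Set (EuclideanSpace ℝ (Fin d)), A.Nonempty → Bornology.IsBounded A →
      MeasurableSet A →
      0 < MeasureTheory.volume (closure A) → MeasureTheory.volume (closure A) < ⊤ →
      Filter.Tendsto
        (fun r : ℝ => (etaABar d α t g lam A r).toReal / (tauBar d α t lam r).toReal)
        Filter.atTop
        (nhds ((MeasureTheory.volume (closure A)).toReal * g 0 ^ (α / (d:ℝ)))) := by
  intro A hA hAb _ _ hclosure
  have hd0 : 0 < d := hd
  have hd' : (0:ℝ) < d := by exact_mod_cast hd0
  have hα0 : 0 < α := hα.1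
  have hg0 : 0 < g 0 := hg_pos 0 le_rfl
  have hlam : lam (Ioi 0) ≠ 0 := fun h => hlam_ne <| by
    rw [← Measure.measure_univ_eq_zero, ← Iic_union_Ioi (a := (0:ℝ))]
    exact measure_union_null hlam0 h
  have hfin : lam (Ioi 1) ≠ ⊤ := by
    refine ne_top_of_le_ne_top hmom ?_
    rw [← setLIntegral_one]
    refine (setLIntegral_mono' measurableSet_Ioi fun z hz => ?_).trans
      (lintegral_mono_set (Ioi_subset_Ioi zero_le_one))
    rw [mem_Ioi] at hz
    rw [min_eq_left (one_le_pow₀ hz.le), ENNReal.ofReal_one]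
  have htail : TailNegligible (α / d) (d / (d + α)) t lam 1 := by
    rcases hcase with h | ⟨hba, l, hl, hlpos, heq⟩
    · exact tailNegligible_of_moment ht hlam hfin h (by positivity)
    · exact (hl.regularlyVaryingTail hlpos hfin heq).tailNegligible (by positivity) hba ht
  have key := tendsto_etaABar_div_tauBar hα0 hd0 ht hlam hfin hsmall htail hA hAb
    hg_anti.antitoneOn hg0 hg_tail
  have h := (ENNReal.tendsto_toReal (ENNReal.mul_ne_top hclosure.ne ENNReal.ofReal_ne_top)).comp key
  rw [ENNReal.toReal_mul, ENNReal.toReal_ofReal (by positivity)] at h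
  refine h.congr fun r => ?_
  simp only [Function.comp_apply, ENNReal.toReal_div]
end

section
/- Assume ∫_{(0,1]} z^{α/d} λ(dz) < ∞ and d/(d+α) < α/d, and suppose there are β ∈ (d/(d+α), α/d) and a slowly varying function l at infinity such that λ̄(r) = l(r)/r^{β} for all r ≥ 1. Then for every nonempty bounded Borel set A ⊂ ℝ^d with 0 < |Ā| < ∞, lim_{r→∞} η̄_A(r)/τ̄(r) = |Ā| g(0)^{β} + t^{dβ/α − 1}(1 − dβ/α) ∫_{(0,t]} ∫_{ℝ^d \setminus Ā} s^{-dβ/α} g(d(y,A)/s^{1/α})^{β} dy ds. -/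
open MeasureTheory Set Filter Topology
open scoped ENNReal NNReal

/-- Potter-type upper bound for an eventually antitone function of regular variation. -/
lemma exists_potter_bound {V : ℝ → ℝ} {β ε : ℝ} (hε : 0 < ε) (hεβ : ε < β)
    (hV : AntitoneOn V (Ici 1)) (hpos : ∀ x, 1 ≤ x → 0 < V x)
    (hlim : Tendsto (fun x => V (2 * x) / V x) atTop (𝓝 ((2:ℝ) ^ (-β)))) :
    ∃ X C : ℝ, 1 ≤ X ∧ 0 < C ∧ ∀ x, X ≤ x → ∀ k, 0 < k → X ≤ x / k →
      V (x / k) ≤ C * (k ^ (β + ε) + k ^ (β - ε)) * V x := by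
  have h1 : (2:ℝ) ^ (-β) < 2 ^ (-(β - ε)) :=
    Real.rpow_lt_rpow_of_exponent_lt (by norm_num) (by linarith)
  have h2 : (2:ℝ) ^ (-(β + ε)) < 2 ^ (-β) :=
    Real.rpow_lt_rpow_of_exponent_lt (by norm_num) (by linarith)
  obtain ⟨X, hX⟩ := eventually_atTop.1 ((hlim.eventually (lt_mem_nhds h2)).and
    ((hlim.eventually (gt_mem_nhds h1)).and (eventually_ge_atTop (1:ℝ))))
  have hX1 : 1 ≤ X := (hX X le_rfl).2.2
  have hup : ∀ n : ℕ, ∀ x, X ≤ x → V (2 ^ n * x) ≤ ((2:ℝ) ^ n) ^ (-(β - ε)) * V x := by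
    intro n
    induction n with
    | zero => intro x _; simp
    | succ n ih =>
      intro x hx
      have h2n : X ≤ 2 * x := by linarith
      have h3 := (hX x hx).2.1
      rw [div_lt_iff₀ (hpos x (hX1.trans hx))] at h3
      calc V (2 ^ (n + 1) * x) = V (2 ^ n * (2 * x)) := by ring_nf
        _ ≤ ((2:ℝ) ^ n) ^ (-(β - ε)) * V (2 * x) := ih _ h2n
        _ ≤ ((2:ℝ) ^ n) ^ (-(β - ε)) * (2 ^ (-(β - ε)) * V x) := by gcongr
        _ = ((2:ℝ) ^ (n + 1)) ^ (-(β - ε)) * V x := by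
          rw [pow_succ, Real.mul_rpow (by positivity) (by norm_num)]; ring
  have hlow : ∀ n : ℕ, ∀ x, X ≤ x → V x ≤ ((2:ℝ) ^ n) ^ (β + ε) * V (2 ^ n * x) := by
    intro n
    induction n with
    | zero => intro x _; simp
    | succ n ih =>
      intro x hx
      have h2n : X ≤ 2 * x := by linarith
      have h3 := (hX x hx).1
      rw [lt_div_iff₀ (hpos x (hX1.trans hx)), Real.rpow_neg (by norm_num),
        inv_mul_lt_iff₀ (by positivity)] at h3
      calc V x ≤ 2 ^ (β + ε) * V (2 * x) := h3.le
        _ ≤ 2 ^ (β + ε) * (((2:ℝ) ^ n) ^ (β + ε) * V (2 ^ n * (2 * x))) := by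
          gcongr; exact ih _ h2n
        _ = ((2:ℝ) ^ (n + 1)) ^ (β + ε) * V (2 ^ (n + 1) * x) := by
          rw [pow_succ, Real.mul_rpow (by positivity) (by norm_num)]; ring_nf
  refine ⟨X, 2 ^ (β + ε), hX1, by positivity, fun x hx k hk hxk => ?_⟩
  have hVx := hpos x (hX1.trans hx)
  have hx0 : 0 < x := by linarith
  have hka : 0 < k ^ (β - ε) := Real.rpow_pos_of_pos hk _
  have hkb : 0 < k ^ (β + ε) := Real.rpow_pos_of_pos hk _
  rcases le_total k 1 with hk1 | hk1
  · obtain ⟨n, hn1, hn2⟩ := exists_nat_pow_near ((one_le_inv₀ hk).2 hk1) (one_lt_two (α := ℝ))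
    have hle : V (x / k) ≤ V (2 ^ n * x) := by
      have h4 : (2:ℝ) ^ n * x ≤ x / k := by rw [div_eq_inv_mul]; gcongr
      have h5 : (1:ℝ) ≤ 2 ^ n := one_le_pow₀ (by norm_num)
      exact hV (mem_Ici.2 (by nlinarith)) (mem_Ici.2 (by linarith)) h4
    have h6 : ((2:ℝ) ^ n) ^ (-(β - ε)) ≤ 2 ^ (β - ε) * k ^ (β - ε) := by
      rw [← Real.mul_rpow (by norm_num) hk.le, Real.rpow_neg (by positivity),
        ← Real.inv_rpow (by positivity)]
      apply Real.rpow_le_rpow (by positivity) _ (by linarith)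
      rw [inv_le_comm₀ (by positivity) (by positivity), mul_inv]
      rw [pow_succ] at hn2
      linarith
    calc V (x / k) ≤ ((2:ℝ) ^ n) ^ (-(β - ε)) * V x := hle.trans (hup n x hx)
      _ ≤ 2 ^ (β - ε) * k ^ (β - ε) * V x := by gcongr
      _ ≤ 2 ^ (β + ε) * (k ^ (β + ε) + k ^ (β - ε)) * V x := by
        gcongr
        · norm_num
        · linarith
        · linarith
  · obtain ⟨n, hn1, hn2⟩ := exists_nat_pow_near hk1 (one_lt_two (α := ℝ))
    have hxk0 : 0 < x / k := by positivity
    have hle : V (2 ^ (n + 1) * (x / k)) ≤ V x := by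
      have h4 : x ≤ 2 ^ (n + 1) * (x / k) := by
        rw [← mul_div_assoc, le_div_iff₀ hk, mul_comm]; gcongr
      exact hV (mem_Ici.2 (by linarith)) (mem_Ici.2 (by linarith)) h4
    have hVn : 0 ≤ V (2 ^ (n + 1) * (x / k)) := by
      refine (hpos _ ((hX1.trans hxk).trans ?_)).le
      exact le_mul_of_one_le_left hxk0.le (one_le_pow₀ (by norm_num))
    have h6 : ((2:ℝ) ^ (n + 1)) ^ (β + ε) ≤ 2 ^ (β + ε) * k ^ (β + ε) := by
      rw [← Real.mul_rpow (by norm_num) hk.le]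
      apply Real.rpow_le_rpow (by positivity) _ (by linarith)
      rw [pow_succ]; linarith
    calc V (x / k) ≤ ((2:ℝ) ^ (n + 1)) ^ (β + ε) * V (2 ^ (n + 1) * (x / k)) := hlow _ _ hxk
      _ ≤ 2 ^ (β + ε) * k ^ (β + ε) * V x := by gcongr
      _ ≤ 2 ^ (β + ε) * (k ^ (β + ε) + k ^ (β - ε)) * V x := by
        gcongr
        linarith

lemma lintegral_tail_near_zero_le (lam : Measure ℝ) [SigmaFinite lam] {p : ℝ} (hp : 0 < p)
    (t X : ℝ) (hX : 0 < X) {a : ℝ} (ha : 0 < a) :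
    ∫⁻ s in Ioc 0 t, (if s ^ p / a < X then lam (Ioi (s ^ p / a)) else 0) ≤
      ENNReal.ofReal (a ^ (1 / p)) *
        ∫⁻ z in Ioi 0, ENNReal.ofReal (min z X ^ (1 / p)) ∂lam := by
  have hmeas : MeasurableSet {q : ℝ × ℝ | q.1 ^ p / a < min q.2 X} :=
    measurableSet_lt (by fun_prop) (by fun_prop)
  calc _ = ∫⁻ s in Ioc 0 t, ∫⁻ z in Ioi 0,
        {q : ℝ × ℝ | q.1 ^ p / a < min q.2 X}.indicator 1 (s, z) ∂lam := by
        refine setLIntegral_congr_fun measurableSet_Ioc fun s hs => ?_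
        have hs0 : 0 < s ^ p / a := div_pos (Real.rpow_pos_of_pos hs.1 _) ha
        split_ifs with hsX
        · rw [← lintegral_indicator measurableSet_Ioi,
            ← lintegral_indicator_one measurableSet_Ioi]
          refine lintegral_congr fun z => ?_
          simp only [indicator, mem_Ioi, mem_ofPred_eq, lt_min_iff, hsX, and_true, Pi.one_apply]
          split_ifs <;> first | rfl | (exfalso; linarith)
        · simp [indicator, hsX]
    _ = ∫⁻ z in Ioi 0, (∫⁻ s in Ioc 0 t,
        {q : ℝ × ℝ | q.1 ^ p / a < min q.2 X}.indicator 1 (s, z)) ∂lam :=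
        lintegral_lintegral_swap (f := fun s z =>
          {q : ℝ × ℝ | q.1 ^ p / a < min q.2 X}.indicator 1 (s, z)) (measurable_one.indicator hmeas).aemeasurable
    _ ≤ ∫⁻ z in Ioi 0, ENNReal.ofReal (a ^ (1 / p)) * ENNReal.ofReal (min z X ^ (1 / p)) ∂lam := by
        refine setLIntegral_mono' measurableSet_Ioi fun z hz => ?_
        have hm : 0 < min z X := lt_min hz hX
        rw [← ENNReal.ofReal_mul (by positivity), ← Real.mul_rpow ha.le hm.le]
        calc _ ≤ ∫⁻ s, (Ioc 0 ((a * min z X) ^ (1 / p))).indicator 1 s := by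
              rw [← lintegral_indicator measurableSet_Ioc]
              refine lintegral_mono fun s => ?_
              simp only [indicator, mem_Ioc, mem_ofPred_eq, Pi.one_apply]
              split_ifs with h1 h2 h3 <;> simp
              apply h3
              refine ⟨h1.1, ?_⟩
              rw [one_div, Real.le_rpow_inv_iff_of_pos h1.1.le (by positivity) hp]
              rw [div_lt_iff₀ ha] at h2
              linarith
          _ = _ := by
              rw [lintegral_indicator_one measurableSet_Ioc]; simp
    _ = _ := lintegral_const_mul _ (by fun_prop)

/-- The tail of `lam` composed with a kernel dominated by `s ^ (-p) * G y` inherits the regular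
variation of `lam`. -/
lemma tendsto_lintegral_tail_div {E : Type*} [MeasurableSpace E] (ν : Measure E) [SFinite ν]
    (lam : Measure ℝ) [SigmaFinite lam] {p t β ε : ℝ} (hp : 0 < p) (hε : 0 < ε) (hεβ : ε < β)
    (hpβ : p * (β + ε) < 1)
    (hpos : ∀ x, 1 ≤ x → 0 < (lam (Ioi x)).toReal)
    (hlim : ∀ c : ℝ, 0 < c → Tendsto (fun x => (lam (Ioi (c * x))).toReal / (lam (Ioi x)).toReal)
      atTop (𝓝 (c ^ (-β))))
    (hsmall : ∫⁻ z in Ioc (0:ℝ) 1, ENNReal.ofReal (z ^ (1 / p)) ∂lam ≠ ⊤)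
    {h : ℝ × E → ℝ} (hh : Measurable h) {G : E → ℝ} (hG : Measurable G) (hG0 : ∀ y, 0 < G y)
    (hhG : ∀ s ∈ Ioc 0 t, ∀ y, 0 < h (s, y) ∧ h (s, y) ≤ s ^ (-p) * G y)
    (hGint : ∀ q ∈ Icc (β - ε) (1 / p), ∫⁻ y, ENNReal.ofReal (G y ^ q) ∂ν ≠ ⊤) :
    ∫⁻ w, ENNReal.ofReal (h w ^ β) ∂((volume.restrict (Ioc 0 t)).prod ν) ≠ ⊤ ∧
    Tendsto (fun r => (∫⁻ w, lam (Ioi (r / h w)) ∂((volume.restrict (Ioc 0 t)).prod ν)) /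
      lam (Ioi r)) atTop
      (𝓝 (∫⁻ w, ENNReal.ofReal (h w ^ β) ∂((volume.restrict (Ioc 0 t)).prod ν))) := by
  have hfin : ∀ x : ℝ, 1 ≤ x → lam (Ioi x) ≠ ⊤ := fun x hx htop => by
    simpa [htop] using hpos x hx
  have hanti : Antitone fun x : ℝ => lam (Ioi x) := fun x y hxy =>
    measure_mono (Ioi_subset_Ioi hxy)
  obtain ⟨X, C, hX1, hC, hpot⟩ := exists_potter_bound (V := fun x => (lam (Ioi x)).toReal) hε hεβ
    (fun x hx y _ hxy => ENNReal.toReal_mono (hfin x hx) (hanti hxy)) hpos (hlim 2 two_pos)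
  have hX0 : 0 < X := by linarith
  have hp1 : β + ε < 1 / p := by rw [lt_div_iff₀ hp]; linarith
  set μ := (volume.restrict (Ioc 0 t)).prod ν with hμ
  let k : ℝ × E → ℝ := fun w => w.1 ^ (-p) * G w.2
  have hk : Measurable k := by fun_prop
  have hmem : ∀ᵐ w ∂μ, w.1 ∈ Ioc 0 t :=
    Measure.quasiMeasurePreserving_fst.ae (ae_restrict_mem measurableSet_Ioc)
  have hk0 : ∀ w : ℝ × E, w.1 ∈ Ioc 0 t → 0 < k w := fun w hw =>
    mul_pos (Real.rpow_pos_of_pos hw.1 _) (hG0 _)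
  have hkint : ∀ q, β - ε ≤ q → q ≤ β + ε → ∫⁻ w, ENNReal.ofReal (k w ^ q) ∂μ ≠ ⊤ := by
    intro q hq1 hq2
    have h1 : ∫⁻ w, ENNReal.ofReal (k w ^ q) ∂μ =
        (∫⁻ s in Ioc 0 t, ENNReal.ofReal (s ^ (-(p * q)))) *
          ∫⁻ y, ENNReal.ofReal (G y ^ q) ∂ν := by
      rw [← lintegral_prod_mul (by fun_prop) (by fun_prop)]
      refine lintegral_congr_ae ?_
      filter_upwards [hmem] with w hw
      have hs := hw.1
      simp only [k]
      rw [Real.mul_rpow (by positivity) (hG0 _).le, ← Real.rpow_mul hs.le, neg_mul,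
        ENNReal.ofReal_mul (by positivity)]
    rw [h1]
    refine ENNReal.mul_ne_top ?_ (hGint q ⟨hq1, hq2.trans hp1.le⟩)
    have h2 : IntegrableOn (fun s : ℝ => s ^ (-(p * q))) (Ioc 0 t) := by
      refine (intervalIntegral.intervalIntegrable_rpow' (a := 0) (b := t) ?_).1
      nlinarith
    exact (Integrable.lintegral_lt_top h2).ne
  have hkh : ∀ w : ℝ × E, w.1 ∈ Ioc 0 t → ∀ r : ℝ, 0 < r → r / k w ≤ r / h w := by
    intro w hw r hr
    exact div_le_div_of_nonneg_left hr.le (hhG w.1 hw w.2).1 (hhG w.1 hw w.2).2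
  have hβint : ∫⁻ w, ENNReal.ofReal (h w ^ β) ∂μ ≠ ⊤ := by
    refine ne_top_of_le_ne_top (hkint β (by linarith) (by linarith)) (lintegral_mono_ae ?_)
    filter_upwards [hmem] with w hw
    have := hhG w.1 hw w.2
    exact ENNReal.ofReal_le_ofReal (Real.rpow_le_rpow this.1.le this.2 (by linarith))
  refine ⟨hβint, ?_⟩
  have hNh : ∀ r : ℝ, Measurable fun w => lam (Ioi (r / h w)) := fun r =>
    hanti.measurable.comp (by fun_prop)
  have hset : ∀ r : ℝ, MeasurableSet {w : ℝ × E | r / k w < X} := fun r =>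
    measurableSet_lt (by fun_prop) measurable_const
  let F : ℝ → ℝ × E → ℝ≥0∞ := fun r w =>
    if r / k w < X then 0 else lam (Ioi (r / h w)) / lam (Ioi r)
  have hFm : ∀ r, Measurable (F r) := fun r =>
    Measurable.ite (hset r) measurable_const ((hNh r).div_const _)
  have hF : Tendsto (fun r => ∫⁻ w, F r w ∂μ) atTop
      (𝓝 (∫⁻ w, ENNReal.ofReal (h w ^ β) ∂μ)) := by
    refine tendsto_lintegral_filter_of_dominated_convergence
      (fun w => ENNReal.ofReal C * (ENNReal.ofReal (k w ^ (β + ε)) +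
        ENNReal.ofReal (k w ^ (β - ε))))
      (Eventually.of_forall hFm) ?_ ?_ ?_
    · filter_upwards [eventually_ge_atTop X] with r hr
      filter_upwards [hmem] with w hw
      have hkw := hk0 w hw
      have hr0 : 0 < r := by linarith
      simp only [F]
      split_ifs with hlt
      · exact zero_le
      · push Not at hlt
        refine ENNReal.div_le_of_le_mul ((hanti (hkh w hw r hr0)).trans ?_)
        beta_reduce
        rw [← ENNReal.ofReal_add (by positivity) (by positivity), ← ENNReal.ofReal_mul hC.le,
          ← ENNReal.ofReal_toReal (hfin r (hX1.trans hr)), ← ENNReal.ofReal_mul (by positivity),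
          ← ENNReal.ofReal_toReal (hfin _ (hX1.trans hlt))]
        exact ENNReal.ofReal_le_ofReal (hpot r hr (k w) hkw hlt)
    · rw [lintegral_const_mul _ (by fun_prop), lintegral_add_left (by fun_prop)]
      exact ENNReal.mul_ne_top ENNReal.ofReal_ne_top (ENNReal.add_ne_top.2
        ⟨hkint _ (by linarith) le_rfl, hkint _ le_rfl (by linarith)⟩)
    · filter_upwards [hmem] with w hw
      have hkw := hk0 w hw
      have hhw := (hhG w.1 hw w.2).1
      have h1 := ENNReal.tendsto_ofReal (hlim (h w)⁻¹ (inv_pos.2 hhw))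
      rw [Real.inv_rpow hhw.le, Real.rpow_neg hhw.le, inv_inv] at h1
      refine h1.congr' ?_
      filter_upwards [eventually_ge_atTop (X * k w), eventually_ge_atTop X] with r hr hrX
      have hr0 : 0 < r := by linarith
      have hge : X ≤ r / k w := (le_div_iff₀ hkw).2 hr
      simp only [F, not_lt.2 hge, if_false]
      rw [ENNReal.ofReal_div_of_pos (hpos r (hX1.trans hrX)), ← div_eq_inv_mul,
        ENNReal.ofReal_toReal (hfin _ (hX1.trans (hge.trans (hkh w hw r hr0)))),
        ENNReal.ofReal_toReal (hfin r (hX1.trans hrX))]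
  let R : ℝ → ℝ × E → ℝ≥0∞ := fun r w => if r / k w < X then lam (Ioi (r / h w)) else 0
  set K : ℝ≥0∞ := (∫⁻ z in Ioi 0, ENNReal.ofReal (min z X ^ (1 / p)) ∂lam) *
    ∫⁻ y, ENNReal.ofReal (G y ^ (1 / p)) ∂ν with hK
  have hKtop : K ≠ ⊤ := by
    refine ENNReal.mul_ne_top ?_ (hGint _ ⟨by linarith, le_rfl⟩)
    rw [← Ioc_union_Ioi_eq_Ioi zero_le_one]
    refine ne_top_of_le_ne_top ?_ (lintegral_union_le _ _ _)
    refine ENNReal.add_ne_top.2 ⟨ne_top_of_le_ne_top hsmall ?_, ne_top_of_le_ne_top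
      (b := ∫⁻ z in Ioi (1:ℝ), ENNReal.ofReal (X ^ (1 / p)) ∂lam) ?_ ?_⟩
    · refine setLIntegral_mono' measurableSet_Ioc fun z hz => ENNReal.ofReal_le_ofReal ?_
      exact Real.rpow_le_rpow (lt_min hz.1 hX0).le (min_le_left _ _) (by positivity)
    · simpa using ENNReal.mul_ne_top ENNReal.ofReal_ne_top (hfin 1 le_rfl)
    · refine setLIntegral_mono' measurableSet_Ioi fun z hz => ENNReal.ofReal_le_ofReal ?_
      refine Real.rpow_le_rpow (lt_min (zero_lt_one.trans hz) hX0).le (min_le_right _ _)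
        (by positivity)
  have hRle : ∀ r : ℝ, 0 < r → ∫⁻ w, R r w ∂μ ≤ ENNReal.ofReal (r ^ (-(1 / p))) * K := by
    intro r hr
    calc ∫⁻ w, R r w ∂μ
        ≤ ∫⁻ w, (if r / k w < X then lam (Ioi (r / k w)) else 0) ∂μ := by
          refine lintegral_mono_ae ?_
          filter_upwards [hmem] with w hw
          simp only [R]
          split_ifs
          · exact hanti (hkh w hw r hr)
          · exact le_rfl
      _ = ∫⁻ y, (∫⁻ s in Ioc 0 t,
            (if r / k (s, y) < X then lam (Ioi (r / k (s, y))) else 0)) ∂ν :=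
          lintegral_prod_symm _ (Measurable.ite (hset r)
            (hanti.measurable.comp (by fun_prop)) measurable_const).aemeasurable
      _ ≤ ∫⁻ y, ENNReal.ofReal ((G y / r) ^ (1 / p)) *
            (∫⁻ z in Ioi 0, ENNReal.ofReal (min z X ^ (1 / p)) ∂lam) ∂ν := by
          refine lintegral_mono fun y => ?_
          refine le_trans (le_of_eq ?_)
            (lintegral_tail_near_zero_le lam hp t X hX0 (div_pos (hG0 y) hr))
          refine setLIntegral_congr_fun measurableSet_Ioc fun s hs => ?_
          have : r / k (s, y) = s ^ p / (G y / r) := by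
            have h1 := (Real.rpow_pos_of_pos hs.1 p).ne'
            have h2 := (hG0 y).ne'
            simp only [k]
            rw [Real.rpow_neg hs.1.le]
            field_simp
          simp only [this]
      _ = _ := by
          have hGr : ∫⁻ y, ENNReal.ofReal ((G y / r) ^ (1 / p)) ∂ν =
              ENNReal.ofReal (r ^ (-(1 / p))) * ∫⁻ y, ENNReal.ofReal (G y ^ (1 / p)) ∂ν := by
            rw [← lintegral_const_mul _ (by fun_prop)]
            refine lintegral_congr fun y => ?_
            rw [← ENNReal.ofReal_mul (by positivity), div_eq_inv_mul,
              Real.mul_rpow (by positivity) (hG0 y).le, Real.inv_rpow hr.le, Real.rpow_neg hr.le]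
          rw [lintegral_mul_const _ (by fun_prop), hGr, hK]
          ring
  have hR : Tendsto (fun r => (∫⁻ w, R r w ∂μ) / lam (Ioi r)) atTop (𝓝 0) := by
    set D : ℝ := C * ((X⁻¹) ^ (β + ε) + (X⁻¹) ^ (β - ε)) / (lam (Ioi X)).toReal with hD
    have hVX := hpos X hX1
    have hDpos : 0 < D := by positivity
    have hlim0 : Tendsto (fun r : ℝ => ENNReal.ofReal (r ^ (-(1 / p)) * (D * r ^ (β + ε))) * K)
        atTop (𝓝 0) := by
      have h1 : Tendsto (fun r : ℝ => D * r ^ (-(1 / p - (β + ε)))) atTop (𝓝 (D * 0)) :=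
        (tendsto_rpow_neg_atTop (by linarith)).const_mul D
      rw [mul_zero] at h1
      have h2 := ENNReal.Tendsto.mul_const (ENNReal.tendsto_ofReal h1) (b := K) (Or.inr hKtop)
      rw [ENNReal.ofReal_zero, zero_mul] at h2
      refine h2.congr' ?_
      filter_upwards [eventually_gt_atTop 0] with r hr
      have h3 : r ^ (-(1 / p)) * (D * r ^ (β + ε)) = D * r ^ (-(1 / p - (β + ε))) := by
        rw [mul_left_comm, ← Real.rpow_add hr]
        ring_nf
      rw [h3]
    refine tendsto_of_tendsto_of_tendsto_of_le_of_le' tendsto_const_nhds hlim0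
      (Eventually.of_forall fun _ => zero_le) ?_
    filter_upwards [eventually_ge_atTop X] with r hr
    have hr1 : 1 ≤ r := hX1.trans hr
    have hr0 : 0 < r := by linarith
    have hVr := hpos r hr1
    have hlow : 1 ≤ D * r ^ (β + ε) * (lam (Ioi r)).toReal := by
      have h1 := hpot r hr (r / X) (by positivity) (by field_simp; exact le_rfl)
      have h2 : r / (r / X) = X := by field_simp
      simp only [h2] at h1
      have h3 : (r / X) ^ (β + ε) + (r / X) ^ (β - ε) ≤
          ((X⁻¹) ^ (β + ε) + (X⁻¹) ^ (β - ε)) * r ^ (β + ε) := by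
        rw [div_eq_inv_mul, Real.mul_rpow (by positivity) hr0.le,
          Real.mul_rpow (by positivity) hr0.le, add_mul]
        gcongr
        linarith
      have h4 : (lam (Ioi X)).toReal ≤
          C * (((X⁻¹) ^ (β + ε) + (X⁻¹) ^ (β - ε)) * r ^ (β + ε)) * (lam (Ioi r)).toReal :=
        h1.trans (by gcongr)
      have h5 : D * r ^ (β + ε) * (lam (Ioi r)).toReal =
          C * (((X⁻¹) ^ (β + ε) + (X⁻¹) ^ (β - ε)) * r ^ (β + ε)) * (lam (Ioi r)).toReal /
            (lam (Ioi X)).toReal := by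
        rw [hD]; ring
      rw [h5, one_le_div hVX]
      exact h4
    have hlow' : 1 ≤ ENNReal.ofReal (D * r ^ (β + ε)) * lam (Ioi r) := by
      rw [← ENNReal.ofReal_toReal (hfin r hr1), ← ENNReal.ofReal_mul (by positivity)]
      exact ENNReal.one_le_ofReal.2 hlow
    refine ENNReal.div_le_of_le_mul ((hRle r hr0).trans ?_)
    calc ENNReal.ofReal (r ^ (-(1 / p))) * K
        ≤ ENNReal.ofReal (r ^ (-(1 / p))) * K *
          (ENNReal.ofReal (D * r ^ (β + ε)) * lam (Ioi r)) := le_mul_of_one_le_right' hlow'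
      _ = _ := by
        rw [ENNReal.ofReal_mul (p := r ^ (-(1 / p))) (by positivity)]
        ring
  have hsum : (fun r => (∫⁻ w, lam (Ioi (r / h w)) ∂μ) / lam (Ioi r)) = fun r =>
      ∫⁻ w, F r w ∂μ + (∫⁻ w, R r w ∂μ) / lam (Ioi r) := by
    funext r
    have hRm : Measurable (R r) := Measurable.ite (hset r) (hNh r) measurable_const
    rw [div_eq_mul_inv, div_eq_mul_inv, ← lintegral_mul_const _ (hNh r),
      ← lintegral_mul_const _ hRm, ← lintegral_add_left (hFm r)]
    refine lintegral_congr fun w => ?_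
    simp only [F, R]
    split_ifs <;> simp [div_eq_mul_inv]
  rw [hsum]
  simpa using hF.add hR

lemma measure_prod_setOf_lt_mul {Ω : Type*} [MeasurableSpace Ω] (μ : Measure Ω) [SFinite μ]
    (lam : Measure ℝ) [SigmaFinite lam] {h : Ω → ℝ} (hh : Measurable h)
    (hpos : ∀ᵐ w ∂μ, 0 < h w) {r : ℝ} (hr : 0 < r) :
    (μ.prod (lam.restrict (Ioi 0))) {q : Ω × ℝ | r < h q.1 * q.2} =
      ∫⁻ w, lam (Ioi (r / h w)) ∂μ := by
  rw [Measure.prod_apply (measurableSet_lt (by fun_prop) (by fun_prop))]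
  refine lintegral_congr_ae ?_
  filter_upwards [hpos] with w hw
  have h1 : Prod.mk w ⁻¹' {q : Ω × ℝ | r < h q.1 * q.2} = Ioi (r / h w) := by
    ext z
    simp [div_lt_iff₀ hw, mul_comm]
  rw [h1, Measure.restrict_apply measurableSet_Ioi,
    inter_eq_left.2 (Ioi_subset_Ioi (by positivity))]

lemma exists_le_mul_one_add_rpow_neg {g : ℝ → ℝ} (hg_anti : AntitoneOn g (Ici 0))
    (hg_pos : ∀ x : ℝ, 0 ≤ x → 0 < g x) {a c₀ : ℝ} (ha : 0 ≤ a)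
    (hg_tail : Tendsto (fun r : ℝ => r ^ a * g r) atTop (𝓝 c₀)) :
    ∃ C : ℝ, 0 < C ∧ ∀ x, 0 ≤ x → g x ≤ C * (1 + x) ^ (-a) := by
  obtain ⟨X, hX⟩ := eventually_atTop.1
    ((hg_tail.eventually (gt_mem_nhds (lt_add_one c₀))).and (eventually_ge_atTop (1:ℝ)))
  have hX1 : 1 ≤ X := (hX X le_rfl).2
  have hg0 := hg_pos 0 le_rfl
  have hc : 0 < c₀ + 1 := by
    have h1 := (hX X le_rfl).1
    have h2 := hg_pos X (by linarith)
    have h3 : 0 < X ^ a * g X := by positivity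
    linarith
  refine ⟨g 0 * (1 + X) ^ a + 2 ^ a * (c₀ + 1), by positivity, fun x hx => ?_⟩
  have hx1 : 0 < (1 + x) ^ a := by positivity
  rw [Real.rpow_neg (by positivity), ← div_eq_mul_inv, le_div_iff₀ hx1]
  rcases le_total x X with hxX | hxX
  · have h1 : g x * (1 + x) ^ a ≤ g 0 * (1 + X) ^ a := by
      have := hg_anti (mem_Ici.2 le_rfl) (mem_Ici.2 hx) hx
      gcongr
    have h2 : 0 ≤ 2 ^ a * (c₀ + 1) := by positivity
    linarith
  · have hgx := hg_pos x hx
    have h1 : g x * (1 + x) ^ a ≤ 2 ^ a * (c₀ + 1) := by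
      calc g x * (1 + x) ^ a ≤ g x * (2 * x) ^ a := by gcongr; linarith
        _ = 2 ^ a * (x ^ a * g x) := by rw [Real.mul_rpow (by norm_num) hx]; ring
        _ ≤ _ := by gcongr; exact (hX x hxX).1.le
    have h2 : 0 ≤ g 0 * (1 + X) ^ a := by positivity
    linarith

lemma lintegral_rpow_comp_infDist_ne_top {d : ℕ} {g : ℝ → ℝ} (hg_anti : AntitoneOn g (Ici 0))
    (hg_pos : ∀ x : ℝ, 0 ≤ x → 0 < g x) {a c₀ : ℝ} (ha : 0 < a)
    (hg_tail : Tendsto (fun r : ℝ => r ^ a * g r) atTop (𝓝 c₀))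
    {A : Set (EuclideanSpace ℝ (Fin d))} (hA : A.Nonempty) (hAb : Bornology.IsBounded A)
    {T q : ℝ} (hT : 0 < T) (hq0 : 0 < q) (hq : d < a * q) :
    ∫⁻ y, ENNReal.ofReal (g (Metric.infDist y A / T) ^ q) ≠ ⊤ := by
  obtain ⟨C, hC, hgC⟩ := exists_le_mul_one_add_rpow_neg hg_anti hg_pos ha.le hg_tail
  obtain ⟨R, hR0, hR⟩ := hAb.exists_pos_norm_le
  set K := 1 + R + T with hK
  have hK0 : 0 < K := by positivity
  have hint : ∫⁻ y : EuclideanSpace ℝ (Fin d),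
      ENNReal.ofReal ((1 + ‖y‖) ^ (-(a * q))) ≠ ⊤ :=
    (finite_integral_one_add_norm (by simpa using hq)).ne
  refine ne_top_of_le_ne_top (b := ENNReal.ofReal (C ^ q * K ^ (a * q)) *
    ∫⁻ y : EuclideanSpace ℝ (Fin d), ENNReal.ofReal ((1 + ‖y‖) ^ (-(a * q))))
    (ENNReal.mul_ne_top ENNReal.ofReal_ne_top hint) ?_
  rw [← lintegral_const_mul _ (by fun_prop)]
  refine lintegral_mono fun y => ?_
  rw [← ENNReal.ofReal_mul (by positivity)]
  refine ENNReal.ofReal_le_ofReal ?_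
  set x := Metric.infDist y A / T with hx
  have hx0 : 0 ≤ x := div_nonneg Metric.infDist_nonneg hT.le
  have hdist : ‖y‖ - R ≤ Metric.infDist y A := by
    refine (Metric.le_infDist hA).2 fun z hz => ?_
    have h1 := norm_sub_norm_le y z
    have h2 := hR z hz
    rw [dist_eq_norm]
    linarith
  have hle : (1 + ‖y‖) / K ≤ 1 + x := by
    rw [div_le_iff₀ hK0]
    have h1 : Metric.infDist y A = x * T := by rw [hx]; field_simp
    nlinarith [mul_nonneg hx0 hR0.le]
  have hgx := hg_pos x hx0
  calc g x ^ q ≤ (C * ((1 + ‖y‖) / K) ^ (-a)) ^ q := by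
        refine Real.rpow_le_rpow hgx.le ((hgC x hx0).trans ?_) hq0.le
        gcongr C * ?_
        exact Real.rpow_le_rpow_of_nonpos (by positivity) hle (by linarith)
    _ = C ^ q * K ^ (a * q) * (1 + ‖y‖) ^ (-(a * q)) := by
        rw [Real.mul_rpow hC.le (by positivity), ← Real.rpow_mul (by positivity),
          Real.div_rpow (by positivity) hK0.le, neg_mul, Real.rpow_neg hK0.le]
        field_simp

lemma lintegral_Ioc_rpow_neg {t a : ℝ} (ht : 0 < t) (ha : a < 1) :
    ∫⁻ s in Ioc 0 t, ENNReal.ofReal (s ^ (-a)) =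
      ENNReal.ofReal (t ^ (1 - a) / (1 - a)) := by
  rw [← ofReal_integral_eq_lintegral_ofReal
    (intervalIntegral.intervalIntegrable_rpow' (by linarith)).1
    ((ae_restrict_mem measurableSet_Ioc).mono fun s hs => Real.rpow_nonneg hs.1.le _),
    ← intervalIntegral.integral_of_le ht.le, integral_rpow (Or.inl (by linarith)),
    Real.zero_rpow (by linarith)]
  congr 1
  rw [sub_zero, show -a + 1 = 1 - a by ring]

theorem stmt12 (d : ℕ) (hd : 1 ≤ d) (α : ℝ) (hα : α ∈ Set.Ioo (0:ℝ) 2) (t : ℝ) (ht : 0 < t)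
    (lam : MeasureTheory.Measure ℝ) [SigmaFinite lam]
    (hlam0 : lam (Set.Iic 0) = 0) (hlam_ne : lam ≠ 0)
    (hmom : ∫⁻ z in Set.Ioi (0:ℝ), ENNReal.ofReal (min 1 (z ^ 2)) ∂lam ≠ ⊤)
    (g : ℝ → ℝ) (hg_cont : ContinuousOn g (Set.Ici 0))
    (hg_anti : StrictAntiOn g (Set.Ici 0)) (hg_pos : ∀ x : ℝ, 0 ≤ x → 0 < g x)
    (c₀ : ℝ) (hc₀ : 0 < c₀)
    (hg_tail : Filter.Tendsto (fun r : ℝ => r ^ ((d:ℝ) + α) * g r) Filter.atTop (nhds c₀))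
    (hsmall : ∫⁻ z in Set.Ioc (0:ℝ) 1, ENNReal.ofReal (z ^ (α / (d:ℝ))) ∂lam ≠ ⊤)
    (hda : (d:ℝ) / ((d:ℝ) + α) < α / (d:ℝ))
    (β : ℝ) (hβ1 : (d:ℝ) / ((d:ℝ) + α) < β) (hβ2 : β < α / (d:ℝ))
    (l : ℝ → ℝ) (hl : SlowlyVarying l) (hl_pos : ∀ x : ℝ, 0 < x → 0 < l x)
    (hlaml : ∀ r : ℝ, 1 ≤ r → (lam (Set.Ioi r)).toReal = l r / r ^ β) :
    ∀ A : Set (EuclideanSpace ℝ (Fin d)), A.Nonempty → Bornology.IsBounded A →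
      MeasurableSet A →
      0 < MeasureTheory.volume (closure A) → MeasureTheory.volume (closure A) < ⊤ →
      Filter.Tendsto
        (fun r : ℝ => (etaABar d α t g lam A r).toReal / (tauBar d α t lam r).toReal)
        Filter.atTop
        (nhds ((MeasureTheory.volume (closure A)).toReal * g 0 ^ β +
          t ^ ((d:ℝ) * β / α - 1) * (1 - (d:ℝ) * β / α) *
            ∫ s in Set.Ioc (0:ℝ) t, ∫ y in (closure A)ᶜ,
              s ^ (-((d:ℝ) * β / α)) *
                g (Metric.infDist y A / s ^ ((1:ℝ) / α)) ^ β)) := by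
  intro A hA hAb _ _ hAfin
  have hα0 : 0 < α := hα.1
  have hd0 : (0:ℝ) < d := by exact_mod_cast hd
  set p : ℝ := (d:ℝ) / α with hp
  have hp0 : 0 < p := by positivity
  have hpinv : 1 / p = α / d := one_div_div _ _
  have hγ : 0 < (d:ℝ) / (d + α) := by positivity
  obtain ⟨ε, hε, hε1, hε2⟩ : ∃ ε : ℝ, 0 < ε ∧ (d:ℝ) / (d + α) < β - ε ∧ β + ε < 1 / p := by
    refine ⟨min (β - d / (d + α)) (1 / p - β) / 2, ?_, ?_, ?_⟩
    · have : 0 < min (β - d / (d + α)) (1 / p - β) := lt_min (by linarith) (by linarith)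
      linarith
    · linarith [min_le_left (β - d / (d + α)) (1 / p - β)]
    · linarith [min_le_right (β - d / (d + α)) (1 / p - β)]
  have hεβ : ε < β := by linarith
  have hβ0 : 0 < β := by linarith
  have hpβε : p * (β + ε) < 1 := by rw [lt_div_iff₀ hp0] at hε2; linarith
  have hpβ : p * β < 1 := by nlinarith
  have hpos : ∀ x : ℝ, 1 ≤ x → 0 < (lam (Ioi x)).toReal := fun x hx => by
    have h1 := hl_pos x (by linarith)
    rw [hlaml x hx]
    positivity
  have hlim : ∀ c : ℝ, 0 < c → Tendsto
      (fun x => (lam (Ioi (c * x))).toReal / (lam (Ioi x)).toReal) atTop (𝓝 (c ^ (-β))) := by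
    intro c hc
    have h1 := (hl c hc).mul_const (c ^ (-β))
    rw [one_mul] at h1
    refine h1.congr' ?_
    filter_upwards [eventually_ge_atTop 1, eventually_ge_atTop (1 / c)] with x hx hx'
    have hx0 : 0 < x := by linarith
    have h2 : 1 ≤ c * x := by rw [div_le_iff₀ hc] at hx'; linarith
    have h3 := hl_pos x hx0
    rw [hlaml x hx, hlaml _ h2, Real.mul_rpow hc.le hx0.le, Real.rpow_neg hc.le]
    have h4 : 0 < c ^ β := by positivity
    field_simp
  have hsmall' : ∫⁻ z in Ioc (0:ℝ) 1, ENNReal.ofReal (z ^ (1 / p)) ∂lam ≠ ⊤ := by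
    rwa [hpinv]
  have hanti : Antitone fun x : ℝ => lam (Ioi x) := fun x y hxy =>
    measure_mono (Ioi_subset_Ioi hxy)
  set μ := volume.restrict (Ioc 0 t) with hμ
  have hIval : ∫⁻ s, ENNReal.ofReal ((s ^ (-p)) ^ β) ∂μ =
      ENNReal.ofReal (t ^ (1 - p * β) / (1 - p * β)) := by
    rw [← lintegral_Ioc_rpow_neg ht hpβ]
    refine setLIntegral_congr_fun measurableSet_Ioc fun s hs => ?_
    rw [← Real.rpow_mul hs.1.le, neg_mul]
  have htau : Tendsto (fun r => tauBar d α t lam r / lam (Ioi r)) atTop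
      (𝓝 (ENNReal.ofReal (t ^ (1 - p * β) / (1 - p * β)))) := by
    have h1 := (tendsto_lintegral_tail_div (Measure.dirac ()) lam (t := t) hp0 hε hεβ hpβε hpos
      hlim hsmall' (h := fun w => w.1 ^ (-p)) (by fun_prop) (G := fun _ => 1) measurable_const
      (fun _ => one_pos) (fun s hs y => ⟨Real.rpow_pos_of_pos hs.1 _, by simp⟩)
      (fun q _ => by simp)).2
    rw [lintegral_prod _ (by fun_prop)] at h1
    simp only [lintegral_dirac] at h1
    rw [← hμ, hIval] at h1
    refine h1.congr' ?_
    filter_upwards [eventually_gt_atTop 0] with r hr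
    congr 1
    have hm : Measurable fun w : ℝ × Unit => lam (Ioi (r / w.1 ^ (-p))) :=
      hanti.measurable.comp (by fun_prop)
    rw [lintegral_prod _ hm.aemeasurable]
    simp only [lintegral_dirac]
    rw [← measure_prod_setOf_lt_mul μ lam (h := fun s => s ^ (-p)) (by fun_prop)
      ((ae_restrict_mem measurableSet_Ioc).mono fun s hs => Real.rpow_pos_of_pos hs.1 _) hr]
    simp only [tauBar, mul_comm, hμ, hp]
  let g' : ℝ → ℝ := fun x => g (max x 0)
  have hg'c : Continuous g' :=
    hg_cont.comp_continuous (by fun_prop) fun x => mem_Ici.2 (le_max_right _ _)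
  have hg' : ∀ x, 0 ≤ x → g' x = g x := fun x hx => by simp [g', hx]
  let h : ℝ × EuclideanSpace ℝ (Fin d) → ℝ := fun w =>
    w.1 ^ (-p) * g' (Metric.infDist w.2 A / w.1 ^ (1 / α))
  let G : EuclideanSpace ℝ (Fin d) → ℝ := fun y => g (Metric.infDist y A / t ^ (1 / α))
  have hhm : Measurable h := by
    have h1 : Measurable fun w : ℝ × EuclideanSpace ℝ (Fin d) =>
        Metric.infDist w.2 A / w.1 ^ (1 / α) :=
      ((Metric.continuous_infDist_pt A).measurable.comp measurable_snd).div (by fun_prop)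
    exact (measurable_fst.pow_const _).mul (hg'c.measurable.comp h1)
  have harg : ∀ s ∈ Ioc 0 t, ∀ y, 0 ≤ Metric.infDist y A / s ^ (1 / α) := fun s hs y =>
    div_nonneg Metric.infDist_nonneg (Real.rpow_nonneg hs.1.le _)
  have htmem : t ∈ Ioc 0 t := ⟨ht, le_rfl⟩
  have hheq : ∀ s ∈ Ioc 0 t, ∀ y,
      h (s, y) = s ^ (-p) * g (Metric.infDist y A / s ^ (1 / α)) := fun s hs y => by
    simp only [h]
    rw [hg' _ (harg s hs y)]
  have hGm : Measurable G := by
    have h1 : G = fun y => g' (Metric.infDist y A / t ^ (1 / α)) := by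
      funext y
      exact (hg' _ (harg t htmem y)).symm
    rw [h1]
    exact hg'c.measurable.comp ((Metric.continuous_infDist_pt A).measurable.div_const _)
  have hG0 : ∀ y, 0 < G y := fun y => hg_pos _ (harg t htmem y)
  have hhG : ∀ s ∈ Ioc 0 t, ∀ y, 0 < h (s, y) ∧ h (s, y) ≤ s ^ (-p) * G y := by
    intro s hs y
    have hs0 := Real.rpow_pos_of_pos hs.1 (-p)
    rw [hheq s hs y]
    refine ⟨mul_pos hs0 (hg_pos _ (harg s hs y)), ?_⟩
    gcongr
    refine hg_anti.antitoneOn (mem_Ici.2 (harg t htmem y)) (mem_Ici.2 (harg s hs y)) ?_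
    exact div_le_div_of_nonneg_left Metric.infDist_nonneg (Real.rpow_pos_of_pos hs.1 _)
      (Real.rpow_le_rpow hs.1.le hs.2 (by positivity))
  have hGint : ∀ q ∈ Icc (β - ε) (1 / p), ∫⁻ y, ENNReal.ofReal (G y ^ q) ≠ ⊤ := by
    intro q hq
    have hq1 : (d:ℝ) / (d + α) < q := hε1.trans_le hq.1
    refine lintegral_rpow_comp_infDist_ne_top hg_anti.antitoneOn hg_pos (by positivity) hg_tail
      hA hAb (Real.rpow_pos_of_pos ht _) (hγ.trans hq1) ?_
    rw [div_lt_iff₀ (by positivity)] at hq1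
    linarith
  obtain ⟨hIfin, hIlim⟩ := tendsto_lintegral_tail_div volume lam (t := t) hp0 hε hεβ hpβε hpos
    hlim hsmall' hhm hGm hG0 hhG hGint
  rw [← hμ] at hIfin hIlim
  have hmem : ∀ ν : Measure (EuclideanSpace ℝ (Fin d)), ∀ᵐ w ∂(μ.prod ν), w.1 ∈ Ioc 0 t :=
    fun ν => Measure.quasiMeasurePreserving_fst.ae (ae_restrict_mem measurableSet_Ioc)
  have heta : Tendsto (fun r => etaABar d α t g lam A r / lam (Ioi r)) atTop
      (𝓝 (∫⁻ w, ENNReal.ofReal (h w ^ β) ∂(μ.prod volume))) := by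
    refine hIlim.congr' ?_
    filter_upwards [eventually_gt_atTop 0] with r hr
    congr 1
    rw [← measure_prod_setOf_lt_mul (μ.prod volume) lam hhm
      ((hmem volume).mono fun w hw => (hhG w.1 hw w.2).1) hr, etaABar,
      ← (measurePreserving_prodAssoc μ volume (lam.restrict (Ioi 0))).measure_preimage_equiv]
    refine measure_congr ?_
    filter_upwards [Measure.quasiMeasurePreserving_fst.ae (hmem volume)] with w hw
    refine propext ?_
    change r < h w.1 * w.2 ↔
      r < w.1.1 ^ (-p) * g (Metric.infDist w.1.2 A / w.1.1 ^ (1 / α)) * w.2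
    rw [← hheq w.1.1 hw w.1.2]
  set τ : ℝ := t ^ (1 - p * β) / (1 - p * β) with hτ
  have hτ0 : 0 < τ := div_pos (Real.rpow_pos_of_pos ht _) (by linarith)
  have hclm : MeasurableSet (closure A) := isClosed_closure.measurableSet
  set J := ∫⁻ w, ENNReal.ofReal (h w ^ β) ∂(μ.prod (volume.restrict (closure A)ᶜ)) with hJ
  have hsplit : ∫⁻ w, ENNReal.ofReal (h w ^ β) ∂(μ.prod volume) =
      volume (closure A) * ENNReal.ofReal (g 0 ^ β) * ENNReal.ofReal τ + J := by
    have hadd : μ.prod volume =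
        μ.prod (volume.restrict (closure A)) + μ.prod (volume.restrict (closure A)ᶜ) := by
      rw [← Measure.prod_add, Measure.restrict_add_restrict_compl hclm]
    rw [hadd, lintegral_add_measure]
    congr 1
    rw [lintegral_prod _ (by fun_prop), ← hIval, ← lintegral_const_mul _ (by fun_prop)]
    refine setLIntegral_congr_fun measurableSet_Ioc fun s hs => ?_
    have h1 : ∀ y ∈ closure A, ENNReal.ofReal (h (s, y) ^ β) =
        ENNReal.ofReal (g 0 ^ β) * ENNReal.ofReal ((s ^ (-p)) ^ β) := by
      intro y hy
      have hg0 := hg_pos 0 le_rfl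
      rw [hheq s hs y, (Metric.mem_closure_iff_infDist_zero hA).1 hy, zero_div,
        Real.mul_rpow (Real.rpow_nonneg hs.1.le _) hg0.le, mul_comm,
        ENNReal.ofReal_mul (by positivity)]
    rw [setLIntegral_congr_fun hclm h1, setLIntegral_const]
    ring
  have hJfin : J ≠ ⊤ := fun hJt => hIfin (by rw [hsplit, hJt, add_top])
  have hJreal : J.toReal = ∫ s in Ioc (0:ℝ) t, ∫ y in (closure A)ᶜ,
      s ^ (-((d:ℝ) * β / α)) * g (Metric.infDist y A / s ^ ((1:ℝ) / α)) ^ β := by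
    have hnn : 0 ≤ᵐ[μ.prod (volume.restrict (closure A)ᶜ)] fun w => h w ^ β :=
      (hmem _).mono fun w hw => Real.rpow_nonneg (hhG w.1 hw w.2).1.le _
    have hm : Measurable fun w => h w ^ β := hhm.pow_const _
    have hint : Integrable (fun w => h w ^ β) (μ.prod (volume.restrict (closure A)ᶜ)) :=
      (lintegral_ofReal_ne_top_iff_integrable hm.aestronglyMeasurable hnn).1 hJfin
    rw [hJ, ← integral_eq_lintegral_of_nonneg_ae hnn hm.aestronglyMeasurable,
      integral_prod _ hint]
    refine setIntegral_congr_fun measurableSet_Ioc fun s hs => ?_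
    refine integral_congr_ae (Eventually.of_forall fun y => ?_)
    simp only
    rw [hheq s hs y, Real.mul_rpow (Real.rpow_nonneg hs.1.le _) (hg_pos _ (harg s hs y)).le,
      ← Real.rpow_mul hs.1.le, hp]
    congr 2
    ring
  rw [← hJreal]
  have hlimval : (volume (closure A)).toReal * g 0 ^ β +
      t ^ ((d:ℝ) * β / α - 1) * (1 - (d:ℝ) * β / α) * J.toReal =
      (∫⁻ w, ENNReal.ofReal (h w ^ β) ∂(μ.prod volume)).toReal /
        (ENNReal.ofReal τ).toReal := by
    have hg0 := hg_pos 0 le_rfl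
    rw [hsplit, ENNReal.toReal_add (ENNReal.mul_ne_top (ENNReal.mul_ne_top hAfin.ne
      ENNReal.ofReal_ne_top) ENNReal.ofReal_ne_top) hJfin, ENNReal.toReal_mul,
      ENNReal.toReal_mul, ENNReal.toReal_ofReal (by positivity), ENNReal.toReal_ofReal hτ0.le,
      show (d:ℝ) * β / α = p * β by rw [hp]; ring, add_div, mul_div_cancel_right₀ _ hτ0.ne']
    congr 1
    rw [hτ, show p * β - 1 = -(1 - p * β) by ring, Real.rpow_neg ht.le]
    field_simp
  rw [hlimval]
  have h1 := ((ENNReal.tendsto_toReal hIfin).comp heta).div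
    ((ENNReal.tendsto_toReal ENNReal.ofReal_ne_top).comp htau)
    (by rw [ENNReal.toReal_ofReal hτ0.le]; exact hτ0.ne')
  refine h1.congr' ?_
  filter_upwards [eventually_ge_atTop 1] with r hr
  simp only [Function.comp_apply, Pi.div_apply, ENNReal.toReal_div]
  exact div_div_div_cancel_right₀ (hpos r hr).ne' _ _
end

section
/- (i) η̄₀(r) < ∞ for every r > 0 if and only if ∫_{(0,1]} z^{1+α/d} λ(dz) < ∞. (ii) Under this condition, r ↦ η̄₀(r) is continuous and nonincreasing on (0,∞), liminf_{r→∞} r^{1+α/d} η̄₀(r) > 0, η̄₀ is of extended regular variation at infinity, and moreover η̄₀(r) ≍ r^{-(1+α/d)} ∫_{(0,r]} z^{1+α/d} λ(dz) + λ̄(r) as r → ∞. -/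
open MeasureTheory Set Filter Topology
open scoped ENNReal NNReal

/-- The heat-kernel profile `p_s(y) = s^{-d/α} g(|y|/s^{1/α})`. -/
noncomputable def pker (d : ℕ) (α : ℝ) (g : ℝ → ℝ) (s : ℝ)
    (y : EuclideanSpace ℝ (Fin d)) : ℝ :=
  s ^ (-((d : ℝ) / α)) * g (‖y‖ / s ^ ((1 : ℝ) / α))

/-- `etaBar d α t g lam r = η̄(r)`, where
`η(B) = (Leb_(0,t] ⊗ Leb_{ℝ^d} ⊗ λ)({(s,y,z) : p_s(y)·z ∈ B})` and `η̄(r) = η((r,∞))`. -/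
noncomputable def etaBar (d : ℕ) (α t : ℝ) (g : ℝ → ℝ) (lam : MeasureTheory.Measure ℝ)
    (r : ℝ) : ℝ≥0∞ :=
  ((MeasureTheory.volume.restrict (Set.Ioc (0:ℝ) t)).prod
      ((MeasureTheory.volume : MeasureTheory.Measure (EuclideanSpace ℝ (Fin d))).prod
        (lam.restrict (Set.Ioi (0:ℝ)))))
    {q : ℝ × EuclideanSpace ℝ (Fin d) × ℝ | r < pker d α g q.1 q.2.1 * q.2.2}

/-- `etaZeroBar d α t g lam r = η̄₀(r)`, where
`η₀(B) = (Leb_(0,t] ⊗ Leb_{ℝ^d} ⊗ λ)({(s,y,z) : |y| ≤ 1/2, p_s(y)·z ∈ B ∩ (e_{d,α},∞)})`,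
`e_{d,α} = 1` if `d < α` and `e_{d,α} = 0` if `d ≥ α`, and `η̄₀(r) = η₀((r,∞))`. -/
noncomputable def etaZeroBar (d : ℕ) (α t : ℝ) (g : ℝ → ℝ) (lam : MeasureTheory.Measure ℝ)
    (r : ℝ) : ℝ≥0∞ :=
  ((MeasureTheory.volume.restrict (Set.Ioc (0:ℝ) t)).prod
      ((MeasureTheory.volume : MeasureTheory.Measure (EuclideanSpace ℝ (Fin d))).prod
        (lam.restrict (Set.Ioi (0:ℝ)))))
    {q : ℝ × EuclideanSpace ℝ (Fin d) × ℝ |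
      ‖q.2.1‖ ≤ 1 / 2 ∧
        max r (if (d:ℝ) < α then 1 else 0) < pker d α g q.1 q.2.1 * q.2.2}

/-- `f : (0,∞) → (0,∞)` is of extended regular variation at infinity: there are `δ₁, δ₂ ≥ 0`
such that for every `c ≥ 1`,
`c^{-δ₁} ≤ liminf_{s→∞} f(cs)/f(s) ≤ limsup_{s→∞} f(cs)/f(s) ≤ c^{δ₂}`. -/
def ExtendedRegularVariation (f : ℝ → ℝ) : Prop :=
  ∃ δ₁ δ₂ : ℝ, 0 ≤ δ₁ ∧ 0 ≤ δ₂ ∧ ∀ c : ℝ, 1 ≤ c →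
    c ^ (-δ₁) ≤ Filter.liminf (fun s => f (c * s) / f s) Filter.atTop ∧
    Filter.liminf (fun s => f (c * s) / f s) Filter.atTop ≤
      Filter.limsup (fun s => f (c * s) / f s) Filter.atTop ∧
    Filter.limsup (fun s => f (c * s) / f s) Filter.atTop ≤ c ^ δ₂

/-- The space-time region `{(s, y) : 0 < s ≤ t, |y| ≤ 1/2, p_s(y) > u}`. -/
def superlevel (d : ℕ) (α t : ℝ) (g : ℝ → ℝ) (u : ℝ) : Set (ℝ × EuclideanSpace ℝ (Fin d)) :=
  {q | (0 < q.1 ∧ q.1 ≤ t) ∧ ‖q.2‖ ≤ 1 / 2 ∧ u < pker d α g q.1 q.2}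

/-- The volume of the space-time region `{(s, y) : 0 < s ≤ t, |y| ≤ 1/2, p_s(y) > u}`. -/
noncomputable def superlevelVol (d : ℕ) (α t : ℝ) (g : ℝ → ℝ) (u : ℝ) : ℝ≥0∞ :=
  (volume : Measure (ℝ × EuclideanSpace ℝ (Fin d))) (superlevel d α t g u)

theorem superlevelVol_antitone (d : ℕ) (α t : ℝ) (g : ℝ → ℝ) :
    Antitone (superlevelVol d α t g) := fun _ _ huv =>
  measure_mono fun _ hq => ⟨hq.1, hq.2.1, huv.trans_lt hq.2.2⟩

/-- Parabolic scaling of the heat-kernel profile. -/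
theorem pker_scaling {d : ℕ} (hd : 1 ≤ d) {α : ℝ} (hα : 0 < α) (g : ℝ → ℝ) {c s : ℝ}
    (hc : 0 < c) (hs : 0 < s) (y : EuclideanSpace ℝ (Fin d)) :
    pker d α g (c ^ (-(α / d)) * s) (c ^ (-(1 / (d : ℝ))) • y) = c * pker d α g s y := by
  have hd0 : (0 : ℝ) < d := by exact_mod_cast hd
  have hca : 0 < c ^ (-(α / (d : ℝ))) := Real.rpow_pos_of_pos hc _
  have hcb : 0 < c ^ (-(1 / (d : ℝ))) := Real.rpow_pos_of_pos hc _
  have h1 : (c ^ (-(α / (d : ℝ))) * s) ^ (-((d : ℝ) / α)) = c * s ^ (-((d : ℝ) / α)) := by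
    rw [Real.mul_rpow hca.le hs.le, ← Real.rpow_mul hc.le]
    have : -(α / (d : ℝ)) * -((d : ℝ) / α) = 1 := by field_simp
    rw [this, Real.rpow_one]
  have h2 : (c ^ (-(α / (d : ℝ))) * s) ^ (1 / α) = c ^ (-(1 / (d : ℝ))) * s ^ (1 / α) := by
    rw [Real.mul_rpow hca.le hs.le, ← Real.rpow_mul hc.le]
    congr 2
    field_simp
  rw [pker, pker, h1, h2, norm_smul, Real.norm_of_nonneg hcb.le,
    mul_div_mul_left _ _ hcb.ne', mul_assoc]

theorem superlevelVol_le_rpow_mul {d : ℕ} (hd : 1 ≤ d) {α : ℝ} (hα : 0 < α) (t : ℝ)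
    (g : ℝ → ℝ) {c : ℝ} (hc : 1 ≤ c) (u : ℝ) :
    superlevelVol d α t g u ≤
      ENNReal.ofReal (c ^ (1 + α / (d : ℝ))) * superlevelVol d α t g (c * u) := by
  have hd0 : (0 : ℝ) < d := by exact_mod_cast hd
  have hc0 : 0 < c := one_pos.trans_le hc
  set a : ℝ := c ^ (-(α / (d : ℝ))) with ha
  set b : ℝ := c ^ (-(1 / (d : ℝ))) with hb
  have ha0 : 0 < a := Real.rpow_pos_of_pos hc0 _
  have hb0 : 0 < b := Real.rpow_pos_of_pos hc0 _
  have ha1 : a ≤ 1 := Real.rpow_le_one_of_one_le_of_nonpos hc (by simp; positivity)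
  have hb1 : b ≤ 1 := Real.rpow_le_one_of_one_le_of_nonpos hc (by simp)
  have hsub : superlevel d α t g u ⊆
      Prod.map (a * ·) (b • ·) ⁻¹' superlevel d α t g (c * u) := by
    rintro ⟨s, y⟩ ⟨⟨hs, hst⟩, hy, hu⟩
    refine ⟨⟨mul_pos ha0 hs, ?_⟩, ?_, ?_⟩
    · exact (mul_le_of_le_one_left hs.le ha1).trans hst
    · simp only [Prod.map_snd, norm_smul, Real.norm_of_nonneg hb0.le]
      exact (mul_le_of_le_one_left (norm_nonneg _) hb1).trans hy
    · simp only [Prod.map_fst, Prod.map_snd]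
      rw [pker_scaling hd hα g hc0 hs]
      exact mul_lt_mul_of_pos_left hu hc0
  have hmap : Measure.map (Prod.map (a * ·) (b • ·))
      (volume : Measure (ℝ × EuclideanSpace ℝ (Fin d))) =
      ENNReal.ofReal (c ^ (1 + α / (d : ℝ))) • volume := by
    rw [Measure.volume_eq_prod, ← Measure.map_prod_map _ _ (measurable_const_mul a)
      (measurable_const_smul b), Real.map_volume_mul_left ha0.ne',
      Measure.map_addHaar_smul _ hb0.ne', Measure.prod_smul_left, Measure.prod_smul_right,
      smul_smul, ← ENNReal.ofReal_mul (abs_nonneg _)]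
    congr 2
    rw [finrank_euclideanSpace_fin, abs_of_pos (by positivity), abs_of_pos (by positivity),
      ← Real.rpow_natCast b, ha, hb, ← Real.rpow_mul hc0.le, ← Real.rpow_neg hc0.le,
      ← Real.rpow_neg hc0.le, ← Real.rpow_add hc0]
    congr 1
    field_simp
    ring
  calc superlevelVol d α t g u
      ≤ volume (Prod.map (a * ·) (b • ·) ⁻¹' superlevel d α t g (c * u)) := measure_mono hsub
    _ ≤ Measure.map (Prod.map (a * ·) (b • ·)) volume (superlevel d α t g (c * u)) :=
        Measure.le_map_apply
          (((measurable_const_mul a).prodMap (measurable_const_smul b)).aemeasurable) _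
    _ = _ := by rw [hmap]; rfl

theorem superlevelVol_one_pos {d : ℕ} (hd : 1 ≤ d) {α t : ℝ} (hα : 0 < α) (ht : 0 < t)
    {g : ℝ → ℝ} (hg_anti : AntitoneOn g (Ici 0)) (hg1 : 0 < g 1) :
    0 < superlevelVol d α t g 1 := by
  have hd0 : (0 : ℝ) < d := by exact_mod_cast hd
  have hlim : Tendsto (fun s : ℝ => s ^ (-((d : ℝ) / α)) * g 1) (𝓝[>] 0) atTop := by
    refine Tendsto.atTop_mul_const hg1 ?_
    exact tendsto_rpow_neg_nhdsGT_zero (by simp; positivity)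
  obtain ⟨s₁, hs₁, hs₁'⟩ : ∃ s₁ > 0, ∀ s ∈ Ioc (0 : ℝ) s₁, 1 < s ^ (-((d : ℝ) / α)) * g 1 := by
    have := hlim.eventually (eventually_gt_atTop 1)
    obtain ⟨v, hv, h⟩ := (mem_nhdsGT_iff_exists_Ioc_subset).1 this
    exact ⟨v, hv, fun s hs => h hs⟩
  set s₀ := min s₁ t
  have hs₀ : 0 < s₀ := lt_min hs₁ ht
  set ρ := min (1 / 2) ((s₀ / 2) ^ (1 / α))
  have hρ : 0 < ρ := lt_min (by norm_num) (Real.rpow_pos_of_pos (by positivity) _)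
  have hsub : Ioo (s₀ / 2) s₀ ×ˢ Metric.ball (0 : EuclideanSpace ℝ (Fin d)) ρ ⊆
      superlevel d α t g 1 := by
    rintro ⟨s, y⟩ ⟨⟨hs, hs'⟩, hy⟩
    simp only [mem_ball_zero_iff] at hs hs' hy
    have hs0 : 0 < s := (by positivity : 0 < s₀ / 2).trans hs
    refine ⟨⟨hs0, hs'.le.trans (min_le_right _ _)⟩, hy.le.trans (min_le_left _ _), ?_⟩
    refine (hs₁' s ⟨hs0, hs'.le.trans (min_le_left _ _)⟩).trans_le ?_
    refine mul_le_mul_of_nonneg_left (hg_anti ?_ ?_ ?_) (Real.rpow_nonneg hs0.le _)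
    · exact div_nonneg (norm_nonneg _) (Real.rpow_nonneg hs0.le _)
    · exact zero_le_one (α := ℝ)
    · refine div_le_one_of_le₀ ?_ (Real.rpow_nonneg hs0.le _)
      refine hy.le.trans ((min_le_right _ _).trans ?_)
      exact Real.rpow_le_rpow (by positivity) hs.le (by positivity)
  refine lt_of_lt_of_le ?_ (measure_mono hsub)
  rw [Measure.volume_eq_prod, Measure.prod_prod]
  refine ENNReal.mul_pos ?_ (Metric.measure_ball_pos volume _ hρ).ne'
  rw [Real.volume_Ioo]
  simp [hs₀]

theorem exists_le_const_and_rpow_mul_le {α : ℝ} (d : ℕ) {g : ℝ → ℝ}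
    (hα : 0 < α) (hg_anti : AntitoneOn g (Ici 0)) (hg_pos : ∀ x : ℝ, 0 ≤ x → 0 < g x) {c₀ : ℝ}
    (hg_tail : Tendsto (fun r : ℝ => r ^ ((d : ℝ) + α) * g r) atTop (𝓝 c₀)) :
    ∃ K : ℝ, 0 < K ∧ ∀ x, 0 ≤ x → g x ≤ K ∧ x ^ ((d : ℝ) + α) * g x ≤ K := by
  have hev := hg_tail.eventually (eventually_le_nhds (lt_add_one c₀))
  obtain ⟨M, hM⟩ := eventually_atTop.1 hev
  set M' := max M 0
  have hg0 := hg_pos 0 le_rfl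
  refine ⟨max (g 0) (max (c₀ + 1) (M' ^ ((d : ℝ) + α) * g 0)), lt_max_of_lt_left hg0,
    fun x hx => ⟨?_, ?_⟩⟩
  · exact (hg_anti self_mem_Ici hx hx).trans (le_max_left _ _)
  · rcases le_total M x with h | h
    · exact (hM x h).trans ((le_max_left _ _).trans (le_max_right _ _))
    · refine le_trans ?_ ((le_max_right _ _).trans (le_max_right _ _))
      exact mul_le_mul (Real.rpow_le_rpow hx (h.trans (le_max_left _ _)) (by positivity))
        (hg_anti self_mem_Ici hx hx) (hg_pos x hx).le (by positivity)

theorem superlevelVol_le_rpow {d : ℕ} (hd : 1 ≤ d) {α : ℝ} (hα : 0 < α) (t : ℝ)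
    {g : ℝ → ℝ} {K : ℝ} (hK : 0 < K)
    (hgK : ∀ x, 0 ≤ x → g x ≤ K ∧ x ^ ((d : ℝ) + α) * g x ≤ K) {u : ℝ} (hu : 0 < u) :
    superlevelVol d α t g u ≤ ENNReal.ofReal ((K / u) ^ (1 + α / (d : ℝ))) *
      volume (Metric.ball (0 : EuclideanSpace ℝ (Fin d)) 1) := by
  have hd0 : (0 : ℝ) < d := by exact_mod_cast hd
  have hKu : 0 < K / u := by positivity
  have hsub : superlevel d α t g u ⊆ Ioc 0 ((K / u) ^ (α / (d : ℝ))) ×ˢ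
      Metric.closedBall (0 : EuclideanSpace ℝ (Fin d)) ((K / u) ^ (1 / (d : ℝ))) := by
    rintro ⟨s, y⟩ ⟨⟨hs, -⟩, -, hsy⟩
    simp only [pker] at hs hsy
    set x := ‖y‖ / s ^ (1 / α) with hx
    have hsα : 0 < s ^ (1 / α) := Real.rpow_pos_of_pos hs _
    have hx0 : 0 ≤ x := by positivity
    have hsd : 0 < s ^ ((d : ℝ) / α) := Real.rpow_pos_of_pos hs _
    have hs1 : s ^ ((d : ℝ) / α) ≤ K / u := by
      rw [Real.rpow_neg hs.le, inv_mul_eq_div, lt_div_iff₀ hsd] at hsy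
      rw [le_div_iff₀ hu, mul_comm]
      exact hsy.le.trans (hgK x hx0).1
    have hs2 : s ≤ (K / u) ^ (α / (d : ℝ)) := by
      have := Real.rpow_le_rpow hsd.le hs1 (by positivity : 0 ≤ α / (d : ℝ))
      rwa [← Real.rpow_mul hs.le, div_mul_div_cancel₀ hα.ne', div_self hd0.ne',
        Real.rpow_one] at this
    refine ⟨⟨hs, hs2⟩, ?_⟩
    rw [mem_closedBall_zero_iff]
    have hy : ‖y‖ = s ^ (1 / α) * x := by rw [hx]; field_simp
    have hyda : ‖y‖ ^ ((d : ℝ) + α) ≤ (K / u) * s := by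
      rw [hy, Real.mul_rpow hsα.le hx0, ← Real.rpow_mul hs.le]
      have e : 1 / α * ((d : ℝ) + α) = (d : ℝ) / α + 1 := by field_simp
      rw [e, Real.rpow_add hs, Real.rpow_one]
      rw [Real.rpow_neg hs.le, inv_mul_eq_div, lt_div_iff₀ hsd] at hsy
      have h2 := (hgK x hx0).2
      have hX : 0 ≤ x ^ ((d : ℝ) + α) := Real.rpow_nonneg hx0 _
      have h3 : u * s ^ ((d : ℝ) / α) * x ^ ((d : ℝ) + α) ≤ K := by
        refine le_trans ?_ h2
        rw [mul_comm (x ^ _)]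
        exact mul_le_mul_of_nonneg_right hsy.le hX
      have h4 : s ^ ((d : ℝ) / α) * x ^ ((d : ℝ) + α) ≤ K / u := by
        rw [le_div_iff₀ hu]
        linarith
      calc s ^ ((d : ℝ) / α) * s * x ^ ((d : ℝ) + α)
          = s ^ ((d : ℝ) / α) * x ^ ((d : ℝ) + α) * s := by ring
        _ ≤ _ := mul_le_mul_of_nonneg_right h4 hs.le
    have hle : ‖y‖ ^ ((d : ℝ) + α) ≤ ((K / u) ^ (1 / (d : ℝ))) ^ ((d : ℝ) + α) := by
      refine hyda.trans ((mul_le_mul_of_nonneg_left hs2 hKu.le).trans_eq ?_)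
      rw [← Real.rpow_mul hKu.le, ← Real.rpow_one_add' hKu.le (by positivity)]
      congr 1
      field_simp
    exact (Real.rpow_le_rpow_iff (norm_nonneg _) (by positivity) (by positivity)).1 hle
  refine (measure_mono hsub).trans_eq ?_
  rw [Measure.volume_eq_prod, Measure.prod_prod, Real.volume_Ioc,
    Measure.addHaar_closedBall _ _ (by positivity), ← mul_assoc, ← ENNReal.ofReal_mul
    (by simp; positivity), finrank_euclideanSpace_fin, ← Real.rpow_natCast,
    ← Real.rpow_mul hKu.le, sub_zero, ← Real.rpow_add hKu,
    one_div_mul_cancel hd0.ne', add_comm]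

theorem superlevelVol_le_const (d : ℕ) (α : ℝ) {t : ℝ} (g : ℝ → ℝ) (u : ℝ) :
    superlevelVol d α t g u ≤ ENNReal.ofReal t *
      volume (Metric.closedBall (0 : EuclideanSpace ℝ (Fin d)) (1 / 2)) := by
  have hsub : superlevel d α t g u ⊆ Ioc 0 t ×ˢ
      Metric.closedBall (0 : EuclideanSpace ℝ (Fin d)) (1 / 2) := by
    rintro ⟨s, y⟩ ⟨hs, hy, -⟩
    exact ⟨hs, mem_closedBall_zero_iff.2 hy⟩
  refine (measure_mono hsub).trans_eq ?_
  rw [Measure.volume_eq_prod, Measure.prod_prod, Real.volume_Ioc, sub_zero]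

theorem exists_superlevelVol_le {d : ℕ} (hd : 1 ≤ d) {α : ℝ} (hα : 0 < α) (t : ℝ)
    {g : ℝ → ℝ} (hg_anti : AntitoneOn g (Ici 0)) (hg_pos : ∀ x : ℝ, 0 ≤ x → 0 < g x) {c₀ : ℝ}
    (hg_tail : Tendsto (fun r : ℝ => r ^ ((d : ℝ) + α) * g r) atTop (𝓝 c₀)) :
    ∃ A : ℝ≥0∞, A ≠ ⊤ ∧ ∀ u, 0 < u → superlevelVol d α t g u ≤
      A * ENNReal.ofReal (min 1 (u⁻¹ ^ (1 + α / (d : ℝ)))) := by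
  obtain ⟨K, hK, hgK⟩ := exists_le_const_and_rpow_mul_le d hα hg_anti hg_pos hg_tail
  refine ⟨max (ENNReal.ofReal t * volume (Metric.closedBall (0 : EuclideanSpace ℝ (Fin d)) (1 / 2)))
    (ENNReal.ofReal (K ^ (1 + α / (d : ℝ))) *
      volume (Metric.ball (0 : EuclideanSpace ℝ (Fin d)) 1)), ?_, fun u hu => ?_⟩
  · rw [Ne, max_eq_top, not_or]
    exact ⟨ENNReal.mul_ne_top ENNReal.ofReal_ne_top measure_closedBall_lt_top.ne,
      ENNReal.mul_ne_top ENNReal.ofReal_ne_top measure_ball_lt_top.ne⟩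
  · rcases min_cases (1 : ℝ) (u⁻¹ ^ (1 + α / (d : ℝ))) with ⟨h, -⟩ | ⟨h, -⟩
    · rw [h, ENNReal.ofReal_one, mul_one]
      exact (superlevelVol_le_const d α g u).trans (le_max_left _ _)
    · rw [h]
      refine (superlevelVol_le_rpow hd hα t hK hgK hu).trans ?_
      rw [div_eq_mul_inv, Real.mul_rpow hK.le (by positivity), ENNReal.ofReal_mul (by positivity),
        mul_right_comm]
      exact mul_le_mul_left (le_max_right _ _) _

theorem mul_superlevelVol_one_le {d : ℕ} (hd : 1 ≤ d) {α : ℝ} (hα : 0 < α) (t : ℝ)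
    (g : ℝ → ℝ) {u : ℝ} (hu : 0 < u) :
    superlevelVol d α t g 1 * ENNReal.ofReal (min 1 (u⁻¹ ^ (1 + α / (d : ℝ)))) ≤
      superlevelVol d α t g u := by
  rcases le_total u 1 with h | h
  · calc _ ≤ superlevelVol d α t g 1 * ENNReal.ofReal 1 := by gcongr; exact min_le_left _ _
      _ = superlevelVol d α t g 1 := by simp
      _ ≤ _ := superlevelVol_antitone d α t g h
  · have hup : 0 < u ^ (1 + α / (d : ℝ)) := Real.rpow_pos_of_pos hu _
    calc _ ≤ superlevelVol d α t g 1 * ENNReal.ofReal (u⁻¹ ^ (1 + α / (d : ℝ))) := by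
          gcongr; exact min_le_right _ _
      _ ≤ (ENNReal.ofReal (u ^ (1 + α / (d : ℝ))) * superlevelVol d α t g (u * 1)) *
          ENNReal.ofReal (u⁻¹ ^ (1 + α / (d : ℝ))) := by
          gcongr; exact superlevelVol_le_rpow_mul hd hα t g h 1
      _ = _ := by
          rw [mul_right_comm, ← ENNReal.ofReal_mul hup.le, Real.inv_rpow hu.le,
            mul_inv_cancel₀ hup.ne', ENNReal.ofReal_one, one_mul, mul_one]

/-- The integral `∫_{(0,∞)} |{(s, y) : p_s(y) > R / z}| λ(dz)`. -/
noncomputable def tailIntegral (d : ℕ) (α t : ℝ) (g : ℝ → ℝ) (lam : Measure ℝ) (R : ℝ) : ℝ≥0∞ :=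
  ∫⁻ z in Ioi (0 : ℝ), superlevelVol d α t g (R / z) ∂lam

theorem etaZeroBar_eq_tailIntegral (d : ℕ) (α t : ℝ) {g : ℝ → ℝ} (lam : Measure ℝ)
    [SigmaFinite lam] (hg_cont : ContinuousOn g (Ici 0)) (r : ℝ) :
    etaZeroBar d α t g lam r =
      tailIntegral d α t g lam (max r (if (d : ℝ) < α then 1 else 0)) := by
  rw [etaZeroBar, tailIntegral]
  generalize max r (if (d : ℝ) < α then 1 else 0) = R
  set ν := lam.restrict (Ioi (0 : ℝ))
  have hg' : Continuous fun x => g (max x 0) :=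
    hg_cont.comp_continuous (by fun_prop) fun x => mem_Ici.2 (le_max_right _ _)
  set S : Set ((ℝ × EuclideanSpace ℝ (Fin d)) × ℝ) :=
    {q | (0 < q.1.1 ∧ q.1.1 ≤ t) ∧ ‖q.1.2‖ ≤ 1 / 2 ∧
      R < q.1.1 ^ (-((d : ℝ) / α)) * g (max (‖q.1.2‖ / q.1.1 ^ ((1 : ℝ) / α)) 0) * q.2}
  have hS : MeasurableSet S := by
    have hm : Measurable fun q : (ℝ × EuclideanSpace ℝ (Fin d)) × ℝ =>
        g (max (‖q.1.2‖ / q.1.1 ^ ((1 : ℝ) / α)) 0) :=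
      hg'.measurable.comp (f := fun q : (ℝ × EuclideanSpace ℝ (Fin d)) × ℝ =>
        ‖q.1.2‖ / q.1.1 ^ ((1 : ℝ) / α)) (by fun_prop)
    have h1 : Measurable fun q : (ℝ × EuclideanSpace ℝ (Fin d)) × ℝ => q.1.1 := by fun_prop
    have h2 : Measurable fun q : (ℝ × EuclideanSpace ℝ (Fin d)) × ℝ => ‖q.1.2‖ := by fun_prop
    exact ((measurableSet_lt measurable_const h1).inter
      (measurableSet_le h1 measurable_const)).inter ((measurableSet_le h2 measurable_const).inter
        (measurableSet_lt measurable_const (((h1.pow_const _).mul hm).mul measurable_snd)))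
  have hprod : (volume.restrict (Ioc (0 : ℝ) t)).prod
      ((volume : Measure (EuclideanSpace ℝ (Fin d))).prod ν) =
      (volume.prod (volume.prod ν)).restrict (Ioc (0 : ℝ) t ×ˢ univ) := by
    rw [← Measure.prod_restrict, Measure.restrict_univ]
  rw [hprod, Measure.restrict_apply' (measurableSet_Ioc.prod MeasurableSet.univ),
    ← (measurePreserving_prodAssoc volume volume ν).measure_preimage_equiv]
  have hset : MeasurableEquiv.prodAssoc ⁻¹'
      ({q : ℝ × EuclideanSpace ℝ (Fin d) × ℝ |
        ‖q.2.1‖ ≤ 1 / 2 ∧ R < pker d α g q.1 q.2.1 * q.2.2} ∩ Ioc (0 : ℝ) t ×ˢ univ) = S := by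
    ext ⟨⟨s, y⟩, z⟩
    simp only [S, MeasurableEquiv.prodAssoc, MeasurableEquiv.coe_mk, mem_preimage, mem_inter_iff,
      mem_ofPred_eq, Equiv.prodAssoc_apply, mem_prod, mem_univ, and_true, mem_Ioc, pker]
    constructor
    · rintro ⟨⟨h1, h2⟩, h3⟩
      refine ⟨h3, h1, ?_⟩
      rwa [max_eq_left (div_nonneg (norm_nonneg _) (Real.rpow_nonneg h3.1.le _))]
    · rintro ⟨h3, h1, h2⟩
      rw [max_eq_left (div_nonneg (norm_nonneg _) (Real.rpow_nonneg h3.1.le _))] at h2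
      exact ⟨⟨h1, h2⟩, h3⟩
  rw [hset, Measure.prod_apply_symm hS]
  refine setLIntegral_congr_fun measurableSet_Ioi fun z hz => ?_
  rw [superlevelVol, Measure.volume_eq_prod]
  congr 1
  ext ⟨s, y⟩
  simp only [S, mem_preimage, mem_ofPred_eq, superlevel, pker]
  refine and_congr_right fun hs => and_congr_right fun _ => ?_
  rw [max_eq_left (div_nonneg (norm_nonneg _) (Real.rpow_nonneg hs.1.le _)),
    div_lt_iff₀ (mem_Ioi.1 hz)]

theorem tailIntegral_anti (d : ℕ) (α t : ℝ) (g : ℝ → ℝ) (lam : Measure ℝ) :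
    Antitone (tailIntegral d α t g lam) := fun _ _ h =>
  setLIntegral_mono' measurableSet_Ioi fun _ hz =>
    superlevelVol_antitone d α t g (div_le_div_of_nonneg_right h (mem_Ioi.1 hz).le)

theorem tailIntegral_le_rpow_mul {d : ℕ} (hd : 1 ≤ d) {α : ℝ} (hα : 0 < α) (t : ℝ)
    (g : ℝ → ℝ) (lam : Measure ℝ) {c : ℝ} (hc : 1 ≤ c) (R : ℝ) :
    tailIntegral d α t g lam R ≤
      ENNReal.ofReal (c ^ (1 + α / (d : ℝ))) * tailIntegral d α t g lam (c * R) := by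
  rw [tailIntegral, tailIntegral, ← lintegral_const_mul' _ _ ENNReal.ofReal_ne_top]
  refine lintegral_mono fun z => ?_
  simp only [mul_div_assoc]
  exact superlevelVol_le_rpow_mul hd hα t g hc _

/-- The truncated moment integral splits at `R`. -/
theorem lintegral_min_one_div_rpow (lam : Measure ℝ) {p R : ℝ} (hp : 0 < p) (hR : 0 < R) :
    ∫⁻ z in Ioi (0 : ℝ), ENNReal.ofReal (min 1 ((R / z)⁻¹ ^ p)) ∂lam =
      ENNReal.ofReal (R ^ (-p)) * ∫⁻ z in Ioc (0 : ℝ) R, ENNReal.ofReal (z ^ p) ∂lam +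
        lam (Ioi R) := by
  rw [← Ioc_union_Ioi_eq_Ioi hR.le,
    lintegral_union measurableSet_Ioi (Ioc_disjoint_Ioi le_rfl),
    ← lintegral_const_mul' _ _ ENNReal.ofReal_ne_top]
  congr 1
  · refine setLIntegral_congr_fun measurableSet_Ioc fun z hz => ?_
    have hz0 : 0 < z := hz.1
    simp only [inv_div]
    rw [min_eq_right (Real.rpow_le_one (by positivity) ((div_le_one hR).2 hz.2) hp.le),
      Real.div_rpow hz0.le hR.le, ← ENNReal.ofReal_mul (by positivity), Real.rpow_neg hR.le,
      inv_mul_eq_div]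
  · rw [← setLIntegral_one]
    refine setLIntegral_congr_fun measurableSet_Ioi fun z hz => ?_
    simp only [inv_div]
    rw [min_eq_left (Real.one_le_rpow ((one_le_div hR).2 (mem_Ioi.1 hz).le) hp.le),
      ENNReal.ofReal_one]

theorem measure_Ioi_lt_top_of_lintegral_min {lam : Measure ℝ}
    (hmom : ∫⁻ z in Ioi (0 : ℝ), ENNReal.ofReal (min 1 (z ^ 2)) ∂lam ≠ ⊤) {R : ℝ} (hR : 0 < R) :
    lam (Ioi R) < ⊤ := by
  have h : ENNReal.ofReal (min 1 (R ^ 2)) * lam (Ioi R) ≤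
      ∫⁻ z in Ioi (0 : ℝ), ENNReal.ofReal (min 1 (z ^ 2)) ∂lam := by
    calc _ = ∫⁻ _ in Ioi R, ENNReal.ofReal (min 1 (R ^ 2)) ∂lam := by rw [setLIntegral_const]
      _ ≤ ∫⁻ z in Ioi R, ENNReal.ofReal (min 1 (z ^ 2)) ∂lam := by
          refine setLIntegral_mono' measurableSet_Ioi fun z hz => ?_
          have := (mem_Ioi.1 hz).le
          gcongr
      _ ≤ _ := lintegral_mono_set (Ioi_subset_Ioi hR.le)
  have hpos : ENNReal.ofReal (min 1 (R ^ 2)) ≠ 0 := by simp [hR.ne']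
  by_contra hc
  rw [not_lt, top_le_iff] at hc
  rw [hc, ENNReal.mul_top hpos, top_le_iff] at h
  exact hmom h

theorem setLIntegral_Ioc_rpow_lt_top {lam : Measure ℝ} {p : ℝ} (hp : 0 < p)
    (hlam : lam (Ioi 1) < ⊤)
    (h1 : ∫⁻ z in Ioc (0 : ℝ) 1, ENNReal.ofReal (z ^ p) ∂lam ≠ ⊤) (R : ℝ) :
    ∫⁻ z in Ioc (0 : ℝ) R, ENNReal.ofReal (z ^ p) ∂lam < ⊤ := by
  have hsub : Ioc (0 : ℝ) R ⊆ Ioc 0 1 ∪ Ioc 1 R := fun z hz => by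
    rcases le_or_gt z 1 with h | h
    · exact Or.inl ⟨hz.1, h⟩
    · exact Or.inr ⟨h, hz.2⟩
  refine (lintegral_mono_set hsub).trans_lt ((lintegral_union_le _ _ _).trans_lt ?_)
  refine ENNReal.add_lt_top.2 ⟨h1.lt_top, ?_⟩
  calc ∫⁻ z in Ioc 1 R, ENNReal.ofReal (z ^ p) ∂lam
      ≤ ∫⁻ _ in Ioc 1 R, ENNReal.ofReal (R ^ p) ∂lam := by
        refine setLIntegral_mono' measurableSet_Ioc fun z hz => ?_
        have hz0 : 0 ≤ z := zero_le_one.trans hz.1.le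
        exact ENNReal.ofReal_le_ofReal (Real.rpow_le_rpow hz0 hz.2 hp.le)
    _ = ENNReal.ofReal (R ^ p) * lam (Ioc 1 R) := setLIntegral_const _ _
    _ < ⊤ := ENNReal.mul_lt_top ENNReal.ofReal_lt_top
        ((measure_mono Ioc_subset_Ioi_self).trans_lt hlam)

/-- A nonincreasing function that loses at most a factor `c ^ p` under dilation by `c ≥ 1` is
continuous. -/
theorem continuousOn_of_antitoneOn_of_le_rpow_mul {f : ℝ → ℝ} {p : ℝ}
    (hanti : AntitoneOn f (Ioi 0)) (hscale : ∀ c, 1 ≤ c → ∀ r, 0 < r → f r ≤ c ^ p * f (c * r)) :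
    ContinuousOn f (Ioi 0) := by
  intro x hx
  have hx0 : 0 < x := hx
  refine ContinuousAt.continuousWithinAt ?_
  -- squeeze `f` between dilated values of `f x`
  set m : ℝ → ℝ := fun y => max 1 (y / x)
  set n : ℝ → ℝ := fun y => max 1 (x / y)
  have hm : Tendsto (fun y => (m y ^ p)⁻¹ * f x) (𝓝 x) (𝓝 (f x)) := by
    have h : ContinuousAt (fun y => (m y ^ p)⁻¹ * f x) x := by
      have : ContinuousAt m x := by fun_prop
      refine ((this.rpow_const (Or.inl ?_)).inv₀ ?_).mul_const _
      · positivity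
      · positivity
    simpa [ContinuousAt, m, div_self hx0.ne'] using h
  have hn : Tendsto (fun y => n y ^ p * f x) (𝓝 x) (𝓝 (f x)) := by
    have h : ContinuousAt (fun y => n y ^ p * f x) x := by
      have : ContinuousAt n x :=
        continuousAt_const.max (continuousAt_const.div continuousAt_id hx0.ne')
      exact (this.rpow_const (Or.inl (by positivity))).mul_const _
    simpa [ContinuousAt, n, div_self hx0.ne'] using h
  refine tendsto_of_tendsto_of_tendsto_of_le_of_le' hm hn ?_ ?_
  · filter_upwards [lt_mem_nhds hx0] with y hy
    have hmp : 0 < m y ^ p := Real.rpow_pos_of_pos (by positivity) _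
    rw [inv_mul_le_iff₀ hmp]
    refine (hscale _ (le_max_left 1 (y / x)) x hx0).trans ?_
    refine mul_le_mul_of_nonneg_left (hanti hy (mul_pos (by positivity) hx0) ?_) hmp.le
    calc y = y / x * x := by field_simp
      _ ≤ _ := by gcongr; exact le_max_right _ _
  · filter_upwards [lt_mem_nhds hx0] with y hy
    have hnp : 0 < n y ^ p := Real.rpow_pos_of_pos (by positivity) _
    refine (hscale _ (le_max_left 1 (x / y)) y hy).trans ?_
    refine mul_le_mul_of_nonneg_left (hanti hx (mul_pos (by positivity) hy) ?_) hnp.le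
    calc x = x / y * y := by field_simp
      _ ≤ _ := by gcongr; exact le_max_right _ _

/-- A nonincreasing, eventually positive function that loses at most a factor `c ^ p` under
dilation by `c ≥ 1` is of extended regular variation. -/
theorem extendedRegularVariation_of_antitoneOn {f : ℝ → ℝ} {p : ℝ} (hp : 0 ≤ p)
    (hanti : AntitoneOn f (Ioi 0)) (hpos : ∀ᶠ r in atTop, 0 < f r)
    (hscale : ∀ c, 1 ≤ c → ∀ᶠ r in atTop, f r ≤ c ^ p * f (c * r)) :
    ExtendedRegularVariation f := by
  refine ⟨p, 0, hp, le_rfl, fun c hc => ?_⟩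
  have hc0 : 0 < c := one_pos.trans_le hc
  have hlow : ∀ᶠ s in atTop, c ^ (-p) ≤ f (c * s) / f s := by
    filter_upwards [hpos, hscale c hc] with s h1 h2
    rw [le_div_iff₀ h1, Real.rpow_neg hc0.le, inv_mul_le_iff₀ (Real.rpow_pos_of_pos hc0 _)]
    exact h2
  have hupp : ∀ᶠ s in atTop, f (c * s) / f s ≤ 1 := by
    filter_upwards [hpos, eventually_gt_atTop 0] with s h1 h2
    rw [div_le_one h1]
    exact hanti h2 (mul_pos hc0 h2) (le_mul_of_one_le_left h2.le hc)
  have hbb : IsBoundedUnder (· ≥ ·) atTop fun s => f (c * s) / f s := ⟨_, hlow⟩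
  have hba : IsBoundedUnder (· ≤ ·) atTop fun s => f (c * s) / f s := ⟨_, hupp⟩
  refine ⟨le_liminf_of_le hba.isCoboundedUnder_ge hlow, liminf_le_limsup hba hbb, ?_⟩
  rw [Real.rpow_zero]
  exact limsup_le_of_le hbb.isCoboundedUnder_le hupp

/-- A nonzero measure on `(0, ∞)` has positive truncated moments at every large level. -/
theorem exists_setLIntegral_Ioc_rpow_pos {lam : Measure ℝ} (hlam0 : lam (Iic 0) = 0)
    (hlam_ne : lam ≠ 0) (p : ℝ) :
    ∃ R, 0 < ∫⁻ z in Ioc (0 : ℝ) R, ENNReal.ofReal (z ^ p) ∂lam := by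
  by_contra! hcon
  refine hlam_ne (Measure.measure_univ_eq_zero.1 ?_)
  have hnull : ∀ n : ℕ, lam (Ioc (0 : ℝ) n) = 0 := fun n => by
    have h := hcon n
    rw [nonpos_iff_eq_zero, setLIntegral_eq_zero_iff measurableSet_Ioc (by fun_prop)] at h
    rw [← compl_compl (Ioc (0 : ℝ) n)]
    refine measure_mono_null ?_ h
    intro z hz hz'
    have hz0 : z ∈ Ioc (0 : ℝ) n := by simpa using hz
    exact (ENNReal.ofReal_pos.2 (Real.rpow_pos_of_pos hz0.1 p)).ne' (hz' hz0)
  refine measure_mono_null (t := Iic 0 ∪ ⋃ n : ℕ, Ioc (0 : ℝ) n) (fun z _ => ?_)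
    (measure_union_null hlam0 (measure_iUnion_null hnull))
  rcases le_or_gt z 0 with h | h
  · exact Or.inl h
  · obtain ⟨n, hn⟩ := exists_nat_ge z
    exact Or.inr (mem_iUnion.2 ⟨n, h, hn⟩)

theorem stmt13 (d : ℕ) (hd : 1 ≤ d) (α : ℝ) (hα : α ∈ Set.Ioo (0:ℝ) 2) (t : ℝ) (ht : 0 < t)
    (lam : MeasureTheory.Measure ℝ) [SigmaFinite lam]
    (hlam0 : lam (Set.Iic 0) = 0) (hlam_ne : lam ≠ 0)
    (hmom : ∫⁻ z in Set.Ioi (0:ℝ), ENNReal.ofReal (min 1 (z ^ 2)) ∂lam ≠ ⊤)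
    (g : ℝ → ℝ) (hg_cont : ContinuousOn g (Set.Ici 0))
    (hg_anti : StrictAntiOn g (Set.Ici 0)) (hg_pos : ∀ x : ℝ, 0 ≤ x → 0 < g x)
    (c₀ : ℝ) (hc₀ : 0 < c₀)
    (hg_tail : Filter.Tendsto (fun r : ℝ => r ^ ((d:ℝ) + α) * g r) Filter.atTop (nhds c₀)) :
    -- (i)
    ((∀ r : ℝ, 0 < r → etaZeroBar d α t g lam r < ⊤) ↔
      ∫⁻ z in Set.Ioc (0:ℝ) 1, ENNReal.ofReal (z ^ (1 + α / (d:ℝ))) ∂lam < ⊤) ∧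
    -- (ii)
    ((∫⁻ z in Set.Ioc (0:ℝ) 1, ENNReal.ofReal (z ^ (1 + α / (d:ℝ))) ∂lam ≠ ⊤) →
      ContinuousOn (fun r => (etaZeroBar d α t g lam r).toReal) (Set.Ioi 0) ∧
      AntitoneOn (fun r => (etaZeroBar d α t g lam r).toReal) (Set.Ioi 0) ∧
      0 < Filter.liminf
          (fun r : ℝ => ENNReal.ofReal (r ^ (1 + α / (d:ℝ))) * etaZeroBar d α t g lam r)
          Filter.atTop ∧
      ExtendedRegularVariation (fun r => (etaZeroBar d α t g lam r).toReal) ∧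
      ∃ C : ℝ, 1 ≤ C ∧ ∀ᶠ r : ℝ in Filter.atTop,
        C⁻¹ * (r ^ (-(1 + α / (d:ℝ))) *
            (∫⁻ z in Set.Ioc (0:ℝ) r, ENNReal.ofReal (z ^ (1 + α / (d:ℝ))) ∂lam).toReal
            + (lam (Set.Ioi r)).toReal)
          ≤ (etaZeroBar d α t g lam r).toReal ∧
        (etaZeroBar d α t g lam r).toReal
          ≤ C * (r ^ (-(1 + α / (d:ℝ))) *
            (∫⁻ z in Set.Ioc (0:ℝ) r, ENNReal.ofReal (z ^ (1 + α / (d:ℝ))) ∂lam).toReal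
            + (lam (Set.Ioi r)).toReal)) := by
  have hα0 : 0 < α := hα.1
  have hd0 : (0 : ℝ) < d := by exact_mod_cast hd
  set p : ℝ := 1 + α / (d : ℝ) with hp_def
  have hp : 0 < p := by positivity
  set e : ℝ := if (d : ℝ) < α then 1 else 0 with he_def
  have he0 : 0 ≤ e := by rw [he_def]; split_ifs <;> norm_num
  have he1 : e ≤ 1 := by rw [he_def]; split_ifs <;> norm_num
  set H := tailIntegral d α t g lam
  have heta : ∀ r, etaZeroBar d α t g lam r = H (max r e) :=
    etaZeroBar_eq_tailIntegral d α t lam hg_cont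
  set I : ℝ → ℝ≥0∞ := fun R => ∫⁻ z in Ioc (0 : ℝ) R, ENNReal.ofReal (z ^ p) ∂lam with hI
  set a := superlevelVol d α t g 1
  obtain ⟨A, hA, hGA⟩ := exists_superlevelVol_le hd hα0 t hg_anti.antitoneOn hg_pos hg_tail
  have ha0 : 0 < a := superlevelVol_one_pos hd hα0 ht hg_anti.antitoneOn (hg_pos 1 zero_le_one)
  have ha : a ≠ ⊤ := by
    refine ((hGA 1 one_pos).trans_lt ?_).ne
    exact ENNReal.mul_lt_top hA.lt_top ENNReal.ofReal_lt_top
  have hlow : ∀ R, 0 < R → a * (ENNReal.ofReal (R ^ (-p)) * I R + lam (Ioi R)) ≤ H R := by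
    intro R hR
    rw [hI, ← lintegral_min_one_div_rpow lam hp hR, ← lintegral_const_mul' _ _ ha]
    exact setLIntegral_mono' measurableSet_Ioi fun z hz =>
      mul_superlevelVol_one_le hd hα0 t g (div_pos hR hz)
  have hupp : ∀ R, 0 < R → H R ≤ A * (ENNReal.ofReal (R ^ (-p)) * I R + lam (Ioi R)) := by
    intro R hR
    rw [hI, ← lintegral_min_one_div_rpow lam hp hR, ← lintegral_const_mul' _ _ hA]
    exact setLIntegral_mono' measurableSet_Ioi fun z hz => hGA _ (div_pos hR hz)
  have hL : ∀ R, 0 < R → lam (Ioi R) < ⊤ := fun R hR =>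
    measure_Ioi_lt_top_of_lintegral_min hmom hR
  have hIfin : I 1 ≠ ⊤ → ∀ R, I R < ⊤ := fun h =>
    setLIntegral_Ioc_rpow_lt_top hp (hL 1 one_pos) h
  have hHfin : I 1 ≠ ⊤ → ∀ R, 0 < R → H R < ⊤ := fun h R hR =>
    (hupp R hR).trans_lt (ENNReal.mul_lt_top hA.lt_top (ENNReal.add_lt_top.2
      ⟨ENNReal.mul_lt_top ENNReal.ofReal_lt_top (hIfin h R), hL R hR⟩))
  refine ⟨⟨fun h => ?_, fun h r hr => ?_⟩, fun h => ?_⟩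
  · have h1 := h 1 one_pos
    rw [heta, max_eq_left he1] at h1
    have h2 := (hlow 1 one_pos).trans_lt h1
    have h3 := ENNReal.lt_top_of_mul_ne_top_right h2.ne ha0.ne'
    have h4 := (ENNReal.add_lt_top.1 h3).1
    simpa using h4
  · rw [heta]
    exact hHfin h.ne _ (lt_max_of_lt_left hr)
  have hHanti : AntitoneOn (fun R => (H R).toReal) (Ioi 0) := fun x hx y _ hxy =>
    ENNReal.toReal_mono (hHfin h x hx).ne (tailIntegral_anti d α t g lam hxy)
  have hHscale : ∀ c, 1 ≤ c → ∀ r, 0 < r → (H r).toReal ≤ c ^ p * (H (c * r)).toReal := by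
    intro c hc r hr
    have hc0 : 0 < c := one_pos.trans_le hc
    have := ENNReal.toReal_mono (ENNReal.mul_ne_top ENNReal.ofReal_ne_top
      (hHfin h (c * r) (mul_pos hc0 hr)).ne) (tailIntegral_le_rpow_mul hd hα0 t g lam hc r)
    rwa [ENNReal.toReal_mul, ENNReal.toReal_ofReal (by positivity)] at this
  have hmaps : MapsTo (fun r => max r e) (Ioi 0) (Ioi 0) := fun r hr =>
    mem_Ioi.2 (lt_max_of_lt_left hr)
  have hanti : AntitoneOn (fun r => (etaZeroBar d α t g lam r).toReal) (Ioi 0) := by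
    simp only [heta]
    exact fun x hx y hy hxy => hHanti (hmaps hx) (hmaps hy) (max_le_max_right e hxy)
  have heta1 : ∀ r, 1 ≤ r → etaZeroBar d α t g lam r = H r := fun r hr => by
    rw [heta, max_eq_left (he1.trans hr)]
  obtain ⟨R₀, hR₀⟩ := exists_setLIntegral_Ioc_rpow_pos hlam0 hlam_ne p
  have hlower : ∀ᶠ r in atTop, a * I R₀ ≤ ENNReal.ofReal (r ^ p) * etaZeroBar d α t g lam r := by
    filter_upwards [eventually_ge_atTop 1, eventually_ge_atTop R₀] with r hr hrR
    have hr0 : 0 < r := one_pos.trans_le hr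
    rw [heta1 r hr]
    calc a * I R₀ ≤ a * I r := by
          gcongr
          exact lintegral_mono_set (Ioc_subset_Ioc_right hrR)
      _ = ENNReal.ofReal (r ^ p) * (a * (ENNReal.ofReal (r ^ (-p)) * I r)) := by
          have : ENNReal.ofReal (r ^ p) * ENNReal.ofReal (r ^ (-p)) = 1 := by
            rw [← ENNReal.ofReal_mul (by positivity), ← Real.rpow_add hr0]
            simp
          calc a * I r = (ENNReal.ofReal (r ^ p) * ENNReal.ofReal (r ^ (-p))) * (a * I r) := by
                rw [this, one_mul]
            _ = _ := by ring
      _ ≤ ENNReal.ofReal (r ^ p) * (a * (ENNReal.ofReal (r ^ (-p)) * I r + lam (Ioi r))) := by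
          gcongr
          exact le_self_add
      _ ≤ _ := by
          gcongr
          exact hlow r hr0
  have haI : 0 < a * I R₀ := ENNReal.mul_pos ha0.ne' hR₀.ne'
  refine ⟨?_, hanti, haI.trans_le (le_liminf_of_le (by isBoundedDefault) hlower), ?_, ?_⟩
  · simp only [heta]
    exact (continuousOn_of_antitoneOn_of_le_rpow_mul hHanti hHscale).comp (by fun_prop) hmaps
  · refine extendedRegularVariation_of_antitoneOn hp.le hanti ?_ fun c hc => ?_
    · filter_upwards [hlower, eventually_gt_atTop 0] with r h1 h2
      refine ENNReal.toReal_pos (fun h0 => ?_) ?_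
      · rw [h0, mul_zero] at h1
        exact haI.not_ge h1
      · rw [heta]
        exact (hHfin h _ (hmaps h2)).ne
    · filter_upwards [eventually_ge_atTop 1] with r hr
      rw [heta1 r hr, heta1 (c * r) (one_le_mul_of_one_le_of_one_le hc hr)]
      exact hHscale c hc r (one_pos.trans_le hr)
  · have haR : 0 < a.toReal := ENNReal.toReal_pos ha0.ne' ha
    refine ⟨max 1 (max a.toReal⁻¹ A.toReal), le_max_left _ _, ?_⟩
    filter_upwards [eventually_ge_atTop 1] with r hr
    have hr0 : 0 < r := one_pos.trans_le hr
    set C := max 1 (max a.toReal⁻¹ A.toReal)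
    have hCa : C⁻¹ ≤ a.toReal :=
      inv_le_of_inv_le₀ haR ((le_max_left _ _).trans (le_max_right _ _))
    have hCA : A.toReal ≤ C := (le_max_right _ _).trans (le_max_right _ _)
    have hT : ENNReal.ofReal (r ^ (-p)) * I r ≠ ⊤ :=
      ENNReal.mul_ne_top ENNReal.ofReal_ne_top (hIfin h r).ne
    have hJ : (ENNReal.ofReal (r ^ (-p)) * I r + lam (Ioi r)).toReal =
        r ^ (-p) * (I r).toReal + (lam (Ioi r)).toReal := by
      rw [ENNReal.toReal_add hT (hL r hr0).ne, ENNReal.toReal_mul,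
        ENNReal.toReal_ofReal (by positivity)]
    have hJ0 : 0 ≤ r ^ (-p) * (I r).toReal + (lam (Ioi r)).toReal := hJ ▸ ENNReal.toReal_nonneg
    have h1 := ENNReal.toReal_mono (hHfin h r hr0).ne (hlow r hr0)
    have h2 := ENNReal.toReal_mono (ENNReal.mul_ne_top hA
      (ENNReal.add_ne_top.2 ⟨hT, (hL r hr0).ne⟩)) (hupp r hr0)
    rw [ENNReal.toReal_mul, hJ] at h1 h2
    rw [heta1 r hr]
    exact ⟨(mul_le_mul_of_nonneg_right hCa hJ0).trans h1,
      h2.trans (mul_le_mul_of_nonneg_right hCA hJ0)⟩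
end

section
/- Assume ∫_{(0,1]} z^{1+α/d} λ(dz) < ∞ and ∫_{(1,∞)} z^{d/(d+α)} λ(dz) < ∞, that the support of λ is contained in [1,∞), and that λ̄(r) ≍ l(r)/r^{d/(d+α)} for r ≥ 1, where l is slowly varying at infinity with ∫_{1}^{∞} l(r)/r dr < ∞. Then η̄₀(r) ≍ λ̄(r) as r → ∞, and η̄₀(r)/η̄(r) → 0 as r → ∞. -/
open MeasureTheory Set Filter Topology
open scoped ENNReal NNReal

/-- A slowly varying comparison bounds `F (k r)` from below by a multiple of `F r`. -/
lemma eventually_le_scale {F l : ℝ → ℝ} {C θ k : ℝ} (hC : 1 ≤ C) (hk : 0 < k)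
    (hl : SlowlyVarying l) (hl_pos : ∀ x : ℝ, 0 < x → 0 < l x)
    (hF : ∀ r : ℝ, 1 ≤ r → C⁻¹ * (l r / r ^ θ) ≤ F r ∧ F r ≤ C * (l r / r ^ θ)) :
    ∀ᶠ r : ℝ in atTop, (2 * C ^ 2)⁻¹ * k ^ (-θ) * F r ≤ F (k * r) := by
  have h1 : ∀ᶠ r : ℝ in atTop, 1 / 2 < l (k * r) / l r :=
    (hl k hk).eventually (lt_mem_nhds (by norm_num))
  have h2 : ∀ᶠ r : ℝ in atTop, 1 ≤ k * r :=
    (tendsto_id.const_mul_atTop hk).eventually_ge_atTop 1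
  filter_upwards [h1, h2, eventually_ge_atTop 1] with r hr1 hr2 hr
  have hr0 : 0 < r := by linarith
  have hlr := hl_pos r hr0
  have hC0 : 0 < C := by linarith
  have hkθ : 0 < k ^ θ := Real.rpow_pos_of_pos hk θ
  have hrθ : 0 < r ^ θ := Real.rpow_pos_of_pos hr0 θ
  rw [lt_div_iff₀ hlr] at hr1
  calc (2 * C ^ 2)⁻¹ * k ^ (-θ) * F r
      ≤ (2 * C ^ 2)⁻¹ * k ^ (-θ) * (C * (l r / r ^ θ)) := by
        have := Real.rpow_pos_of_pos hk (-θ)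
        gcongr
        exact (hF r hr).2
    _ = C⁻¹ * ((1 / 2 * l r) / (k * r) ^ θ) := by
        rw [Real.mul_rpow hk.le hr0.le, Real.rpow_neg hk.le]
        field_simp
    _ ≤ C⁻¹ * (l (k * r) / (k * r) ^ θ) := by gcongr
    _ ≤ F (k * r) := (hF _ hr2).1

/-- If `F` is antitone and comparable to a regularly varying function of index `-θ > -1`, then
`u ↦ u * F u` is almost increasing. -/
lemma exists_mul_le_mul {F l : ℝ → ℝ} {C θ M : ℝ} (hC : 1 ≤ C) (hθ : θ < 1)
    (hl : SlowlyVarying l) (hl_pos : ∀ x : ℝ, 0 < x → 0 < l x)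
    (hanti : Antitone F) (hF0 : ∀ r, 0 ≤ F r) (hM : ∀ r, F r ≤ M)
    (hF : ∀ r : ℝ, 1 ≤ r → C⁻¹ * (l r / r ^ θ) ≤ F r ∧ F r ≤ C * (l r / r ^ θ)) :
    ∃ K : ℝ, 0 ≤ K ∧ ∀ᶠ r : ℝ in atTop, ∀ u, 0 < u → u ≤ r → u * F u ≤ K * (r * F r) := by
  have hC0 : 0 < C := by linarith
  have h1 : ∀ᶠ r : ℝ in atTop, (2 : ℝ) ^ (θ - 1) < l (2 * r) / l r :=
    (hl 2 two_pos).eventually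
      (lt_mem_nhds (Real.rpow_lt_one_of_one_lt_of_neg one_lt_two (by linarith)))
  obtain ⟨R₀, hR₀⟩ := eventually_atTop.1 h1
  set R := max R₀ 1 with hR
  have hR1 : 1 ≤ R := le_max_right _ _
  set G : ℝ → ℝ := fun r => r * (l r / r ^ θ) with hG
  have hG2 : ∀ r, R ≤ r → G r ≤ G (2 * r) := by
    intro r hr
    have hr0 : 0 < r := by linarith
    have h := hR₀ r ((le_max_left _ _).trans hr)
    rw [lt_div_iff₀ (hl_pos r hr0)] at h
    have hrθ : 0 < r ^ θ := Real.rpow_pos_of_pos hr0 θ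
    have h2θ : (0 : ℝ) < 2 ^ θ := Real.rpow_pos_of_pos two_pos θ
    have e : (2 : ℝ) ^ (θ - 1) = 2 ^ θ / 2 := by
      rw [Real.rpow_sub two_pos, Real.rpow_one]
    rw [e] at h
    simp only [hG]
    rw [Real.mul_rpow two_pos.le hr0.le]
    calc r * (l r / r ^ θ) = 2 * r * ((2 ^ θ / 2 * l r) / (2 ^ θ * r ^ θ)) := by field_simp
      _ ≤ _ := by gcongr
  have hGpow : ∀ (n : ℕ) (r : ℝ), R ≤ r → G r ≤ G (2 ^ n * r) := by
    intro n
    induction n with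
    | zero => intro r _; simp
    | succ n ih =>
      intro r hr
      have h3 : R ≤ 2 ^ n * r := by
        have : (1 : ℝ) ≤ 2 ^ n := one_le_pow₀ one_le_two
        nlinarith
      calc G r ≤ G (2 ^ n * r) := ih r hr
        _ ≤ G (2 * (2 ^ n * r)) := hG2 _ h3
        _ = G (2 ^ (n + 1) * r) := by ring_nf
  have hlow : ∀ r, 1 ≤ r → C⁻¹ * G r ≤ r * F r := by
    intro r hr
    have := (hF r hr).1
    calc C⁻¹ * G r = r * (C⁻¹ * (l r / r ^ θ)) := by simp only [hG]; ring
      _ ≤ _ := by gcongr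
  have hupp : ∀ r, 1 ≤ r → r * F r ≤ C * G r := by
    intro r hr
    have := (hF r hr).2
    calc r * F r ≤ r * (C * (l r / r ^ θ)) := by gcongr
      _ = _ := by simp only [hG]; ring
  have key : ∀ u r, R ≤ u → u ≤ r → u * F u ≤ 2 * C ^ 2 * (r * F r) := by
    intro u r hu hur
    have hu0 : 0 < u := by linarith
    obtain ⟨n, hn1, hn2⟩ := exists_nat_pow_near ((one_le_div hu0).2 hur) one_lt_two
    rw [le_div_iff₀ hu0] at hn1
    rw [div_lt_iff₀ hu0] at hn2
    have hn3 : 1 ≤ (2 : ℝ) ^ (n + 1) * u := by linarith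
    have h4 : F (2 ^ (n + 1) * u) ≤ F r := hanti hn2.le
    have h5 : (2 : ℝ) ^ (n + 1) * u ≤ 2 * r := by rw [pow_succ]; linarith
    have h6 : C⁻¹ * G u ≤ 2 * (r * F r) := calc
      C⁻¹ * G u ≤ C⁻¹ * G (2 ^ (n + 1) * u) := by gcongr; exact hGpow _ _ hu
      _ ≤ 2 ^ (n + 1) * u * F (2 ^ (n + 1) * u) := hlow _ hn3
      _ ≤ 2 * r * F r := mul_le_mul h5 h4 (hF0 _) (by linarith)
      _ = _ := by ring
    calc u * F u ≤ C * G u := hupp u (by linarith)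
      _ = C ^ 2 * (C⁻¹ * G u) := by field_simp
      _ ≤ C ^ 2 * (2 * (r * F r)) := by gcongr
      _ = _ := by ring
  have hRF : 0 < R * F R := by
    have hR0 : 0 < R := by linarith
    refine lt_of_lt_of_le ?_ (hlow R hR1)
    have := hl_pos R hR0
    have := Real.rpow_pos_of_pos hR0 θ
    simp only [hG]; positivity
  have hM0 : 0 ≤ M := (hF0 0).trans (hM 0)
  refine ⟨2 * C ^ 2 + R * M / (R * F R) * (2 * C ^ 2), by positivity, ?_⟩
  filter_upwards [eventually_ge_atTop R] with r hr u hu hur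
  have hr0 : 0 ≤ r * F r := mul_nonneg (by linarith) (hF0 r)
  rw [add_mul]
  rcases le_total R u with h | h
  · have := key u r h hur
    have : 0 ≤ R * M / (R * F R) * (2 * C ^ 2) * (r * F r) := by positivity
    linarith
  · have h7 := key R r le_rfl hr
    have h8 : u * F u ≤ R * M / (R * F R) * (R * F R) := by
      rw [div_mul_cancel₀ _ hRF.ne']
      exact mul_le_mul h (hM u) (hF0 u) (by linarith)
    have h9 : R * M / (R * F R) * (R * F R) ≤ R * M / (R * F R) * (2 * C ^ 2 * (r * F r)) := by
      gcongr
    have : 0 ≤ 2 * C ^ 2 * (r * F r) := by positivity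
    linarith

lemma exists_div_le {F l : ℝ → ℝ} {C θ M : ℝ} (hC : 1 ≤ C) (hθ : θ < 1)
    (hl : SlowlyVarying l) (hl_pos : ∀ x : ℝ, 0 < x → 0 < l x)
    (hanti : Antitone F) (hF0 : ∀ r, 0 ≤ F r) (hM : ∀ r, F r ≤ M)
    (hF : ∀ r : ℝ, 1 ≤ r → C⁻¹ * (l r / r ^ θ) ≤ F r ∧ F r ≤ C * (l r / r ^ θ)) :
    ∃ K : ℝ, 0 ≤ K ∧ ∀ᶠ r : ℝ in atTop, ∀ p, 0 < p → F (r / p) ≤ K * F r * (1 + p) := by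
  obtain ⟨K, hK, h⟩ := exists_mul_le_mul hC hθ hl hl_pos hanti hF0 hM hF
  refine ⟨1 + K, by positivity, ?_⟩
  filter_upwards [h, eventually_gt_atTop 0] with r hr hr0 p hp
  have hFr := hF0 r
  rcases le_total p 1 with h1 | h1
  · have h2 : F (r / p) ≤ F r := hanti (by rw [le_div_iff₀ hp]; nlinarith)
    have : 0 ≤ K * F r + (1 + K) * F r * p := by positivity
    nlinarith
  · have h2 := hr (r / p) (by positivity) (div_le_self hr0.le h1)
    have h3 : F (r / p) ≤ K * F r * p := by
      have h4 : r / p * F (r / p) ≤ r / p * (K * F r * p) := by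
        refine h2.trans_eq ?_
        field_simp
      exact le_of_mul_le_mul_left h4 (by positivity)
    have : 0 ≤ F r * p + (1 + K) * F r := by positivity
    nlinarith

/-- A positive antitone profile with tail `c₀ x ^ (-κ)` is comparable to `(1 + x) ^ (-κ)`. -/
lemma exists_profile_bounds {g : ℝ → ℝ} {κ c₀ : ℝ} (hκ : 0 < κ) (hc₀ : 0 < c₀)
    (hg_anti : StrictAntiOn g (Ici 0)) (hg_pos : ∀ x : ℝ, 0 ≤ x → 0 < g x)
    (hg_tail : Tendsto (fun r : ℝ => r ^ κ * g r) atTop (nhds c₀)) :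
    ∃ a A : ℝ, 0 < a ∧ 0 < A ∧
      ∀ x, 0 ≤ x → a * (1 + x) ^ (-κ) ≤ g x ∧ g x ≤ A * (1 + x) ^ (-κ) := by
  have h1 : ∀ᶠ r : ℝ in atTop, c₀ / 2 < r ^ κ * g r :=
    hg_tail.eventually (lt_mem_nhds (by linarith))
  have h2 : ∀ᶠ r : ℝ in atTop, r ^ κ * g r < 2 * c₀ :=
    hg_tail.eventually (gt_mem_nhds (by linarith))
  obtain ⟨R, hR⟩ := eventually_atTop.1 ((h1.and h2).and (eventually_ge_atTop 1))
  have hR1 : 1 ≤ R := (hR R le_rfl).2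
  have hR0 : (0 : ℝ) ≤ R := by linarith
  have hgR := hg_pos R hR0
  have hg0 := hg_pos 0 le_rfl
  refine ⟨min (c₀ / 2) (g R), max (2 ^ κ * (2 * c₀)) ((1 + R) ^ κ * g 0), by positivity,
    by positivity, fun x hx => ?_⟩
  have hgx := hg_pos x hx
  have hx1 : 0 < 1 + x := by linarith
  have hpow : 0 < (1 + x) ^ κ := Real.rpow_pos_of_pos hx1 κ
  rw [Real.rpow_neg hx1.le, ← div_eq_mul_inv, ← div_eq_mul_inv, div_le_iff₀ hpow,
    le_div_iff₀ hpow]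
  rcases le_total R x with h | h
  · obtain ⟨⟨h3, h4⟩, h5⟩ := hR x h
    constructor
    · refine (min_le_left _ _).trans (h3.le.trans ?_)
      rw [mul_comm]
      gcongr
      linarith
    · refine le_trans ?_ (le_max_left _ _)
      calc g x * (1 + x) ^ κ ≤ g x * (2 * x) ^ κ := by gcongr; linarith
        _ = 2 ^ κ * (x ^ κ * g x) := by rw [Real.mul_rpow two_pos.le hx]; ring
        _ ≤ _ := by gcongr
  · constructor
    · refine (min_le_right _ _).trans ?_
      have h6 : g R ≤ g x := hg_anti.antitoneOn hx hR0 h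
      have h7 : 1 ≤ (1 + x) ^ κ := Real.one_le_rpow (by linarith) hκ.le
      nlinarith
    · refine le_trans ?_ (le_max_right _ _)
      have h6 : g x ≤ g 0 := hg_anti.antitoneOn (mem_Ici.2 le_rfl) hx hx
      rw [mul_comm]
      gcongr

lemma le_pker {d : ℕ} {α t a κ ρ : ℝ} {g : ℝ → ℝ} (hα : 0 < α) (ht : 0 < t) (ha : 0 < a)
    (hκ : 0 < κ) (hg : ∀ x, 0 ≤ x → a * (1 + x) ^ (-κ) ≤ g x)
    {s : ℝ} (hs : s ∈ Ioc (t / 2) t) {y : EuclideanSpace ℝ (Fin d)} (hy : ‖y‖ ≤ ρ) :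
    t ^ (-((d : ℝ) / α)) * (a * (1 + ρ / (t / 2) ^ (1 / α)) ^ (-κ)) ≤ pker d α g s y := by
  have hs0 : 0 < s := by linarith [hs.1]
  have hρ : 0 ≤ ρ := (norm_nonneg y).trans hy
  have h1 : 0 < (t / 2) ^ (1 / α) := by positivity
  have h2 : 0 < s ^ (1 / α) := by positivity
  unfold pker
  have h3 : (t / 2) ^ (1 / α) ≤ s ^ (1 / α) := Real.rpow_le_rpow (by linarith) hs.1.le (by positivity)
  have h4 : t ^ (-((d : ℝ) / α)) ≤ s ^ (-((d : ℝ) / α)) :=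
    Real.rpow_le_rpow_of_nonpos hs0 hs.2 (by rw [neg_nonpos]; positivity)
  have h5 : (1 + ρ / (t / 2) ^ (1 / α)) ^ (-κ) ≤ (1 + ‖y‖ / s ^ (1 / α)) ^ (-κ) := by
    apply Real.rpow_le_rpow_of_nonpos (by positivity) _ (by linarith)
    gcongr
  have h6 := hg (‖y‖ / s ^ (1 / α)) (by positivity)
  have h7 : a * (1 + ρ / (t / 2) ^ (1 / α)) ^ (-κ) ≤ g (‖y‖ / s ^ (1 / α)) :=
    le_trans (by gcongr) h6
  exact mul_le_mul h4 h7 (by positivity) (by positivity)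

lemma restrict_Ioc_prod_prod {E : Type*} [MeasurableSpace E] (μ : Measure E) [SFinite μ]
    {t a : ℝ} (ht : 0 < t) (lam : Measure ℝ) [SFinite lam] (ha : 0 ≤ a) (A : Set E) :
    ((volume.restrict (Ioc (0 : ℝ) t)).prod (μ.prod (lam.restrict (Ioi (0 : ℝ)))))
      (Ioc (t / 2) t ×ˢ A ×ˢ Ioi a) = ENNReal.ofReal (t / 2) * (μ A * lam (Ioi a)) := by
  rw [Measure.prod_prod, Measure.prod_prod, Measure.restrict_apply measurableSet_Ioc,
    Measure.restrict_apply measurableSet_Ioi, inter_eq_left.2 (Ioi_subset_Ioi ha),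
    inter_eq_left.2 (Ioc_subset_Ioc_left (by linarith)), Real.volume_Ioc]
  congr 2
  ring

lemma lintegral_scaled_profile {d : ℕ} {α A κ s : ℝ} (hκ : (d : ℝ) < κ) (hA : 0 < A)
    (hs : 0 < s) :
    ∫⁻ y : EuclideanSpace ℝ (Fin d),
        ENNReal.ofReal (s ^ (-((d : ℝ) / α)) * (A * (1 + ‖y‖ / s ^ (1 / α)) ^ (-κ))) =
      ENNReal.ofReal (A * ∫ y : EuclideanSpace ℝ (Fin d), (1 + ‖y‖) ^ (-κ)) := by
  have hu : 0 < s ^ (1 / α) := by positivity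
  set u := s ^ (1 / α) with hu_def
  have hsu : s ^ (-((d : ℝ) / α)) = (u ^ d)⁻¹ := by
    rw [hu_def, ← Real.rpow_natCast, ← Real.rpow_mul hs.le, ← Real.rpow_neg hs.le]
    congr 1
    ring
  have hnorm : ∀ y : EuclideanSpace ℝ (Fin d), ‖u⁻¹ • y‖ = ‖y‖ / u := fun y => by
    rw [norm_smul, norm_inv, Real.norm_of_nonneg hu.le, div_eq_inv_mul]
  have hint : Integrable (fun y : EuclideanSpace ℝ (Fin d) => (1 + ‖y‖) ^ (-κ)) :=
    integrable_one_add_norm (by simpa using hκ)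
  have hint2 : Integrable (fun y : EuclideanSpace ℝ (Fin d) => (1 + ‖y‖ / u) ^ (-κ)) := by
    have := hint.comp_smul (inv_ne_zero hu.ne')
    simpa only [hnorm] using this
  have hval : ∫ y : EuclideanSpace ℝ (Fin d), (1 + ‖y‖ / u) ^ (-κ) =
      u ^ d * ∫ y : EuclideanSpace ℝ (Fin d), (1 + ‖y‖) ^ (-κ) := by
    have := Measure.integral_comp_inv_smul_of_nonneg
      (volume : Measure (EuclideanSpace ℝ (Fin d))) (fun y => (1 + ‖y‖) ^ (-κ)) hu.le
    simpa only [hnorm, finrank_euclideanSpace_fin, smul_eq_mul] using this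
  rw [← ofReal_integral_eq_lintegral_ofReal ((hint2.const_mul A).const_mul _)
    (Eventually.of_forall fun y => by positivity), integral_const_mul, integral_const_mul, hval,
    hsu]
  congr 1
  field_simp

/-- Integrating a tail bound that is linear in the kernel bounds `etaZeroBar`. -/
lemma exists_etaZeroBar_le {d : ℕ} {α t A κ : ℝ} {g : ℝ → ℝ}
    (hκ : (d : ℝ) < κ) (hA : 0 < A) (hg : ∀ x, 0 ≤ x → g x ≤ A * (1 + x) ^ (-κ))
    (lam : Measure ℝ) [IsFiniteMeasure lam] :
    ∃ W : ℝ, 0 ≤ W ∧ ∀ r B : ℝ, 0 < r → 0 ≤ B →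
      (∀ p, 0 < p → (lam (Ioi (r / p))).toReal ≤ B * (1 + p)) →
      etaZeroBar d α t g lam r ≤ ENNReal.ofReal (W * B) := by
  set q : ℝ → EuclideanSpace ℝ (Fin d) → ℝ := fun s y =>
    s ^ (-((d : ℝ) / α)) * (A * (1 + ‖y‖ / s ^ (1 / α)) ^ (-κ)) with hq
  set I : ℝ := A * ∫ y : EuclideanSpace ℝ (Fin d), (1 + ‖y‖) ^ (-κ) with hI
  set V : ℝ≥0∞ := volume (Metric.closedBall (0 : EuclideanSpace ℝ (Fin d)) (1 / 2)) with hV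
  have hVtop : V ≠ ⊤ := measure_closedBall_lt_top.ne
  have hWtop : (V + ENNReal.ofReal I) * ENNReal.ofReal t ≠ ⊤ :=
    ENNReal.mul_ne_top (ENNReal.add_ne_top.2 ⟨hVtop, ENNReal.ofReal_ne_top⟩) ENNReal.ofReal_ne_top
  refine ⟨((V + ENNReal.ofReal I) * ENNReal.ofReal t).toReal, ENNReal.toReal_nonneg,
    fun r B hr hB h => ?_⟩
  rw [ENNReal.ofReal_mul ENNReal.toReal_nonneg, ENNReal.ofReal_toReal hWtop]
  have hqm : Measurable (fun x : ℝ × EuclideanSpace ℝ (Fin d) × ℝ => q x.1 x.2.1) := by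
    simp only [hq]
    fun_prop
  have hqpos : ∀ s y, 0 < s → 0 < q s y := fun s y hs => by simp only [hq]; positivity
  set T : Set (ℝ × EuclideanSpace ℝ (Fin d) × ℝ) :=
    {x | ‖x.2.1‖ ≤ 1 / 2 ∧ r < q x.1 x.2.1 * x.2.2} with hT
  have hTm : MeasurableSet T := by
    refine MeasurableSet.inter ?_ ?_
    · exact measurableSet_le measurable_snd.fst.norm measurable_const
    · exact measurableSet_lt measurable_const (hqm.mul measurable_snd.snd)
  have hle : etaZeroBar d α t g lam r ≤
      ((volume.restrict (Ioc (0:ℝ) t)).prod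
        ((volume : Measure (EuclideanSpace ℝ (Fin d))).prod (lam.restrict (Ioi (0:ℝ))))) T := by
    unfold etaZeroBar
    apply measure_mono_ae
    have h1 := Measure.quasiMeasurePreserving_fst (μ := volume.restrict (Ioc (0:ℝ) t))
      (ν := (volume : Measure (EuclideanSpace ℝ (Fin d))).prod (lam.restrict (Ioi (0:ℝ))))
      |>.ae (ae_restrict_mem measurableSet_Ioc)
    have h2 := (Measure.quasiMeasurePreserving_snd
        (μ := (volume : Measure (EuclideanSpace ℝ (Fin d)))) (ν := lam.restrict (Ioi (0:ℝ)))).comp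
      (Measure.quasiMeasurePreserving_snd (μ := volume.restrict (Ioc (0:ℝ) t))
        (ν := (volume : Measure (EuclideanSpace ℝ (Fin d))).prod (lam.restrict (Ioi (0:ℝ)))))
      |>.ae (ae_restrict_mem measurableSet_Ioi)
    filter_upwards [h1, h2] with x hx1 hx2 hx
    obtain ⟨hy, hz⟩ := hx
    refine ⟨hy, ((le_max_left _ _).trans_lt hz).trans_le ?_⟩
    have hs : 0 < x.1 := hx1.1
    have hz0 : 0 < x.2.2 := hx2
    unfold pker
    have := hg (‖x.2.1‖ / x.1 ^ (1 / α)) (by positivity)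
    simp only [hq]
    gcongr
  refine hle.trans ?_
  rw [Measure.prod_apply hTm]
  have hinner : ∀ s, 0 < s →
      ((volume : Measure (EuclideanSpace ℝ (Fin d))).prod (lam.restrict (Ioi (0:ℝ))))
        (Prod.mk s ⁻¹' T) ≤ ENNReal.ofReal B * (V + ENNReal.ofReal I) := by
    intro s hs
    rw [Measure.prod_apply (measurable_prodMk_left hTm)]
    have hpt : ∀ y : EuclideanSpace ℝ (Fin d),
        (lam.restrict (Ioi (0:ℝ))) (Prod.mk y ⁻¹' (Prod.mk s ⁻¹' T)) ≤
          ENNReal.ofReal B * ((Metric.closedBall (0 : EuclideanSpace ℝ (Fin d)) (1 / 2)).indicator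
            (fun _ => 1) y + ENNReal.ofReal (q s y)) := by
      intro y
      by_cases hy : ‖y‖ ≤ 1 / 2
      · rw [indicator_of_mem (by simpa using hy)]
        have hsub : Prod.mk y ⁻¹' (Prod.mk s ⁻¹' T) ⊆ Ioi (r / q s y) := by
          intro z hz
          have : r < q s y * z := hz.2
          rw [mem_Ioi, div_lt_iff₀ (hqpos s y hs)]
          linarith
        calc (lam.restrict (Ioi (0:ℝ))) (Prod.mk y ⁻¹' (Prod.mk s ⁻¹' T))
            ≤ lam (Ioi (r / q s y)) := (measure_mono hsub).trans (Measure.restrict_apply_le _ _)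
          _ = ENNReal.ofReal (lam (Ioi (r / q s y))).toReal :=
            (ENNReal.ofReal_toReal (measure_ne_top _ _)).symm
          _ ≤ ENNReal.ofReal (B * (1 + q s y)) :=
            ENNReal.ofReal_le_ofReal (h _ (hqpos s y hs))
          _ = _ := by
            rw [ENNReal.ofReal_mul hB, ENNReal.ofReal_add zero_le_one (hqpos s y hs).le,
              ENNReal.ofReal_one]
      · have : Prod.mk y ⁻¹' (Prod.mk s ⁻¹' T) = ∅ :=
          eq_empty_of_forall_notMem fun z hz => hy hz.1
        rw [this, measure_empty]
        exact zero_le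
    refine (lintegral_mono hpt).trans ?_
    rw [lintegral_const_mul' _ _ ENNReal.ofReal_ne_top, lintegral_add_left
      (measurable_const.indicator Metric.isClosed_closedBall.measurableSet),
      lintegral_indicator_const Metric.isClosed_closedBall.measurableSet, one_mul]
    simp only [hq]
    rw [lintegral_scaled_profile hκ hA hs]
  calc _ ≤ ∫⁻ s in Ioc (0:ℝ) t, ENNReal.ofReal B * (V + ENNReal.ofReal I) :=
        setLIntegral_mono' measurableSet_Ioc fun s hs => hinner s hs.1
    _ = _ := by
      rw [setLIntegral_const, Real.volume_Ioc, sub_zero]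
      ring

lemma ofReal_le_volume_annulus {d : ℕ} (hd : 1 ≤ d) (j : ℕ) :
    ENNReal.ofReal (((2 : ℝ) ^ j) ^ d) *
        volume (Metric.ball (0 : EuclideanSpace ℝ (Fin d)) 1) ≤
      volume (Metric.closedBall (0 : EuclideanSpace ℝ (Fin d)) (2 ^ (j + 1)) \
        Metric.closedBall 0 (2 ^ j)) := by
  refine le_trans ?_ le_measure_sdiff
  refine ENNReal.le_sub_of_add_le_right measure_closedBall_lt_top.ne ?_
  rw [Measure.addHaar_closedBall _ _ (by positivity), Measure.addHaar_closedBall _ _ (by positivity),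
    finrank_euclideanSpace_fin, ← add_mul, ← ENNReal.ofReal_add (by positivity) (by positivity)]
  gcongr
  have h1 : (2 : ℝ) ≤ 2 ^ d := by
    simpa using pow_le_pow_right₀ (one_le_two : (1 : ℝ) ≤ 2) hd
  have h2 : (0 : ℝ) < (2 ^ j) ^ d := by positivity
  rw [pow_succ, mul_pow]
  nlinarith

lemma exists_le_etaZeroBar {d : ℕ} {α t a κ θ C : ℝ} {g l : ℝ → ℝ} (hα : 0 < α) (ht : 0 < t)
    (ha : 0 < a) (hκ : 0 < κ) (hg : ∀ x, 0 ≤ x → a * (1 + x) ^ (-κ) ≤ g x)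
    (lam : Measure ℝ) [IsFiniteMeasure lam] (hC : 1 ≤ C)
    (hl : SlowlyVarying l) (hl_pos : ∀ x : ℝ, 0 < x → 0 < l x)
    (hF : ∀ r : ℝ, 1 ≤ r → C⁻¹ * (l r / r ^ θ) ≤ (lam (Ioi r)).toReal ∧
      (lam (Ioi r)).toReal ≤ C * (l r / r ^ θ)) :
    ∃ c : ℝ, 0 < c ∧ ∀ᶠ r : ℝ in atTop,
      ENNReal.ofReal (c * (lam (Ioi r)).toReal) ≤ etaZeroBar d α t g lam r := by
  set m : ℝ := t ^ (-((d : ℝ) / α)) * (a * (1 + (1 / 2) / (t / 2) ^ (1 / α)) ^ (-κ)) with hm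
  have hm0 : 0 < m := by positivity
  set B := Metric.closedBall (0 : EuclideanSpace ℝ (Fin d)) (1 / 2) with hB
  have hBtop : volume B ≠ ⊤ := measure_closedBall_lt_top.ne
  have hBpos : 0 < (volume B).toReal :=
    ENNReal.toReal_pos (Metric.measure_closedBall_pos _ _ (by norm_num)).ne' hBtop
  have h := eventually_le_scale (F := fun r => (lam (Ioi r)).toReal) hC (inv_pos.2 hm0) hl hl_pos hF
  refine ⟨t / 2 * ((volume B).toReal * ((2 * C ^ 2)⁻¹ * m⁻¹ ^ (-θ))), by positivity, ?_⟩
  filter_upwards [h, eventually_ge_atTop 1] with r hr hr1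
  have hr0 : 0 < r := by linarith
  have hsub : Ioc (t / 2) t ×ˢ B ×ˢ Ioi (m⁻¹ * r) ⊆
      {q : ℝ × EuclideanSpace ℝ (Fin d) × ℝ | ‖q.2.1‖ ≤ 1 / 2 ∧
        max r (if (d:ℝ) < α then 1 else 0) < pker d α g q.1 q.2.1 * q.2.2} := by
    rintro ⟨s, y, z⟩ ⟨hs, hy, hz⟩
    have hy' : ‖y‖ ≤ 1 / 2 := by simpa [hB] using hy
    have hz' : m⁻¹ * r < z := hz
    refine ⟨hy', ?_⟩
    rw [max_eq_left (by split_ifs <;> linarith)]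
    have hz0 : 0 < z := lt_trans (by positivity) hz'
    rw [inv_mul_lt_iff₀ hm0] at hz'
    exact hz'.trans_le (mul_le_mul_of_nonneg_right (le_pker hα ht ha hκ hg hs hy') hz0.le)
  calc ENNReal.ofReal (t / 2 * ((volume B).toReal * ((2 * C ^ 2)⁻¹ * m⁻¹ ^ (-θ))) *
        (lam (Ioi r)).toReal)
      ≤ ENNReal.ofReal (t / 2 * ((volume B).toReal * (lam (Ioi (m⁻¹ * r))).toReal)) := by
        apply ENNReal.ofReal_le_ofReal
        rw [mul_assoc, mul_assoc]
        gcongr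
    _ = ENNReal.ofReal (t / 2) * (volume B * lam (Ioi (m⁻¹ * r))) := by
        rw [ENNReal.ofReal_mul (by positivity), ENNReal.ofReal_mul ENNReal.toReal_nonneg,
          ENNReal.ofReal_toReal hBtop, ENNReal.ofReal_toReal (measure_ne_top _ _)]
    _ = _ := (restrict_Ioc_prod_prod _ ht lam (by positivity) B).symm
    _ ≤ etaZeroBar d α t g lam r := measure_mono hsub

/-- Each dyadic annulus contributes a fixed multiple of the tail of `lam` to `etaBar`. -/
lemma exists_le_etaBar {d : ℕ} {α t a κ θ C : ℝ} {g l : ℝ → ℝ} (hd : 1 ≤ d) (hα : 0 < α)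
    (ht : 0 < t) (ha : 0 < a) (hκ : 0 < κ) (hκθ : κ * θ = d)
    (hg : ∀ x, 0 ≤ x → a * (1 + x) ^ (-κ) ≤ g x)
    (lam : Measure ℝ) [IsFiniteMeasure lam] (hC : 1 ≤ C)
    (hl : SlowlyVarying l) (hl_pos : ∀ x : ℝ, 0 < x → 0 < l x)
    (hF : ∀ r : ℝ, 1 ≤ r → C⁻¹ * (l r / r ^ θ) ≤ (lam (Ioi r)).toReal ∧
      (lam (Ioi r)).toReal ≤ C * (l r / r ^ θ)) :
    ∃ c : ℝ, 0 < c ∧ ∀ N : ℕ, ∀ᶠ r : ℝ in atTop,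
      ENNReal.ofReal (N * (c * (lam (Ioi r)).toReal)) ≤ etaBar d α t g lam r := by
  set b : ℝ := (t / 2) ^ (1 / α) with hb
  have hb0 : 0 < b := by positivity
  set c₂ : ℝ := t ^ (-((d : ℝ) / α)) * (a * (1 + 2 / b) ^ (-κ)) with hc₂
  have hc₂0 : 0 < c₂ := by positivity
  set v := volume (Metric.ball (0 : EuclideanSpace ℝ (Fin d)) 1) with hv
  have hvtop : v ≠ ⊤ := measure_ball_lt_top.ne
  have hvpos : 0 < v.toReal :=
    ENNReal.toReal_pos (Metric.measure_ball_pos _ _ one_pos).ne' hvtop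
  set k : ℕ → ℝ := fun j => ((2 : ℝ) ^ j) ^ κ / c₂ with hk
  have hk0 : ∀ j, 0 < k j := fun j => by simp only [hk]; positivity
  set A : ℕ → Set (EuclideanSpace ℝ (Fin d)) := fun j =>
    Metric.closedBall 0 (2 ^ (j + 1)) \ Metric.closedBall 0 (2 ^ j) with hA
  have hAm : ∀ j, MeasurableSet (A j) := fun j =>
    Metric.isClosed_closedBall.measurableSet.diff Metric.isClosed_closedBall.measurableSet
  have hAd : Pairwise (Function.onFun Disjoint A) := by
    refine (pairwise_disjoint_on A).2 fun i j hij => disjoint_left.2 fun y hi hj => hj.2 ?_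
    exact Metric.closedBall_subset_closedBall (pow_le_pow_right₀ one_le_two hij) hi.1
  have hkθ : ∀ j, k j ^ (-θ) * ((2 : ℝ) ^ j) ^ d = c₂ ^ θ := by
    intro j
    have h2 : (0 : ℝ) < 2 ^ j := by positivity
    simp only [hk]
    rw [Real.rpow_neg (by positivity), Real.div_rpow (by positivity) hc₂0.le,
      ← Real.rpow_mul h2.le, hκθ, Real.rpow_natCast, inv_div,
      div_mul_cancel₀ _ (by positivity)]
  refine ⟨t / 2 * (v.toReal * ((2 * C ^ 2)⁻¹ * c₂ ^ θ)), by positivity, fun N => ?_⟩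
  have h : ∀ᶠ r : ℝ in atTop, ∀ j ∈ Finset.range N,
      (2 * C ^ 2)⁻¹ * k j ^ (-θ) * (lam (Ioi r)).toReal ≤ (lam (Ioi (k j * r))).toReal :=
    (Filter.eventually_all_finset _).2 fun j _ =>
      eventually_le_scale (F := fun r => (lam (Ioi r)).toReal) hC (hk0 j) hl hl_pos hF
  filter_upwards [h, eventually_gt_atTop 0] with r hr hr0
  set f : ℕ → Set (ℝ × EuclideanSpace ℝ (Fin d) × ℝ) := fun j =>
    Ioc (t / 2) t ×ˢ A j ×ˢ Ioi (k j * r) with hf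
  have hsub : (⋃ j ∈ Finset.range N, f j) ⊆
      {q : ℝ × EuclideanSpace ℝ (Fin d) × ℝ | r < pker d α g q.1 q.2.1 * q.2.2} := by
    refine iUnion₂_subset fun j _ => ?_
    rintro ⟨s, y, z⟩ ⟨hs, hy, hz⟩
    have hy' : ‖y‖ ≤ 2 ^ (j + 1) := by simpa using hy.1
    have hz' : k j * r < z := hz
    have hp := le_pker (d := d) hα ht ha hκ hg hs hy'
    rw [← hb] at hp
    have h2 : (1 : ℝ) ≤ 2 ^ j := one_le_pow₀ one_le_two
    have hz0 : 0 < z := lt_trans (mul_pos (hk0 j) hr0) hz'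
    have hm : (k j)⁻¹ ≤ pker d α g s y := by
      refine le_trans ?_ hp
      have h3 : (2 ^ j * (1 + 2 / b)) ^ (-κ) ≤ (1 + 2 ^ (j + 1) / b) ^ (-κ) := by
        apply Real.rpow_le_rpow_of_nonpos (by positivity) _ (by linarith)
        rw [pow_succ, mul_add, mul_div_assoc]
        linarith
      calc (k j)⁻¹ = t ^ (-((d : ℝ) / α)) * (a * (2 ^ j * (1 + 2 / b)) ^ (-κ)) := by
            simp only [hk]
            rw [Real.mul_rpow (by positivity) (by positivity), inv_div, hc₂,
              Real.rpow_neg (x := 2 ^ j) (by positivity)]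
            ring
        _ ≤ _ := by gcongr
    have h4 : r < (k j)⁻¹ * z := by
      rw [inv_mul_eq_div, lt_div_iff₀ (hk0 j)]
      linarith
    exact h4.trans_le (mul_le_mul_of_nonneg_right hm hz0.le)
  refine le_trans ?_ (measure_mono hsub)
  rw [measure_biUnion_finset]
  · have hterm : ∀ j ∈ Finset.range N,
        ENNReal.ofReal (t / 2 * (v.toReal * ((2 * C ^ 2)⁻¹ * c₂ ^ θ)) * (lam (Ioi r)).toReal) ≤
        ((volume.restrict (Ioc (0:ℝ) t)).prod
          ((volume : Measure (EuclideanSpace ℝ (Fin d))).prod (lam.restrict (Ioi (0:ℝ)))))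
          (f j) := by
      intro j hj
      simp only [hf]
      rw [restrict_Ioc_prod_prod _ ht lam (mul_pos (hk0 j) hr0).le (A j)]
      calc ENNReal.ofReal (t / 2 * (v.toReal * ((2 * C ^ 2)⁻¹ * c₂ ^ θ)) * (lam (Ioi r)).toReal)
          = ENNReal.ofReal (t / 2 * ((((2 : ℝ) ^ j) ^ d * v.toReal) *
              ((2 * C ^ 2)⁻¹ * k j ^ (-θ) * (lam (Ioi r)).toReal))) := by
            rw [← hkθ j]
            congr 1
            ring
        _ ≤ ENNReal.ofReal (t / 2 * ((((2 : ℝ) ^ j) ^ d * v.toReal) *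
              (lam (Ioi (k j * r))).toReal)) := by
            apply ENNReal.ofReal_le_ofReal
            gcongr
            exact hr j hj
        _ = ENNReal.ofReal (t / 2) * ((ENNReal.ofReal (((2 : ℝ) ^ j) ^ d) * v) *
              lam (Ioi (k j * r))) := by
            rw [ENNReal.ofReal_mul (by positivity), ENNReal.ofReal_mul (by positivity),
              ENNReal.ofReal_mul (by positivity), ENNReal.ofReal_toReal hvtop,
              ENNReal.ofReal_toReal (measure_ne_top _ _)]
        _ ≤ _ := by
            gcongr
            exact ofReal_le_volume_annulus hd j
    refine le_trans (le_of_eq ?_) (Finset.sum_le_sum hterm)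
    rw [Finset.sum_const, Finset.card_range, nsmul_eq_mul, ENNReal.ofReal_mul (by positivity),
      ENNReal.ofReal_natCast]
  · intro i _ j _ hij
    refine disjoint_left.2 fun x hi hj => ?_
    exact disjoint_left.1 (hAd hij) hi.2.1 hj.2.1
  · intro j _
    exact measurableSet_Ioc.prod ((hAm j).prod measurableSet_Ioi)

theorem stmt15 (d : ℕ) (hd : 1 ≤ d) (α : ℝ) (hα : α ∈ Set.Ioo (0:ℝ) 2) (t : ℝ) (ht : 0 < t)
    (lam : MeasureTheory.Measure ℝ) [SigmaFinite lam]
    (hlam0 : lam (Set.Iic 0) = 0) (hlam_ne : lam ≠ 0)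
    (hmom : ∫⁻ z in Set.Ioi (0:ℝ), ENNReal.ofReal (min 1 (z ^ 2)) ∂lam ≠ ⊤)
    (g : ℝ → ℝ) (hg_cont : ContinuousOn g (Set.Ici 0))
    (hg_anti : StrictAntiOn g (Set.Ici 0)) (hg_pos : ∀ x : ℝ, 0 ≤ x → 0 < g x)
    (c₀ : ℝ) (hc₀ : 0 < c₀)
    (hg_tail : Filter.Tendsto (fun r : ℝ => r ^ ((d:ℝ) + α) * g r) Filter.atTop (nhds c₀))
    (hsmall : ∫⁻ z in Set.Ioc (0:ℝ) 1, ENNReal.ofReal (z ^ (1 + α / (d:ℝ))) ∂lam ≠ ⊤)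
    (hbig : ∫⁻ z in Set.Ioi (1:ℝ), ENNReal.ofReal (z ^ ((d:ℝ) / ((d:ℝ) + α))) ∂lam ≠ ⊤)
    -- the support of `λ` is contained in `[1,∞)`
    (hsupp : lam (Set.Iio 1) = 0)
    (l : ℝ → ℝ) (hl : SlowlyVarying l) (hl_pos : ∀ x : ℝ, 0 < x → 0 < l x)
    (hl_int : MeasureTheory.IntegrableOn (fun u => l u / u) (Set.Ioi (1:ℝ))
      MeasureTheory.volume)
    (hlaml : ∃ C : ℝ, 1 ≤ C ∧ ∀ r : ℝ, 1 ≤ r →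
      C⁻¹ * (l r / r ^ ((d:ℝ) / ((d:ℝ) + α))) ≤ (lam (Set.Ioi r)).toReal ∧
      (lam (Set.Ioi r)).toReal ≤ C * (l r / r ^ ((d:ℝ) / ((d:ℝ) + α)))) :
    (∃ C : ℝ, 1 ≤ C ∧ ∀ᶠ r : ℝ in Filter.atTop,
      C⁻¹ * (lam (Set.Ioi r)).toReal ≤ (etaZeroBar d α t g lam r).toReal ∧
      (etaZeroBar d α t g lam r).toReal ≤ C * (lam (Set.Ioi r)).toReal) ∧
    Filter.Tendsto
      (fun r : ℝ => (etaZeroBar d α t g lam r).toReal / (etaBar d α t g lam r).toReal)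
      Filter.atTop (nhds 0) := by
  have hα0 : 0 < α := hα.1
  have hd0 : (0 : ℝ) < d := by exact_mod_cast hd
  have hκ : 0 < (d : ℝ) + α := by linarith
  have hθ1 : (d : ℝ) / (d + α) < 1 := by rw [div_lt_one hκ]; linarith
  obtain ⟨C, hC, hF⟩ := hlaml
  have hfin : IsFiniteMeasure lam := by
    have h1 : lam (Ioi 1) ≠ ⊤ := fun htop => by
      have h2 := (hF 1 le_rfl).1
      have h3 := hl_pos 1 one_pos
      rw [htop, ENNReal.toReal_top, Real.one_rpow, div_one] at h2
      have : 0 < C⁻¹ * l 1 := by positivity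
      linarith
    have h2 : lam {1} ≠ ⊤ := by
      have h3 : lam {1} ≤ ∫⁻ z in Ioi (0:ℝ), ENNReal.ofReal (min 1 (z ^ 2)) ∂lam := calc
        lam {1} = ∫⁻ z in {(1 : ℝ)}, ENNReal.ofReal (min 1 (z ^ 2)) ∂lam := by simp
        _ ≤ _ := lintegral_mono_set (by simp)
      exact ne_top_of_le_ne_top hmom h3
    refine ⟨?_⟩
    have h4 : (univ : Set ℝ) ⊆ Iio 1 ∪ ({1} ∪ Ioi 1) := fun x _ => by
      rcases lt_trichotomy x 1 with h | h | h <;> simp [h]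
    calc lam univ ≤ lam (Iio 1) + (lam {1} + lam (Ioi 1)) :=
          (measure_mono h4).trans ((measure_union_le _ _).trans
            (by gcongr; exact measure_union_le _ _))
      _ < ⊤ := by
          rw [hsupp, zero_add]
          exact ENNReal.add_lt_top.2 ⟨h2.lt_top, h1.lt_top⟩
  have hanti : Antitone fun r => (lam (Ioi r)).toReal := fun r s hrs =>
    ENNReal.toReal_mono (measure_ne_top _ _) (measure_mono (Ioi_subset_Ioi hrs))
  obtain ⟨a, A, ha, hA, hgb⟩ := exists_profile_bounds hκ hc₀ hg_anti hg_pos hg_tail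
  obtain ⟨K, hK, hKF⟩ := exists_div_le (F := fun r => (lam (Ioi r)).toReal)
    (M := (lam univ).toReal) hC hθ1 hl hl_pos hanti (fun r => ENNReal.toReal_nonneg)
    (fun r => ENNReal.toReal_mono (measure_ne_top _ _) (measure_mono (subset_univ _))) hF
  obtain ⟨W, hW, hupp⟩ := exists_etaZeroBar_le (α := α) (t := t) (lt_add_of_pos_right (d : ℝ) hα0) hA
    (fun x hx => (hgb x hx).2) lam
  obtain ⟨c, hc, hlow⟩ := exists_le_etaZeroBar (d := d) hα0 ht ha hκ (fun x hx => (hgb x hx).1)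
    lam hC hl hl_pos hF
  obtain ⟨c', hc', hbar⟩ := exists_le_etaBar hd hα0 ht ha hκ (mul_div_cancel₀ (d : ℝ) hκ.ne')
    (fun x hx => (hgb x hx).1) lam hC hl hl_pos hF
  have hup : ∀ᶠ r : ℝ in atTop,
      etaZeroBar d α t g lam r ≤ ENNReal.ofReal (W * (K * (lam (Ioi r)).toReal)) := by
    filter_upwards [hKF, eventually_gt_atTop 0] with r hr hr0
    exact hupp r _ hr0 (by positivity) hr
  have hup' : ∀ᶠ r : ℝ in atTop,
      (etaZeroBar d α t g lam r).toReal ≤ W * K * (lam (Ioi r)).toReal := by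
    filter_upwards [hup] with r hr
    rw [mul_assoc]
    exact ENNReal.toReal_le_of_le_ofReal (by positivity) hr
  refine ⟨⟨max 1 (max c⁻¹ (W * K)), le_max_left _ _, ?_⟩, ?_⟩
  · filter_upwards [hup, hup', hlow] with r hr hr' hr2
    constructor
    · refine le_trans ?_ ((ENNReal.ofReal_le_iff_le_toReal
        (ne_top_of_le_ne_top ENNReal.ofReal_ne_top hr)).1 hr2)
      gcongr
      exact inv_le_of_inv_le₀ hc ((le_max_left _ _).trans (le_max_right _ _))
    · refine hr'.trans ?_
      gcongr
      exact (le_max_right _ _).trans (le_max_right _ _)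
  · rw [Metric.tendsto_nhds]
    intro ε hε
    obtain ⟨N, hN⟩ := exists_nat_gt (W * K / (c' * ε))
    have hN0 : (0 : ℝ) < N := lt_of_le_of_lt (by positivity) hN
    filter_upwards [hup', hbar N, eventually_ge_atTop 1] with r hr hr2 hr1
    rw [Real.dist_eq, sub_zero, abs_of_nonneg (by positivity)]
    by_cases htop : etaBar d α t g lam r = ⊤
    · simpa [htop] using hε
    · have h5 := (ENNReal.ofReal_le_iff_le_toReal htop).1 hr2
      have hr0 : 0 < r := by linarith
      have hFpos : 0 < (lam (Ioi r)).toReal := by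
        refine lt_of_lt_of_le ?_ (hF r hr1).1
        have := hl_pos r hr0
        positivity
      have h6 : 0 < N * (c' * (lam (Ioi r)).toReal) := by positivity
      rw [div_lt_iff₀ (h6.trans_le h5)]
      rw [div_lt_iff₀ (by positivity)] at hN
      calc (etaZeroBar d α t g lam r).toReal ≤ W * K * (lam (Ioi r)).toReal := hr
        _ < N * (c' * ε) * (lam (Ioi r)).toReal := by gcongr
        _ = ε * (N * (c' * (lam (Ioi r)).toReal)) := by ring
        _ ≤ _ := by gcongr
end
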